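/- (Cafure & Matera, 2006) Let q be a prime power, 𝔽_q the finite field with q elements, and let F ∈ 𝔽_q[x_1,…,x_n] (n ≥ 2) be an absolutely irreducible polynomial of total degree d ≥ 1. Let N = #{x ∈ 𝔽_q^n : F(x) = 0}. Then, as real numbers, |N − q^{n−1}| ≤ (d−1)(d−2)·q^{n−3/2} + 5·d^{13/3}·q^{n−2}. -/

import Mathlib

section

open Polynomial

/-- A bivariate polynomial has total degree at most `n`. -/
def TDeg {R : Type*} [CommRing R] (n : ℕ) (h : R[X][X]) : Prop :=
  ∀ i j, n < i + j → (h.coeff j).coeff i = 0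

namespace TDeg

section Ring
variable {R : Type*} [CommRing R]

theorem zero (n : ℕ) : TDeg n (0 : R[X][X]) := fun i j _ => by simp

theorem mono {n m : ℕ} (hnm : n ≤ m) {h : R[X][X]} (hh : TDeg n h) : TDeg m h :=
  fun i j hij => hh i j (by omega)

theorem add {n : ℕ} {g h : R[X][X]} (hg : TDeg n g) (hh : TDeg n h) : TDeg n (g + h) :=
  fun i j hij => by simp [hg i j hij, hh i j hij]

theorem neg {n : ℕ} {g : R[X][X]} (hg : TDeg n g) : TDeg n (-g) :=
  fun i j hij => by simp [hg i j hij]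

theorem sub {n : ℕ} {g h : R[X][X]} (hg : TDeg n g) (hh : TDeg n h) : TDeg n (g - h) :=
  fun i j hij => by simp [hg i j hij, hh i j hij]

theorem sum {ι : Type*} {n : ℕ} (s : Finset ι) (g : ι → R[X][X])
    (hg : ∀ a ∈ s, TDeg n (g a)) : TDeg n (∑ a ∈ s, g a) := fun i j hij => by
  rw [finsetSum_coeff, finsetSum_coeff]
  exact Finset.sum_eq_zero fun a ha => hg a ha i j hij

theorem mul {n m : ℕ} {g h : R[X][X]} (hg : TDeg n g) (hh : TDeg m h) :
    TDeg (n + m) (g * h) := fun i j hij => by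
  rw [coeff_mul, finsetSum_coeff]
  refine Finset.sum_eq_zero fun a ha => ?_
  rw [coeff_mul]
  refine Finset.sum_eq_zero fun b hb => ?_
  rw [Finset.HasAntidiagonal.mem_antidiagonal] at ha hb
  rcases lt_or_ge n (b.1 + a.1) with h1 | h1
  · rw [hg _ _ h1, zero_mul]
  · rw [hh _ _ (by omega), mul_zero]

theorem pow {n : ℕ} {g : R[X][X]} (hg : TDeg n g) (m : ℕ) : TDeg (m * n) (g ^ m) := by
  induction m with
  | zero => 
    intro i j hij
    rw [pow_zero, coeff_one]
    split_ifs with h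
    · rw [coeff_one, if_neg (by omega)]
    · simp
  | succ m ih =>
    rw [pow_succ, add_mul, one_mul]
    exact ih.mul hg

theorem monomial_iff (a : R) (i j n : ℕ) (hij : i + j ≤ n) :
    TDeg n (monomial j (monomial i a)) := fun i' j' hij' => by
  rw [coeff_monomial]
  split_ifs with h
  · rw [coeff_monomial, if_neg (by omega)]
  · simp

theorem CC (a : R) (n : ℕ) : TDeg n (C (C a) : R[X][X]) := by
  simpa using monomial_iff a 0 0 n (by omega)

theorem Y : TDeg 1 (X : R[X][X]) := by
  simpa [← C_mul_X_pow_eq_monomial] using monomial_iff (1 : R) 0 1 1 (by omega)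

theorem CX : TDeg 1 (C X : R[X][X]) := by
  simpa [← C_mul_X_pow_eq_monomial] using monomial_iff (1 : R) 1 0 1 (by omega)

theorem natDegree_le {n : ℕ} {h : R[X][X]} (hh : TDeg n h) : h.natDegree ≤ n := by
  rw [natDegree_le_iff_coeff_eq_zero]
  intro N hN
  ext i
  exact hh i N (by omega)

theorem natDegree_coeff_le {n : ℕ} {h : R[X][X]} (hh : TDeg n h) (j : ℕ) :
    (h.coeff j).natDegree ≤ n - j := by
  rw [natDegree_le_iff_coeff_eq_zero]
  intro N hN
  exact hh N j (by omega)

theorem derivative {n : ℕ} {h : R[X][X]} (hh : TDeg n h) :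
    TDeg (n - 1) (Polynomial.derivative h) := fun i j hij => by
  rw [coeff_derivative]
  have := hh i (j + 1) (by omega)
  have h2 : ((j : R[X]) + 1) = C ((j : R) + 1) := by simp
  rw [h2, coeff_mul_C, this, zero_mul]

theorem map {S : Type*} [CommRing S] (φ : R →+* S) {n : ℕ} {h : R[X][X]} (hh : TDeg n h) :
    TDeg n (h.map (mapRingHom φ)) := fun i j hij => by
  simp [hh i j hij]

theorem of_map {S : Type*} [CommRing S] (φ : R →+* S) (hφ : Function.Injective φ)
    {n : ℕ} {h : R[X][X]} (hh : TDeg n (h.map (mapRingHom φ))) : TDeg n h := fun i j hij => by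
  have := hh i j hij
  rw [coeff_map, coe_mapRingHom, coeff_map] at this
  exact hφ (by rw [this, map_zero])

theorem exists_tDeg (h : R[X][X]) : ∃ n, TDeg n h := by
  refine ⟨h.natDegree + ∑ j ∈ h.support, (h.coeff j).natDegree, fun i j hij => ?_⟩
  by_cases hj : j ∈ h.support
  · apply coeff_eq_zero_of_natDegree_lt
    have h1 := Finset.single_le_sum (f := fun j => (h.coeff j).natDegree)
      (fun _ _ => Nat.zero_le _) hj
    have h2 := le_natDegree_of_mem_supp _ hj
    omega
  · rw [notMem_support_iff.mp hj, coeff_zero]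

/-- Division by a monic polynomial whose total degree is its `Y`-degree does not increase the
total degree. -/
theorem modByMonic {d : ℕ} {f : R[X][X]} (hf : f.Monic) (hfd : f.natDegree = d)
    (hft : TDeg d f) {n : ℕ} {g : R[X][X]} (hg : TDeg n g) : TDeg n (g %ₘ f) := by
  rcases subsingleton_or_nontrivial R with hR | hR
  · intro i j _; exact Subsingleton.elim _ _
  have key : ∀ N, ∀ g : R[X][X], g.natDegree < N → TDeg n g →
      TDeg n (g %ₘ f) := by
    intro N
    induction N with
    | zero => intro g hN; omega
    | succ N ih =>
      intro g hN hg
      by_cases hlt : g.degree < f.degree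
      · rwa [(modByMonic_eq_self_iff hf).mpr hlt]
      rw [not_lt] at hlt
      by_cases hg0 : g = 0
      · simpa [hg0] using TDeg.zero n
      have hdn : d ≤ g.natDegree := by rw [← hfd]; exact natDegree_le_natDegree hlt
      have hmul : TDeg (n - d) (C g.leadingCoeff * X ^ (g.natDegree - d) : R[X][X]) := by
        intro i j hij
        rw [coeff_C_mul_X_pow]
        split_ifs with h
        · exact hg i g.natDegree (by omega)
        · simp
      have hnd : d ≤ n := hdn.trans hg.natDegree_le
      have h1 := hmul.mul hft
      rw [Nat.sub_add_cancel hnd] at h1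
      set g' := g - (C g.leadingCoeff * X ^ (g.natDegree - d)) * f with hg'
      have hdeg : g'.degree < g.degree := by
        have := div_wf_lemma ⟨hlt, hg0⟩ hf
        rw [hfd] at this
        rwa [hg', mul_comm]
      have e : g %ₘ f = g' %ₘ f := by
        rw [hg', sub_modByMonic, (modByMonic_eq_zero_iff_dvd hf).mpr (dvd_mul_left _ _), sub_zero]
      rw [e]
      by_cases hg'0 : g' = 0
      · simpa [hg'0] using TDeg.zero n
      refine ih g' ?_ (hg.sub h1)
      have := natDegree_lt_natDegree hg'0 hdeg
      omega
  exact key _ g (Nat.lt_succ_self _) hg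

end Ring

section Weighted
variable {R : Type*} [CommRing R]

/-- The substitution `X ↦ X * Y`, `Y ↦ Y`, turning total degree into `Y`-degree. -/
noncomputable def blow : R[X][X] →+* R[X][X] :=
  eval₂RingHom (eval₂RingHom (C.comp C) (C X * X)) X

theorem coeff_blow (h : R[X][X]) (n i : ℕ) :
    ((blow h).coeff n).coeff i = if i ≤ n then (h.coeff (n - i)).coeff i else 0 := by
  induction h using Polynomial.induction_on' with
  | add p q hp hq => rw [map_add, coeff_add, coeff_add, hp, hq]; split_ifs <;> simp
  | monomial j p =>
    induction p using Polynomial.induction_on' with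
    | add p q hp hq => 
      rw [map_add, map_add, coeff_add, coeff_add, hp, hq]; split_ifs <;> simp
    | monomial i' a =>
      have : blow (monomial j (monomial i' a)) = monomial (i' + j) (monomial i' a) := by
        simp only [blow, coe_eval₂RingHom, eval₂_monomial, RingHom.comp_apply, mul_pow]
        simp only [← C_mul_X_pow_eq_monomial, C_mul, C_pow]
        ring
      rw [this]
      simp only [coeff_monomial]
      by_cases h1 : i ≤ n
      · rw [if_pos h1]
        by_cases h2 : i' = i
        · subst h2
          by_cases h3 : j = n - i'
          · rw [if_pos (by omega), if_pos h3]
          · rw [if_neg (by omega), if_neg h3]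
        · split_ifs <;> simp [h2, coeff_monomial]
      · rw [if_neg h1]
        split_ifs
        · rw [coeff_monomial, if_neg (by omega)]
        · simp

theorem iff_blow (h : R[X][X]) (n : ℕ) : TDeg n h ↔ (blow h).natDegree ≤ n := by
  rw [natDegree_le_iff_coeff_eq_zero]
  constructor
  · intro hh N hN
    ext i
    rw [coeff_blow]
    split_ifs with hi
    · exact hh i (N - i) (by omega)
    · simp
  · intro hh i j hij
    have := congrArg (fun p => p.coeff i) (hh (i + j) hij)
    simp only [coeff_blow, coeff_zero] at this
    rwa [if_pos (by omega), Nat.add_sub_cancel_left] at this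

theorem blow_injective : Function.Injective (blow : R[X][X] →+* R[X][X]) := by
  rw [injective_iff_map_eq_zero]
  intro h hh
  ext j i
  have := coeff_blow h (i + j) i
  rw [hh, if_pos (by omega), Nat.add_sub_cancel_left] at this
  simpa using this.symm

/-- Monic factors of a polynomial whose total degree equals its `Y`-degree have the same property. -/
theorem of_mul [IsDomain R] {g h : R[X][X]} (hg : g.Monic) (hh : h.Monic)
    (hgh : TDeg (g * h).natDegree (g * h)) : TDeg g.natDegree g := by
  rw [iff_blow, map_mul, natDegree_mul, hg.natDegree_mul hh] at hgh
  · rw [iff_blow]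
    have : h.natDegree ≤ (blow h).natDegree := by
      exact ((iff_blow h _).mpr le_rfl).natDegree_le
    omega
  · rw [Ne, map_eq_zero_iff _ blow_injective]; exact hg.ne_zero
  · rw [Ne, map_eq_zero_iff _ blow_injective]; exact hh.ne_zero

end Weighted
end TDeg

/-- The polynomial is monic of degree `d` in `Y` and of total degree `d`. -/
structure Good {R : Type*} [CommRing R] (d : ℕ) (f : R[X][X]) : Prop where
  monic : f.Monic
  natDegree : f.natDegree = d
  tDeg : TDeg d f

namespace Good
variable {R : Type*} [CommRing R]

theorem map {S : Type*} [CommRing S] [Nontrivial S] (φ : R →+* S) {d : ℕ} {f : R[X][X]} (hf : Good d f) :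
    Good d (f.map (mapRingHom φ)) :=
  ⟨hf.monic.map _, by rw [hf.monic.natDegree_map, hf.natDegree], hf.tDeg.map φ⟩

theorem of_dvd [IsDomain R] {d : ℕ} {f g : R[X][X]} (hf : Good d f) (hg : g.Monic) (h : g ∣ f) :
    Good g.natDegree g := by
  obtain ⟨h, rfl⟩ := h
  have hh : h.Monic := hg.of_mul_monic_left hf.monic
  refine ⟨hg, rfl, TDeg.of_mul hg hh ?_⟩
  rw [hf.natDegree]; exact hf.tDeg

end Good

end

section

open Polynomial

section Boxes
variable (k : Type*) [Field k]

/-- Bivariate polynomials of `Y`-degree less than `d` and total degree at most `n`. -/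
def box (d n : ℕ) : Submodule k k[X][X] where
  carrier := {h | TDeg n h ∧ ∀ j, d ≤ j → h.coeff j = 0}
  zero_mem' := ⟨TDeg.zero n, fun j _ => by simp⟩
  add_mem' := fun ha hb => ⟨ha.1.add hb.1, fun j hj => by simp [ha.2 j hj, hb.2 j hj]⟩
  smul_mem' := fun c h hh => ⟨fun i j hij => by simp [hh.1 i j hij],
    fun j hj => by simp [hh.2 j hj]⟩

/-- The exponents `(i, j)` occurring in `box k d n`. -/
def boxIndex (d n : ℕ) : Finset (ℕ × ℕ) :=
  (Finset.range d).biUnion fun j => (Finset.range (n + 1 - j)).image fun i => (i, j)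

theorem mem_boxIndex {d n : ℕ} {p : ℕ × ℕ} : p ∈ boxIndex d n ↔ p.2 < d ∧ p.1 + p.2 ≤ n := by
  obtain ⟨i, j⟩ := p
  simp only [boxIndex, Finset.mem_biUnion, Finset.mem_range, Finset.mem_image, Prod.mk.injEq]
  constructor
  · rintro ⟨j', h1, i', h2, rfl, rfl⟩; omega
  · rintro ⟨h1, h2⟩; exact ⟨j, h1, i, by omega, rfl, rfl⟩

theorem card_boxIndex (d n : ℕ) : (boxIndex d n).card = ∑ j ∈ Finset.range d, (n + 1 - j) := by
  rw [boxIndex, Finset.card_biUnion]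
  · refine Finset.sum_congr rfl fun j _ => ?_
    rw [Finset.card_image_of_injective, Finset.card_range]
    intro a b h; simpa using h
  · intro a _ b _ hab
    simp only [Function.onFun, Finset.disjoint_left, Finset.mem_image, Finset.mem_range]
    rintro x ⟨i, _, rfl⟩ ⟨i', _, h⟩
    simp only [Prod.mk.injEq] at h
    exact hab h.2.symm

theorem card_boxIndex_sub {d n e : ℕ} (h : d + e ≤ n + 1) :
    (boxIndex d n).card = (boxIndex d (n - e)).card + d * e := by
  rw [card_boxIndex, card_boxIndex, ← smul_eq_mul, ← Finset.card_range d, ← Finset.sum_const,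
    Finset.card_range, ← Finset.sum_add_distrib]
  refine Finset.sum_congr rfl fun j hj => ?_
  rw [Finset.mem_range] at hj
  omega

/-- Coordinates on `box k d n`. -/
noncomputable def boxEquiv (d n : ℕ) : box k d n ≃ₗ[k] (boxIndex d n → k) where
  toFun h p := (h.1.coeff p.1.2).coeff p.1.1
  map_add' _ _ := by ext; simp
  map_smul' _ _ := by ext; simp
  invFun v := ⟨∑ p, monomial p.1.2 (monomial p.1.1 (v p)), by
    refine Submodule.sum_mem _ fun p _ => ?_
    have := mem_boxIndex.mp p.2
    refine ⟨TDeg.monomial_iff _ _ _ _ this.2, fun j hj => ?_⟩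
    rw [coeff_monomial, if_neg (by omega)]⟩
  left_inv h := by
    ext j i
    simp only [finsetSum_coeff, coeff_monomial]
    by_cases hp : (i, j) ∈ boxIndex d n
    · rw [Finset.sum_eq_single ⟨(i, j), hp⟩]
      · simp
      · intro p _ hne
        split_ifs with h1
        · rw [coeff_monomial, if_neg]
          intro h2
          exact hne (Subtype.ext (Prod.ext h2 h1))
        · simp
      · simp
    · rw [Finset.sum_eq_zero]
      · rw [mem_boxIndex, not_and_or] at hp
        rcases hp with hp | hp
        · rw [h.2.2 j (by simpa using hp), coeff_zero]
        · exact (h.2.1 i j (by simpa using hp)).symm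
      · intro p _
        split_ifs with h1
        · rw [coeff_monomial, if_neg]
          intro h2
          exact hp (by rw [← h2, ← h1]; exact p.2)
        · simp
  right_inv v := by
    ext p
    simp only [finsetSum_coeff, coeff_monomial]
    rw [Finset.sum_eq_single p]
    · simp
    · intro q _ hne
      split_ifs with h1
      · rw [coeff_monomial, if_neg]
        intro h2
        exact hne (Subtype.ext (Prod.ext h2 h1))
      · simp
    · simp

instance (d n : ℕ) : FiniteDimensional k (box k d n) :=
  (boxEquiv k d n).symm.finiteDimensional

theorem finrank_box (d n : ℕ) : Module.finrank k (box k d n) = (boxIndex d n).card := by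
  rw [(boxEquiv k d n).finrank_eq, Module.finrank_fintype_fun_eq_card, Fintype.card_coe]

variable {k}

theorem mem_box_iff {d n : ℕ} {h : k[X][X]} : h ∈ box k d n ↔ TDeg n h ∧ h.degree < d := by
  rw [degree_lt_iff_coeff_zero]; rfl

theorem modByMonic_mem_box {d : ℕ} {f : k[X][X]} (hf : Good d f) {n : ℕ} {g : k[X][X]}
    (hg : TDeg n g) : g %ₘ f ∈ box k d n := by
  rw [mem_box_iff]
  refine ⟨TDeg.modByMonic hf.monic hf.natDegree hf.tDeg hg, ?_⟩
  have := degree_modByMonic_lt g hf.monic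
  rwa [degree_eq_natDegree hf.monic.ne_zero, hf.natDegree] at this

/-- Bezout's theorem, for quotient algebras. -/
theorem bezout_finrank {d e : ℕ} {f h : k[X][X]} (hf : Good d f) (hirr : Irreducible f)
    (hh : TDeg e h) (hfh : ¬ f ∣ h) {V : Type*} [AddCommGroup V] [Module k V] [FiniteDimensional k V]
    (φ : k[X][X] →ₗ[k] V) (hφ : Function.Surjective φ) (h1 : ∀ g, φ (f * g) = 0)
    (h2 : ∀ g, φ (h * g) = 0) : Module.finrank k V ≤ d * e := by
  have hmod : ∀ g, φ (g %ₘ f) = φ g := fun g => by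
    conv_rhs => rw [← modByMonic_add_div g f, map_add, h1, add_zero]
  have hn : ∃ n, d + e ≤ n + 1 ∧ ∀ c, ∃ g ∈ box k d n, φ g = c := by
    let b := Module.finBasis k V
    choose g hg using fun i => hφ (b i)
    choose m hm using fun i => TDeg.exists_tDeg (g i)
    refine ⟨d + e + ∑ i, m i, by omega, fun c => ?_⟩
    refine ⟨∑ i, (b.repr c i) • (g i %ₘ f), Submodule.sum_mem _ fun i _ =>
      Submodule.smul_mem _ _ (modByMonic_mem_box hf ((hm i).mono ?_)), ?_⟩
    · have := Finset.single_le_sum (f := m) (fun _ _ => Nat.zero_le _) (Finset.mem_univ i)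
      omega
    · rw [map_sum]
      simp only [map_smul, hmod, hg]
      exact b.sum_repr c
  obtain ⟨n, hne, hn⟩ := hn
  let ψ : box k d n →ₗ[k] V := φ.comp (box k d n).subtype
  have hψ : LinearMap.range ψ = ⊤ := by
    rw [LinearMap.range_eq_top]
    intro c
    obtain ⟨g, hg, rfl⟩ := hn c
    exact ⟨⟨g, hg⟩, rfl⟩
  have hrank := LinearMap.finrank_range_add_finrank_ker (K := k) (V := box k d n) (V₂ := V) ψ
  rw [hψ, finrank_top, finrank_box, card_boxIndex_sub hne, ← finrank_box k] at hrank
  have hmem : ∀ w ∈ box k d (n - e), (h * w) %ₘ f ∈ box k d n := fun w hw => by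
    have := modByMonic_mem_box hf (hh.mul hw.1)
    rwa [Nat.add_sub_cancel' (by
      by_contra hlt
      have hd : d = 0 := by omega
      exact hirr.not_isUnit (by
        rw [hf.monic.natDegree_eq_zero.mp (by rw [hf.natDegree, hd])]; exact isUnit_one))] at this
  let θ : box k d (n - e) →ₗ[k] LinearMap.ker ψ :=
    { toFun := fun w => ⟨⟨(h * w.1) %ₘ f, hmem w.1 w.2⟩, by
        rw [LinearMap.mem_ker]
        change φ ((h * w.1) %ₘ f) = 0
        rw [hmod, h2]⟩
      map_add' := fun a b => by
        ext1; ext1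
        change (h * (a.1 + b.1)) %ₘ f = (h * a.1) %ₘ f + (h * b.1) %ₘ f
        rw [mul_add, add_modByMonic]
      map_smul' := fun c a => by
        ext1; ext1
        change (h * (c • a.1)) %ₘ f = c • ((h * a.1) %ₘ f)
        have : c • ((h * a.1) %ₘ f) = (C c : k[X]) • ((h * a.1) %ₘ f) := by
          ext; simp
        rw [this, ← smul_modByMonic]
        congr 1
        have h3 : ∀ v : k[X][X], c • v = C (C c) * v := fun v => by
          ext; simp
        rw [h3, smul_eq_C_mul, mul_left_comm] }
  have hθ : Function.Injective θ := by
    rw [injective_iff_map_eq_zero]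
    intro w hw
    have h3 : (h * w.1) %ₘ f = 0 := congrArg (fun x => x.1.1) hw
    rw [modByMonic_eq_zero_iff_dvd hf.monic] at h3
    rcases hirr.prime.dvd_or_dvd h3 with h4 | h4
    · exact absurd h4 hfh
    · by_contra hw0
      have hw1 : w.1 ≠ 0 := fun h => hw0 (Subtype.ext h)
      have h5 := degree_le_of_dvd h4 hw1
      have h6 := (mem_box_iff.mp w.2).2
      rw [degree_eq_natDegree hf.monic.ne_zero, hf.natDegree] at h5
      exact absurd h6 (not_lt.mpr h5)
  have : IsNoetherian k (box k d n) := isNoetherian_of_linearEquiv (boxEquiv k d n).symm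
  have : Module.Finite k (LinearMap.ker ψ) :=
    Module.Finite.of_injective (LinearMap.ker ψ).subtype (Submodule.subtype_injective _)
  have := LinearMap.finrank_le_finrank_of_injective hθ
  omega

/-- Bezout's theorem: a bound for the number of common zeros. -/
theorem bezout_card {d e : ℕ} {f h : k[X][X]} (hf : Good d f) (hirr : Irreducible f)
    (hh : TDeg e h) (hfh : ¬ f ∣ h) (S : Finset (k × k))
    (h1 : ∀ p ∈ S, (f.evalEval p.1 p.2) = 0) (h2 : ∀ p ∈ S, (h.evalEval p.1 p.2) = 0) :
    S.card ≤ d * e := by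
  let φ : k[X][X] →ₐ[k] (S → k) := AlgHom.pi fun p =>
    { evalEvalRingHom p.1.1 p.1.2 with commutes' := fun c => by simp [Polynomial.algebraMap_apply] }
  have hφ : ∀ g p, φ g p = g.evalEval p.1.1 p.1.2 := fun g p => rfl
  have hsurj : Function.Surjective φ := by
    classical
    have hsep : ∀ p : S, ∃ g, φ g = Pi.single p 1 := by
      intro p
      refine ⟨∏ q ∈ Finset.univ.erase p, if q.1.1 = p.1.1
        then C (C (p.1.2 - q.1.2)⁻¹) * (X - C (C q.1.2))
        else C (C (p.1.1 - q.1.1)⁻¹) * (C X - C (C q.1.1)), ?_⟩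
      ext r
      rw [map_prod, Finset.prod_apply]
      by_cases hr : r = p
      · subst hr
        rw [Pi.single_eq_same]
        refine Finset.prod_eq_one fun q hq => ?_
        have hq := Finset.ne_of_mem_erase hq
        rw [hφ]
        split_ifs with h
        · have : r.1.2 - q.1.2 ≠ 0 := fun h' =>
            hq (Subtype.ext (Prod.ext h (sub_eq_zero.mp h').symm))
          simp [evalEval_C, this]
        · have : r.1.1 - q.1.1 ≠ 0 := fun h' => h (sub_eq_zero.mp h').symm
          simp [evalEval_C, this]
      · rw [Pi.single_eq_of_ne hr]
        refine Finset.prod_eq_zero (Finset.mem_erase.mpr ⟨hr, Finset.mem_univ _⟩) ?_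
        rw [hφ]
        split_ifs <;> simp [evalEval_C]
    choose g hg using hsep
    intro v
    refine ⟨∑ p, v p • g p, ?_⟩
    rw [map_sum]
    simp only [map_smul, hg]
    ext r
    simp [Pi.single_apply]
  have := bezout_finrank hf hirr hh hfh φ.toLinearMap hsurj
    (fun g => by
      ext p
      change φ (f * g) p = 0
      rw [map_mul, Pi.mul_apply, hφ, h1 p.1 p.2, zero_mul])
    (fun g => by
      ext p
      change φ (h * g) p = 0
      rw [map_mul, Pi.mul_apply, hφ, h2 p.1 p.2, zero_mul])
  simpa using this

/-- Bezout's theorem: a bound for the order of vanishing along a branch. -/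
theorem bezout_order {d e : ℕ} {f h : k[X][X]} (hf : Good d f) (hirr : Irreducible f)
    (hh : TDeg e h) (hfh : ¬ f ∣ h) (ψ : k[X][X] →ₐ[k] PowerSeries k)
    (hX : ψ (C X) = PowerSeries.X) (h1 : ψ f = 0) :
    ∃ m ≤ d * e, PowerSeries.coeff m (ψ h) ≠ 0 := by
  by_contra! hcon
  let φ : k[X][X] →ₗ[k] (Fin (d * e + 1) → k) :=
    LinearMap.pi fun i => (PowerSeries.coeff (R := k) i.1).comp ψ.toLinearMap
  have hφ : ∀ g i, φ g i = PowerSeries.coeff i.1 (ψ g) := fun _ _ => rfl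
  have hsurj : Function.Surjective φ := by
    intro v
    refine ⟨∑ i, v i • (C X) ^ i.1, ?_⟩
    ext i
    rw [hφ, map_sum, map_sum]
    simp only [map_smul, map_pow, hX, PowerSeries.coeff_X_pow, smul_eq_mul]
    rw [Finset.sum_eq_single i]
    · simp
    · intro j _ hj
      rw [if_neg (fun h => hj (Fin.ext h.symm)), mul_zero]
    · simp
  have := bezout_finrank hf hirr hh hfh φ hsurj
    (fun g => by ext i; rw [hφ, map_mul, h1, zero_mul]; simp)
    (fun g => by
      ext i
      rw [hφ, map_mul, PowerSeries.coeff_mul, Pi.zero_apply]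
      refine Finset.sum_eq_zero fun p hp => ?_
      rw [Finset.HasAntidiagonal.mem_antidiagonal] at hp
      rw [hcon p.1 (by have := i.2; omega), zero_mul])
  rw [Module.finrank_fintype_fun_eq_card, Fintype.card_fin] at this
  omega

end Boxes

end

section

open Polynomial

/-- Newton iteration with constant slope for a root of `G` in a power series ring. -/
noncomputable def newtonSeq {S : Type*} [CommRing S] (G : (PowerSeries S)[X]) (ζ v : S) :
    ℕ → PowerSeries S
  | 0 => PowerSeries.C ζ
  | n + 1 => newtonSeq G ζ v n - PowerSeries.C v * G.eval (newtonSeq G ζ v n)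

section
variable {S : Type*} [CommRing S] (G : (PowerSeries S)[X]) (ζ v : S)

theorem newtonSeq_spec (h0 : PowerSeries.constantCoeff (G.eval (PowerSeries.C ζ)) = 0)
    (h1 : v * PowerSeries.constantCoeff ((derivative G).eval (PowerSeries.C ζ)) = 1) (n : ℕ) :
    PowerSeries.X ∣ newtonSeq G ζ v n - PowerSeries.C ζ ∧
      PowerSeries.X ^ (n + 1) ∣ G.eval (newtonSeq G ζ v n) := by
  induction n with
  | zero =>
    refine ⟨by simp [newtonSeq], ?_⟩
    rw [zero_add, pow_one, PowerSeries.X_dvd_iff]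
    exact h0
  | succ n ih =>
    obtain ⟨ih1, ih2⟩ := ih
    set α := newtonSeq G ζ v n with hα
    have e : newtonSeq G ζ v (n + 1) = α + (- (PowerSeries.C v * G.eval α)) := by
      rw [newtonSeq, sub_eq_add_neg]
    constructor
    · rw [e, add_sub_right_comm]
      refine dvd_add ih1 (dvd_neg.mpr (Dvd.dvd.mul_left ?_ _))
      exact (dvd_pow_self _ (Nat.succ_ne_zero n)).trans ih2
    · have h2 := Polynomial.binomExpansion G α (- (PowerSeries.C v * G.eval α))
      obtain ⟨w, hw⟩ := h2
      rw [e, hw]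
      have h3 : PowerSeries.X ∣ 1 - PowerSeries.C v * (derivative G).eval α := by
        have h4 : PowerSeries.X ∣ (derivative G).eval α - (derivative G).eval (PowerSeries.C ζ) :=
          ih1.trans (Polynomial.sub_dvd_eval_sub _ _ _)
        rw [PowerSeries.X_dvd_iff] at h4 ⊢
        rw [map_sub, sub_eq_zero] at h4
        rw [map_sub, map_mul, h4, PowerSeries.constantCoeff_C, h1, map_one, sub_self]
      have h5 : G.eval α + (derivative G).eval α * -(PowerSeries.C v * G.eval α) +
          w * (-(PowerSeries.C v * G.eval α)) ^ 2 =
          G.eval α * (1 - PowerSeries.C v * (derivative G).eval α) +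
          G.eval α * G.eval α * (w * PowerSeries.C v ^ 2) := by ring
      rw [h5, pow_succ]
      refine dvd_add (mul_dvd_mul ih2 h3) (Dvd.dvd.mul_right (mul_dvd_mul ih2 ?_) _)
      exact (dvd_pow_self _ (Nat.succ_ne_zero n)).trans ih2

theorem exists_powerSeries_root
    (h0 : PowerSeries.constantCoeff (G.eval (PowerSeries.C ζ)) = 0)
    (h1 : v * PowerSeries.constantCoeff ((derivative G).eval (PowerSeries.C ζ)) = 1)
    (B : Subring (PowerSeries S)) (hB : ∀ i, G.coeff i ∈ B) (hζ : PowerSeries.C ζ ∈ B)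
    (hv : PowerSeries.C v ∈ B) :
    ∃ α : PowerSeries S, PowerSeries.constantCoeff α = ζ ∧ G.eval α = 0 ∧
      ∀ k, ∃ β ∈ B, PowerSeries.coeff k α = PowerSeries.coeff k β := by
  have hmem : ∀ n, newtonSeq G ζ v n ∈ B := by
    intro n
    induction n with
    | zero => exact hζ
    | succ n ih =>
      refine B.sub_mem ih (B.mul_mem hv ?_)
      rw [eval_eq_sum, Polynomial.sum]
      exact B.sum_mem fun i _ => B.mul_mem (hB i) (B.pow_mem ih i)
  have hspec := newtonSeq_spec G ζ v h0 h1
  have hstab : ∀ n m, n ≤ m → PowerSeries.X ^ (n + 1) ∣ newtonSeq G ζ v m - newtonSeq G ζ v n := by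
    intro n m hnm
    induction m, hnm using Nat.le_induction with
    | base => simp
    | succ m hm ih =>
      have : newtonSeq G ζ v (m + 1) - newtonSeq G ζ v n =
          (newtonSeq G ζ v m - newtonSeq G ζ v n) - PowerSeries.C v * G.eval (newtonSeq G ζ v m) := by
        rw [newtonSeq]; ring
      rw [this]
      refine dvd_sub ih (Dvd.dvd.mul_left ((pow_dvd_pow _ (by omega)).trans (hspec m).2) _)
  let α : PowerSeries S := PowerSeries.mk fun k => PowerSeries.coeff k (newtonSeq G ζ v k)
  have hα : ∀ n, PowerSeries.X ^ (n + 1) ∣ α - newtonSeq G ζ v n := by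
    intro n
    rw [PowerSeries.X_pow_dvd_iff]
    intro k hk
    have := PowerSeries.X_pow_dvd_iff.mp (hstab k n (by omega)) k (by omega)
    rw [map_sub, sub_eq_zero] at this
    rw [map_sub, PowerSeries.coeff_mk, this, sub_self]
  refine ⟨α, ?_, ?_, fun k => ⟨_, hmem k, by rw [PowerSeries.coeff_mk]⟩⟩
  · rw [← PowerSeries.coeff_zero_eq_constantCoeff_apply, PowerSeries.coeff_mk, newtonSeq,
      PowerSeries.coeff_zero_C]
  · ext n
    have h3 : PowerSeries.X ^ (n + 1) ∣ G.eval α := by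
      have := (hα n).trans (Polynomial.sub_dvd_eval_sub _ _ G)
      exact (dvd_iff_dvd_of_dvd_sub this).mpr (hspec n).2
    rw [map_zero]
    exact PowerSeries.X_pow_dvd_iff.mp h3 n (Nat.lt_succ_self n)

end

section Branch
variable {S : Type*} [CommRing S]

/-- Substitution of a power series for `Y` and of the variable for `X`. -/
noncomputable def branch (α : PowerSeries S) : S[X][X] →ₐ[S] PowerSeries S :=
  { eval₂RingHom (Polynomial.coeToPowerSeries.ringHom) α with
    commutes' := fun r => by
      simp [Polynomial.algebraMap_apply, Polynomial.coeToPowerSeries.ringHom_apply] }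

theorem branch_apply (α : PowerSeries S) (h : S[X][X]) :
    branch α h = (h.map (Polynomial.coeToPowerSeries.ringHom)).eval α := by
  rw [eval_map]; rfl

@[simp] theorem branch_X (α : PowerSeries S) : branch α X = α := by
  rw [branch_apply]; simp

@[simp] theorem branch_C (α : PowerSeries S) (p : S[X]) : branch α (C p) = (p : PowerSeries S) := by
  rw [branch_apply]; simp

theorem constantCoeff_branch (α : PowerSeries S) (h : S[X][X]) :
    PowerSeries.constantCoeff (branch α h) = h.evalEval 0 (PowerSeries.constantCoeff α) := by
  have : ((PowerSeries.constantCoeff (R := S)).comp (branch α : S[X][X] →+* PowerSeries S)) =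
      evalEvalRingHom 0 (PowerSeries.constantCoeff α) := by
    ext
    · simp
    · simp
    · simp
  exact congrArg (fun φ => φ h) this

end Branch

end

section

open Polynomial

theorem card_boxIndex_le (d n : ℕ) : (boxIndex d n).card ≤ d * (n + 1) := by
  rw [card_boxIndex, ← smul_eq_mul, ← Finset.card_range d, ← Finset.sum_const, Finset.card_range]
  exact Finset.sum_le_sum fun j _ => Nat.sub_le _ _

theorem le_card_boxIndex (d n : ℕ) : d * (n + 1 - d) ≤ (boxIndex d n).card := by
  rw [card_boxIndex, ← smul_eq_mul, ← Finset.card_range d, ← Finset.sum_const, Finset.card_range]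
  refine Finset.sum_le_sum fun j hj => ?_
  rw [Finset.mem_range] at hj
  omega

section
variable {k : Type*} [Field k]

theorem not_dvd_of_mem_box {d n : ℕ} {f g : k[X][X]} (hf : Good d f) (hg : g ∈ box k d n)
    (hg0 : g ≠ 0) : ¬ f ∣ g := by
  intro h
  have h5 := degree_le_of_dvd h hg0
  have h6 := (mem_box_iff.mp hg).2
  rw [degree_eq_natDegree hf.monic.ne_zero, hf.natDegree] at h5
  exact absurd h6 (not_lt.mpr h5)

/-- The monomial `X ^ i * Y ^ j`. -/
noncomputable def xy (p : ℕ × ℕ) : k[X][X] := monomial p.2 (monomial p.1 1)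

theorem xy_mem_box {d n : ℕ} {p : ℕ × ℕ} (hp : p ∈ boxIndex d n) : (xy p : k[X][X]) ∈ box k d n := by
  have := mem_boxIndex.mp hp
  refine ⟨TDeg.monomial_iff _ _ _ _ this.2, fun j hj => ?_⟩
  rw [xy, coeff_monomial, if_neg (by omega)]

theorem evalEval_xy (p : ℕ × ℕ) (a b : k) : (xy p : k[X][X]).evalEval a b = a ^ p.1 * b ^ p.2 := by
  simp [xy, evalEval, eval_monomial]

theorem sum_smul_xy (d n : ℕ) (v : boxIndex d n → k) :
    ∑ p, v p • (xy p.1 : k[X][X]) = ((boxEquiv k d n).symm v).1 := by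
  change _ = ∑ p : boxIndex d n, monomial p.1.2 (monomial p.1.1 (v p))
  refine Finset.sum_congr rfl fun p _ => ?_
  simp [xy, smul_monomial]

theorem eq_sum_of_mem_box {d n : ℕ} {g : k[X][X]} (hg : g ∈ box k d n) :
    ∃ v : boxIndex d n → k, g = ∑ p, v p • (xy p.1 : k[X][X]) := by
  refine ⟨boxEquiv k d n ⟨g, hg⟩, ?_⟩
  rw [sum_smul_xy, LinearEquiv.symm_apply_apply]

theorem sum_smul_xy_ne_zero {d n : ℕ} {v : boxIndex d n → k} (hv : v ≠ 0) :
    ∑ p, v p • (xy p.1 : k[X][X]) ≠ 0 := by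
  rw [sum_smul_xy]
  intro h
  apply hv
  have : (boxEquiv k d n).symm v = 0 := Subtype.ext h
  simpa using this

theorem sum_smul_xy_mem_box {d n : ℕ} (v : boxIndex d n → k) :
    ∑ p, v p • (xy p.1 : k[X][X]) ∈ box k d n :=
  Submodule.sum_mem _ fun p _ => Submodule.smul_mem _ _ (xy_mem_box p.2)

/-- Functions `g(x, y) z ^ m` on a finite set of points of a double cover of the curve lie in a
space of small dimension. -/
theorem mem_span_monomials {d e : ℕ} {f : k[X][X]} (hf : Good d f) {ι : Type*} (x y z : ι → k)
    (h0 : ∀ s, f.evalEval (x s) (y s) = 0) (g : ℕ → k[X][X]) (hg : ∀ m < e, TDeg (e - m) (g m))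
    (h1 : ∀ s, z s ^ e + ∑ m ∈ Finset.range e, (g m).evalEval (x s) (y s) * z s ^ m = 0)
    (N m i : ℕ) (hN : i + m ≤ N) (w : k[X][X]) (hw : TDeg i w) :
    (fun s => w.evalEval (x s) (y s) * z s ^ m) ∈ Submodule.span k
      (Set.range fun p : boxIndex d N × Fin e =>
        fun s => x s ^ p.1.1.1 * y s ^ p.1.1.2 * z s ^ p.2.1) := by
  induction m using Nat.strong_induction_on generalizing i w with
  | _ m ih =>
  by_cases hm : m < e
  · have hb := modByMonic_mem_box hf (hw.mono (show i ≤ N by omega))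
    obtain ⟨v, hv⟩ := eq_sum_of_mem_box hb
    have : (fun s => w.evalEval (x s) (y s) * z s ^ m) = ∑ p, v p • fun s =>
        x s ^ p.1.1 * y s ^ p.1.2 * z s ^ m := by
      ext s
      have h2 : w.evalEval (x s) (y s) = (w %ₘ f).evalEval (x s) (y s) := by
        conv_lhs => rw [← modByMonic_add_div w f, evalEval_add, evalEval_mul, h0, zero_mul, add_zero]
      rw [h2, hv, evalEval_finsetSum, Finset.sum_apply, Finset.sum_mul]
      refine Finset.sum_congr rfl fun p _ => ?_
      rw [evalEval_smul, evalEval_xy, Pi.smul_apply, smul_mul_assoc]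
    rw [this]
    exact Submodule.sum_mem _ fun p _ => Submodule.smul_mem _ _
      (Submodule.subset_span ⟨(p, ⟨m, hm⟩), rfl⟩)
  · have : (fun s => w.evalEval (x s) (y s) * z s ^ m) = - ∑ m' ∈ Finset.range e, fun s =>
        (w * g m').evalEval (x s) (y s) * z s ^ (m - e + m') := by
      ext s
      have h2 : z s ^ e = - ∑ m ∈ Finset.range e, (g m).evalEval (x s) (y s) * z s ^ m := by
        rw [eq_neg_iff_add_eq_zero]; exact h1 s
      have h3 : z s ^ m = z s ^ (m - e) * z s ^ e := by
        rw [← pow_add]; congr 1; omega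
      rw [h3, h2, Pi.neg_apply, Finset.sum_apply]
      simp only [mul_neg, Finset.mul_sum]
      congr 1
      refine Finset.sum_congr rfl fun m' _ => ?_
      rw [evalEval_mul, pow_add]; ring
    rw [this]
    refine Submodule.neg_mem _ (Submodule.sum_mem _ fun m' hm' => ?_)
    rw [Finset.mem_range] at hm'
    exact ih _ (by omega) (i + (e - m')) (by omega) _ (hw.mul (hg m' hm'))

theorem exists_ne_zero_kernel {ι κ : Type*} [Fintype ι] [Fintype κ] {V : Type*} [AddCommGroup V]
    [Module k V] (φ : (ι → k) →ₗ[k] V) (b : κ → V) (h : ∀ c, φ c ∈ Submodule.span k (Set.range b))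
    (hcard : Fintype.card κ < Fintype.card ι) : ∃ c, c ≠ 0 ∧ φ c = 0 := by
  let φ' := φ.codRestrict _ h
  have : FiniteDimensional k (Submodule.span k (Set.range b)) :=
    FiniteDimensional.span_of_finite k (Set.finite_range b)
  have h2 : LinearMap.ker φ' ≠ ⊥ := by
    refine LinearMap.ker_ne_bot_of_finrank_lt ?_
    rw [Module.finrank_fintype_fun_eq_card]
    exact (finrank_range_le_card b).trans_lt hcard
  obtain ⟨c, hc, hc0⟩ := Submodule.exists_mem_ne_zero_of_ne_bot h2
  refine ⟨c, hc0, ?_⟩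
  exact congrArg Subtype.val (LinearMap.mem_ker.mp hc)

end

end

section

open Polynomial

theorem charP_powerSeries {k : Type*} [Field k] {p : ℕ} [CharP k p] : CharP (PowerSeries k) p :=
  charP_of_injective_algebraMap (R := k) (A := PowerSeries k)
    (FaithfulSMul.algebraMap_injective k (PowerSeries k)) p

section
variable {k : Type*} [Field k] {p : ℕ} [hp : Fact p.Prime] [CharP k p]

theorem not_dvd_frobenius_combination [IsAlgClosed k] {d : ℕ} {f : k[X][X]} (hf : Good d f)
    (hirr : Irreducible f)
    (α : PowerSeries k) (hα : branch α f = 0) {l b s : ℕ} (hl : d * l < p ^ s)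
    (c : boxIndex d l → boxIndex d b → k) (hc : c ≠ 0) :
    ¬ f ∣ ∑ i, ∑ j, c i j • (xy i.1 * xy j.1 ^ p ^ s : k[X][X]) := by
  have := charP_powerSeries (k := k) (p := p)
  have hv : 0 < p ^ s := pow_pos hp.out.pos _
  have hroot : ∀ i j, ∃ x : k, x ^ p ^ s = c i j := fun i j => IsAlgClosed.exists_pow_nat_eq _ hv
  choose c' hc' using hroot
  let w : boxIndex d l → k[X][X] := fun i => ∑ j, c' i j • (xy j.1 : k[X][X])
  have hsum : ∑ i, ∑ j, c i j • (xy i.1 * xy j.1 ^ p ^ s : k[X][X]) =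
      ∑ i, xy i.1 * w i ^ p ^ s := by
    refine Finset.sum_congr rfl fun i _ => ?_
    rw [sum_pow_char_pow, Finset.mul_sum]
    refine Finset.sum_congr rfl fun j _ => ?_
    rw [_root_.smul_pow, hc', mul_smul_comm]
  rw [hsum]
  intro hdvd
  have hz : ∑ i, branch α (xy i.1) * branch α (w i) ^ p ^ s = 0 := by
    obtain ⟨q, hq⟩ := hdvd
    have := congrArg (branch α) hq
    rw [map_mul, hα, zero_mul, map_sum] at this
    simpa [map_mul, map_pow] using this
  have hX : branch α (C X) = PowerSeries.X := by simp
  have hne : ∃ i, branch α (w i) ≠ 0 := by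
    obtain ⟨i, hi⟩ := Function.ne_iff.mp hc
    refine ⟨i, ?_⟩
    have hc0 : c' i ≠ 0 := by
      intro h
      apply hi
      ext j
      rw [← hc', h]
      rw [Pi.zero_apply, zero_pow hv.ne']; rfl
    have hw0 : w i ≠ 0 := sum_smul_xy_ne_zero hc0
    have hwb : w i ∈ box k d b := sum_smul_xy_mem_box _
    obtain ⟨m, -, hm⟩ := bezout_order hf hirr hwb.1 (not_dvd_of_mem_box hf hwb hw0) _ hX hα
    intro h
    rw [h, map_zero] at hm
    exact hm rfl
  have hNe : Nonempty (boxIndex d l) := ⟨hne.choose⟩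
  obtain ⟨i0, hi0⟩ := Finite.exists_min fun i => (branch α (w i)).order
  have hi0' : branch α (w i0) ≠ 0 := by
    obtain ⟨i, hi⟩ := hne
    rw [Ne, ← PowerSeries.order_eq_top] at hi ⊢
    exact ne_top_of_le_ne_top hi (hi0 i)
  set n0 := (branch α (w i0)).order.toNat with hn0
  have hn0' : (n0 : ℕ∞) = (branch α (w i0)).order := ENat.natCast_toNat (mt PowerSeries.order_eq_top.mp hi0')
  have hdv : ∀ i, PowerSeries.X ^ n0 ∣ branch α (w i) := fun i => by
    rw [PowerSeries.X_pow_dvd_iff]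
    intro m hm
    apply PowerSeries.coeff_of_lt_order
    refine lt_of_lt_of_le ?_ (hi0 i)
    rw [← hn0']; exact_mod_cast hm
  choose β hβ using hdv
  have hβ0 : PowerSeries.constantCoeff (β i0) ≠ 0 := by
    have h1 := PowerSeries.coeff_order hi0'
    rw [← hn0, hβ i0, PowerSeries.coeff_X_pow_mul' ] at h1
    simpa using h1
  have hz2 : ∑ i, branch α (xy i.1) * β i ^ p ^ s = 0 := by
    have : (PowerSeries.X ^ n0) ^ p ^ s * ∑ i, branch α (xy i.1) * β i ^ p ^ s = 0 := by
      rw [← hz, Finset.mul_sum]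
      refine Finset.sum_congr rfl fun i _ => ?_
      rw [hβ i, mul_pow]; ring
    exact (mul_eq_zero.mp this).resolve_left
      (pow_ne_zero _ (pow_ne_zero _ PowerSeries.X_ne_zero))
  let a : boxIndex d l → k := fun i => PowerSeries.constantCoeff (β i) ^ p ^ s
  have ha : a ≠ 0 := fun h => hβ0 (by
    have := congrFun h i0
    exact pow_eq_zero_iff hv.ne' |>.mp this)
  let g : k[X][X] := ∑ i, a i • (xy i.1 : k[X][X])
  have hg0 : g ≠ 0 := sum_smul_xy_ne_zero ha
  have hgb : g ∈ box k d l := sum_smul_xy_mem_box _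
  obtain ⟨m, hm1, hm⟩ := bezout_order hf hirr hgb.1 (not_dvd_of_mem_box hf hgb hg0) _ hX hα
  apply hm
  have hdvd2 : PowerSeries.X ^ p ^ s ∣ branch α g := by
    have h1 : branch α g = ∑ i, branch α (xy i.1) *
        (PowerSeries.C (PowerSeries.constantCoeff (β i)) ^ p ^ s - β i ^ p ^ s) := by
      simp only [mul_sub, Finset.sum_sub_distrib, hz2, sub_zero]
      rw [map_sum]
      refine Finset.sum_congr rfl fun i _ => ?_
      rw [map_smul, ← map_pow, PowerSeries.smul_eq_C_mul, mul_comm]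
    rw [h1]
    refine Finset.dvd_sum fun i _ => Dvd.dvd.mul_left ?_ _
    rw [← sub_pow_char_pow]
    refine pow_dvd_pow_of_dvd ?_ _
    rw [PowerSeries.X_dvd_iff]
    simp
  exact PowerSeries.X_pow_dvd_iff.mp hdvd2 m (by omega)

/-- Stepanov's method: an upper bound for the number of points of a plane curve at which the
`Q`-power Frobenius image of the second coordinate satisfies a given equation of degree `e`. -/
theorem card_le_of_frobenius_relation [IsAlgClosed k] {d e : ℕ} {f : k[X][X]} (hf : Good d f)
    (hirr : Irreducible f) (α : PowerSeries k) (hα : branch α f = 0)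
    {l b r s : ℕ} (hl : d * l < p ^ s)
    (hlb : d * (p ^ r * l + b + 1) * e < d * (l + 1 - d) * (d * (b + 1 - d)))
    (S : Finset (k × k)) (hS0 : ∀ a ∈ S, f.evalEval a.1 a.2 = 0)
    (hS1 : ∀ a ∈ S, a.1 ^ (p ^ r * p ^ s) = a.1)
    (g : ℕ → k[X][X]) (hg : ∀ m < e, TDeg (e - m) (g m))
    (hS2 : ∀ a ∈ S, (a.2 ^ (p ^ r * p ^ s)) ^ e +
      ∑ m ∈ Finset.range e, (g m).evalEval a.1 a.2 * (a.2 ^ (p ^ r * p ^ s)) ^ m = 0) :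
    S.card ≤ d * (l + b * p ^ s) := by
  have hu : 0 < p ^ r := pow_pos hp.out.pos _
  let x : S → k := fun a => a.1.1
  let y : S → k := fun a => a.1.2
  let z : S → k := fun a => a.1.2 ^ (p ^ r * p ^ s)
  have hd : d ≠ 0 := by
    rintro rfl
    simp at hlb
  let φ : (boxIndex d l × boxIndex d b → k) →ₗ[k] (S → k) :=
    Fintype.linearCombination k fun ij a =>
      (xy ij.1.1 : k[X][X]).evalEval (x a) (y a) ^ p ^ r * (xy ij.2.1 : k[X][X]).evalEval (x a) (z a)
  have hspan : ∀ c, φ c ∈ Submodule.span k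
      (Set.range fun q : boxIndex d (p ^ r * l + b) × Fin e =>
        fun s => x s ^ q.1.1.1 * y s ^ q.1.1.2 * z s ^ q.2.1) := by
    intro c
    rw [Fintype.linearCombination_apply]
    refine Submodule.sum_mem _ fun ij _ => Submodule.smul_mem _ _ ?_
    have h1 := mem_boxIndex.mp ij.1.2
    have h2 := mem_boxIndex.mp ij.2.2
    have h3 : TDeg (p ^ r * l + ij.2.1.1) ((xy ij.1.1 : k[X][X]) ^ p ^ r * (C X) ^ ij.2.1.1) := by
      have := (TDeg.CX (R := k)).pow ij.2.1.1
      rw [mul_one] at this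
      exact ((xy_mem_box (k := k) ij.1.2).1.pow _).mul this
    have h4 := mem_span_monomials hf x y z (fun a => hS0 _ a.2) g hg (fun a => hS2 _ a.2)
      (p ^ r * l + b) ij.2.1.2 (p ^ r * l + ij.2.1.1) (by omega) _ h3
    convert h4 using 1
    ext a
    simp only [evalEval_mul, evalEval_xy, evalEval_pow, evalEval_C, eval_X]
    ring
  obtain ⟨c, hc, hφc⟩ := exists_ne_zero_kernel φ _ hspan (by
    rw [Fintype.card_prod, Fintype.card_prod, Fintype.card_coe, Fintype.card_coe, Fintype.card_coe,
      Fintype.card_fin]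
    calc _ ≤ d * (p ^ r * l + b + 1) * e := Nat.mul_le_mul_right _ (card_boxIndex_le _ _)
      _ < _ := hlb
      _ ≤ _ := Nat.mul_le_mul (le_card_boxIndex _ _) (le_card_boxIndex _ _))
  have hroot : ∀ i j, ∃ x : k, x ^ p ^ r = c (i, j) := fun i j => IsAlgClosed.exists_pow_nat_eq _ hu
  choose c' hc' using hroot
  have hc0 : c' ≠ 0 := by
    rintro rfl
    apply hc
    ext ⟨i, j⟩
    rw [← hc']
    simp only [Pi.zero_apply]
    rw [zero_pow hu.ne']
  have hndvd := not_dvd_frobenius_combination hf hirr α hα hl c' hc0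
  refine bezout_card hf hirr ?_ hndvd S hS0 ?_
  · refine TDeg.sum _ _ fun i _ => TDeg.sum _ _ fun j _ => ?_
    refine (box k (d + p ^ s * d) (l + b * p ^ s)).smul_mem _ ?_ |>.1
    have h1 := (xy_mem_box (k := k) i.2).1.mul ((xy_mem_box (k := k) j.2).1.pow (p ^ s))
    rw [mul_comm (p ^ s)] at h1
    refine ⟨h1, fun j' hj' => coeff_eq_zero_of_natDegree_lt ?_⟩
    refine lt_of_le_of_lt (natDegree_mul_le.trans (add_le_add_right natDegree_pow_le _)) ?_
    have h2 := mem_boxIndex.mp i.2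
    have h3 := mem_boxIndex.mp j.2
    have h4 : (xy i.1 : k[X][X]).natDegree ≤ i.1.2 := natDegree_monomial_le _
    have h5 : (xy j.1 : k[X][X]).natDegree ≤ j.1.2 := natDegree_monomial_le _
    have h6 : p ^ s * (xy j.1 : k[X][X]).natDegree ≤ p ^ s * d := Nat.mul_le_mul_left _ (by omega)
    omega
  · intro a ha
    have h1 := congrFun hφc ⟨a, ha⟩
    rw [Fintype.linearCombination_apply, Fintype.sum_prod_type, Finset.sum_apply] at h1
    refine pow_eq_zero_iff hu.ne' |>.mp ?_
    rw [← show (0 : S → k) ⟨a, ha⟩ = 0 from rfl, ← h1, evalEval_finsetSum, sum_pow_char_pow]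
    refine Finset.sum_congr rfl fun i _ => ?_
    rw [evalEval_finsetSum, sum_pow_char_pow, Finset.sum_apply]
    refine Finset.sum_congr rfl fun j _ => ?_
    rw [evalEval_smul, _root_.smul_pow, hc', Pi.smul_apply]
    congr 1
    have h2 := hS1 a ha
    simp only [x, y, z, evalEval_mul, evalEval_pow, evalEval_xy]
    rw [mul_pow, ← pow_mul _ (p ^ s) (p ^ r), mul_comm (p ^ s) (p ^ r), mul_pow (a.1 ^ j.1.1),
      ← pow_mul a.1 j.1.1, mul_comm j.1.1, pow_mul a.1 _ j.1.1, h2, ← pow_mul a.2 j.1.2,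
      mul_comm j.1.2, pow_mul a.2]

end

end

section

open Polynomial

/-- The constant in the error term of Stepanov's method. -/
def stepC (d e : ℕ) : ℕ :=
  (e * d * (d + e) + d ^ 2 + 1) + d + 1 +
    d * (d * ((e * d * (d + e) + 1 + d) * d + e * ((e * d * (d + e) + d ^ 2 + 1) + d + 1) + 1))

section
variable {k : Type*} [Field k] {p : ℕ} [hp : Fact p.Prime] [CharP k p]

theorem stepanov [IsAlgClosed k] {d e : ℕ} {f : k[X][X]} (hf : Good d f)
    (hirr : Irreducible f) (α : PowerSeries k) (hα : branch α f = 0)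
    {r s : ℕ} (hrs : r ≤ s) (hs : s ≠ 0)
    (S : Finset (k × k)) (hS0 : ∀ a ∈ S, f.evalEval a.1 a.2 = 0)
    (hS1 : ∀ a ∈ S, a.1 ^ (p ^ r * p ^ s) = a.1)
    (g : ℕ → k[X][X]) (hg : ∀ m < e, TDeg (e - m) (g m))
    (hS2 : ∀ a ∈ S, (a.2 ^ (p ^ r * p ^ s)) ^ e +
      ∑ m ∈ Finset.range e, (g m).evalEval a.1 a.2 * (a.2 ^ (p ^ r * p ^ s)) ^ m = 0) :
    S.card ≤ e * (p ^ r * p ^ s) + stepC d e * p ^ s := by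
  have hd : d ≠ 0 := by
    rintro rfl
    refine hirr.not_isUnit ?_
    rw [hf.monic.natDegree_eq_zero.mp hf.natDegree]; exact isUnit_one
  have huv : p ^ r ≤ p ^ s := Nat.pow_le_pow_right hp.out.pos hrs
  have hu : 0 < p ^ r := pow_pos hp.out.pos _
  have hv : 0 < p ^ s := pow_pos hp.out.pos _
  set M := e * d * (d + e) + d ^ 2 + 1 with hM
  set l0 := (e * d * (d + e) + 1 + d) * d + e * (M + d + 1) with hl0
  have hstepC : stepC d e = M + d + 1 + d * (d * (l0 + 1)) := rfl
  by_cases hsmall : p ^ s ≤ d * (l0 + 1)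
  · have htriv : S.card ≤ d * (p ^ r * p ^ s) := by
      have hQ' : 1 < p ^ r * p ^ s := by
        calc 1 < p ^ s := Nat.one_lt_pow hs hp.out.one_lt
          _ ≤ _ := Nat.le_mul_of_pos_left _ hu
      refine bezout_card (h := C (X ^ (p ^ r * p ^ s) - X)) hf hirr ?_ ?_ S hS0 ?_
      · intro i j hij
        rw [coeff_C]
        split_ifs with h
        · rw [coeff_sub, coeff_X_pow, coeff_X, if_neg (by omega), if_neg (by omega), sub_zero]
        · simp
      · intro h
        have h0 : (X ^ (p ^ r * p ^ s) - X : k[X]) ≠ 0 := FiniteField.X_pow_card_sub_X_ne_zero k hQ'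
        have := natDegree_le_of_dvd h (by rwa [Ne, C_eq_zero])
        rw [natDegree_C, hf.natDegree] at this
        omega
      · intro a ha
        simp [evalEval_C, hS1 a ha]
    calc S.card ≤ d * (p ^ r * p ^ s) := htriv
      _ = d * p ^ r * p ^ s := by ring
      _ ≤ d * (d * (l0 + 1)) * p ^ s := by gcongr; omega
      _ ≤ stepC d e * p ^ s := by gcongr; omega
      _ ≤ _ := Nat.le_add_left _ _
  · rw [not_le] at hsmall
    set l := (p ^ s - 1) / d with hl
    have hd0 : 0 < d := Nat.pos_of_ne_zero hd
    have hl1 : d * l < p ^ s := by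
      have := Nat.mul_div_le (p ^ s - 1) d
      rw [← hl] at this
      omega
    have hl2 : p ^ s ≤ d * (l + 1) := by
      have := Nat.lt_mul_div_succ (p ^ s - 1) hd0
      rw [← hl] at this
      omega
    have hl3 : l0 < l + 1 := by
      have := hsmall.trans_le hl2
      have := Nat.lt_of_mul_lt_mul_left this
      omega
    set b := (e * p ^ r + M) / d + 1 with hb
    have hb1 : e * p ^ r + M < d * b := Nat.lt_mul_div_succ _ hd0
    have hb2 : d * b ≤ e * p ^ r + M + d := by
      have := Nat.mul_div_le (e * p ^ r + M) d
      rw [hb, mul_add, mul_one]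
      omega
    have hb3 : b ≤ d * b := Nat.le_mul_of_pos_left _ hd0
    obtain ⟨L, hL⟩ : ∃ L, l + 1 = L + d := ⟨l + 1 - d, by
      have : d ≤ l0 := by
        rw [hl0]
        have := Nat.zero_le (e * d * (d + e) * d + e * (M + d + 1) + d * d)
        linarith
      omega⟩
    obtain ⟨B, hB⟩ : ∃ B, b + 1 = B + d := ⟨b + 1 - d, by
      have : d * d ≤ d * b := by
        rw [hM, sq] at hb1
        have := Nat.zero_le (e * p ^ r + e * d * (d + e))
        omega
      have := Nat.le_of_mul_le_mul_left this hd0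
      omega⟩
    have hlb : d * (p ^ r * l + b + 1) * e < d * (l + 1 - d) * (d * (b + 1 - d)) := by
      rw [hL, hB, Nat.add_sub_cancel, Nat.add_sub_cancel]
      have h1 : (p ^ r * l + b + 1) * e < L * (d * B) := by
        generalize p ^ r = u at *
        generalize p ^ s = v at *
        have e1 : e * u + e * d * (d + e) + 1 + d ≤ d * B := by
          have : d * b + d = d * B + d * d := by rw [← mul_add, ← hB]; ring
          rw [hM, sq] at hb1
          linarith
        have e2 : L * (e * u + e * d * (d + e) + 1 + d) ≤ L * (d * B) := Nat.mul_le_mul_left _ e1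
        have e3 : u ≤ d * (L + d) := by rw [← hL]; omega
        have e4 : e * b ≤ e * (e * u + M + d) := Nat.mul_le_mul_left _ (by omega)
        have e5 : (d + e) * e * u ≤ (d + e) * e * (d * (L + d)) := Nat.mul_le_mul_left _ e3
        have e6 : u * (l + 1) * e = u * (L + d) * e := by rw [hL]
        have e7 := hl3
        rw [hl0, hL] at e7
        have e8 : 0 ≤ L * d + d * d + u * e := Nat.zero_le _
        linarith
      calc _ = d * ((p ^ r * l + b + 1) * e) := by ring
        _ < d * (L * (d * B)) := Nat.mul_lt_mul_of_pos_left h1 hd0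
        _ = _ := by ring
    have := card_le_of_frobenius_relation hf hirr α hα hl1 hlb S hS0 hS1 g hg hS2
    calc S.card ≤ d * (l + b * p ^ s) := this
      _ = d * l + d * b * p ^ s := by ring
      _ ≤ p ^ s + (e * p ^ r + M + d) * p ^ s := by gcongr
      _ = e * (p ^ r * p ^ s) + (M + d + 1) * p ^ s := by ring
      _ ≤ _ := by gcongr; omega

end

end

section

open Polynomial

section
variable {k : Type*} [Field k]

theorem Good.pos {d : ℕ} {f : k[X][X]} (hf : Good d f) (hirr : Irreducible f) : 0 < d := by
  rw [Nat.pos_iff_ne_zero]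
  rintro rfl
  refine hirr.not_isUnit ?_
  rw [hf.monic.natDegree_eq_zero.mp hf.natDegree]; exact isUnit_one

theorem Good.not_dvd_derivative {d : ℕ} {f : k[X][X]} (hf : Good d f) (hirr : Irreducible f)
    {a b : k} (h : (derivative f).evalEval a b ≠ 0) : ¬ f ∣ derivative f := by
  intro hdvd
  have h0 : derivative f ≠ 0 := fun h0 => h (by rw [h0]; simp)
  have h1 := natDegree_le_of_dvd hdvd h0
  have h2 := natDegree_derivative_le f
  have := hf.pos hirr
  rw [hf.natDegree] at h1 h2
  omega

/-- The roots of `f(a, Y)`. -/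
noncomputable def fiber [DecidableEq k] (f : k[X][X]) (a : k) : Finset k :=
  (f.map (evalRingHom a)).roots.toFinset

theorem mem_fiber [DecidableEq k] {d : ℕ} {f : k[X][X]} (hf : Good d f) {a b : k} :
    b ∈ fiber f a ↔ f.evalEval a b = 0 := by
  rw [fiber, Multiset.mem_toFinset, mem_roots (hf.monic.map _).ne_zero, IsRoot,
    map_evalRingHom_eval]

theorem card_fiber [DecidableEq k] [IsAlgClosed k] {d : ℕ} {f : k[X][X]} (hf : Good d f) (a : k)
    (h : ∀ b, f.evalEval a b = 0 → (derivative f).evalEval a b ≠ 0) : (fiber f a).card = d := by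
  have h0 : f.map (evalRingHom a) ≠ 0 := (hf.monic.map _).ne_zero
  have hnodup : (f.map (evalRingHom a)).roots.Nodup := by
    rw [Multiset.nodup_iff_count_le_one]
    intro b
    rw [count_roots]
    by_contra hlt
    rw [not_le, one_lt_rootMultiplicity_iff_isRoot h0, IsRoot, IsRoot, derivative_map,
      map_evalRingHom_eval, map_evalRingHom_eval] at hlt
    exact h b hlt.1 hlt.2
  rw [fiber, Multiset.toFinset_card_of_nodup hnodup, IsAlgClosed.card_roots_eq_natDegree,
    hf.monic.natDegree_map, hf.natDegree]

/-- The points of a plane curve fixed by the `Q`-power Frobenius. -/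
def fixedPts (f : k[X][X]) (Q : ℕ) : Set (k × k) :=
  {a | f.evalEval a.1 a.2 = 0 ∧ a.1 ^ Q = a.1 ∧ a.2 ^ Q = a.2}

theorem fixedPts_finite (f : k[X][X]) {Q : ℕ} (hQ : 1 < Q) : (fixedPts f Q).Finite := by
  have h0 : (X ^ Q - X : k[X]) ≠ 0 := FiniteField.X_pow_card_sub_X_ne_zero k hQ
  have h1 : {a : k | a ^ Q = a}.Finite := by
    refine (rootSet_finite (X ^ Q - X : k[X]) k).subset fun a ha => ?_
    rw [mem_rootSet]
    exact ⟨h0, by simpa [sub_eq_zero] using ha⟩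
  exact (h1.prod h1).subset fun a ha => ⟨ha.2.1, ha.2.2⟩

variable {p : ℕ} [hp : Fact p.Prime] [CharP k p]

theorem ncard_fixedPts_le [IsAlgClosed k] {d : ℕ} {f : k[X][X]} (hf : Good d f)
    (hirr : Irreducible f) (α : PowerSeries k) (hα : branch α f = 0)
    {r s : ℕ} (hrs : r ≤ s) (hs : s ≠ 0) :
    (fixedPts f (p ^ r * p ^ s)).ncard ≤ p ^ r * p ^ s + stepC d 1 * p ^ s := by
  have hQ : 1 < p ^ r * p ^ s := (Nat.one_lt_pow hs hp.out.one_lt).trans_le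
    (Nat.le_mul_of_pos_left _ (pow_pos hp.out.pos _))
  have hfin := fixedPts_finite f hQ
  rw [Set.ncard_eq_toFinset_card _ hfin]
  have := stepanov (e := 1) hf hirr α hα hrs hs hfin.toFinset
    (fun a ha => (hfin.mem_toFinset.mp ha).1) (fun a ha => (hfin.mem_toFinset.mp ha).2.1)
    (fun _ => - X) (fun m hm => by
      obtain rfl : m = 0 := by omega
      exact TDeg.Y.neg)
    (fun a ha => by simp [(hfin.mem_toFinset.mp ha).2.2])
  simpa using this

/-- The coefficient of `Z ^ m` in `(f(X, Z) - f(X, Y)) / (Z - Y)`. -/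
noncomputable def divDiff (f : k[X][X]) (m : ℕ) : k[X][X] :=
  ∑ j ∈ Finset.Ioc m f.natDegree, C (f.coeff j) * X ^ (j - 1 - m)

theorem tDeg_divDiff {d : ℕ} {f : k[X][X]} (hf : Good d f) (m : ℕ) :
    TDeg (d - 1 - m) (divDiff f m) := by
  refine TDeg.sum _ _ fun j hj => ?_
  rw [Finset.mem_Ioc, hf.natDegree] at hj
  intro i j' hij
  rw [coeff_C_mul_X_pow]
  split_ifs with h
  · exact hf.tDeg i j (by omega)
  · simp

theorem divDiff_spec {d : ℕ} {f : k[X][X]} (hf : Good d f) (hd : 0 < d) (a b z : k) (hbz : z ≠ b)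
    (h1 : f.evalEval a b = 0) (h2 : f.evalEval a z = 0) :
    z ^ (d - 1) + ∑ m ∈ Finset.range (d - 1), (divDiff f m).evalEval a b * z ^ m = 0 := by
  have h3 : (divDiff f (d - 1)).evalEval a b = 1 := by
    have h4 : Finset.Ioc (d - 1) d = {d} := by ext; simp; omega
    have h5 : f.coeff d = 1 := by rw [← hf.natDegree]; exact hf.monic
    rw [divDiff, hf.natDegree, h4, Finset.sum_singleton, h5]
    simp
  have h4 : z ^ (d - 1) + ∑ m ∈ Finset.range (d - 1), (divDiff f m).evalEval a b * z ^ m =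
      ∑ m ∈ Finset.range d, (divDiff f m).evalEval a b * z ^ m := by
    conv_rhs => rw [show d = d - 1 + 1 by omega, Finset.sum_range_succ, h3, one_mul]
    rw [add_comm]
  have h5 : ∀ y, f.evalEval a y = ∑ j ∈ Finset.range (d + 1), (f.coeff j).eval a * y ^ j := by
    intro y
    rw [← map_evalRingHom_eval, eval_eq_sum_range, hf.monic.natDegree_map, hf.natDegree]
    simp
  have h6 : (z - b) * ∑ m ∈ Finset.range d, (divDiff f m).evalEval a b * z ^ m =
      f.evalEval a z - f.evalEval a b := by
    rw [h5, h5, ← Finset.sum_sub_distrib]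
    have : ∑ m ∈ Finset.range d, (divDiff f m).evalEval a b * z ^ m =
        ∑ j ∈ Finset.range (d + 1), (f.coeff j).eval a *
          ∑ m ∈ Finset.range j, z ^ m * b ^ (j - 1 - m) := by
      simp only [divDiff, evalEval_finsetSum, Finset.sum_mul, Finset.mul_sum, evalEval_mul,
        evalEval_C, evalEval_pow, evalEval_X]
      rw [Finset.sum_sigma', Finset.sum_sigma']
      refine Finset.sum_bij' (fun x _ => ⟨x.2, x.1⟩) (fun x _ => ⟨x.2, x.1⟩) ?_ ?_ ?_ ?_ ?_
      · rintro ⟨m, j⟩ h; simp [hf.natDegree] at h ⊢; omega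
      · rintro ⟨m, j⟩ h; simp [hf.natDegree] at h ⊢; omega
      · simp
      · simp
      · rintro ⟨m, j⟩ h; ring
    rw [this, Finset.mul_sum]
    refine Finset.sum_congr rfl fun j _ => ?_
    rw [mul_left_comm, ← mul_sub, (Commute.all z b).mul_geom_sum₂]
  rw [h4]
  rw [h1, h2, sub_zero] at h6
  exact (mul_eq_zero.mp h6).resolve_left (sub_ne_zero.mpr hbz)

theorem card_fixedElts [IsAlgClosed k] [DecidableEq k] (n : ℕ) (hn : n ≠ 0) :
    (X ^ p ^ n - X : k[X]).roots.toFinset.card = p ^ n := by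
  have hsep : (X ^ p ^ n - X : k[X]).Separable :=
    galois_poly_separable p _ (dvd_pow_self p hn)
  rw [Multiset.toFinset_card_of_nodup (nodup_roots hsep), IsAlgClosed.card_roots_eq_natDegree,
    FiniteField.X_pow_card_pow_sub_X_natDegree_eq k hn hp.out.one_lt]

theorem evalEval_pow_fixed {f : k[X][X]} {n : ℕ}
    (hfix : ∀ i j, ((f.coeff j).coeff i) ^ p ^ n = (f.coeff j).coeff i) (a b : k) :
    f.evalEval (a ^ p ^ n) (b ^ p ^ n) = f.evalEval a b ^ p ^ n := by
  have h : ∀ a b : k, f.evalEval a b =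
      ∑ j ∈ f.support, (∑ i ∈ (f.coeff j).support, (f.coeff j).coeff i * a ^ i) * b ^ j := by
    intro a b
    rw [evalEval, eval_eq_sum (p := f), Polynomial.sum, eval_finsetSum]
    refine Finset.sum_congr rfl fun j _ => ?_
    rw [eval_mul, eval_pow, eval_C, eval_eq_sum (p := f.coeff j), Polynomial.sum]
  rw [h, h, sum_pow_char_pow]
  refine Finset.sum_congr rfl fun j _ => ?_
  rw [mul_pow, sum_pow_char_pow, ← pow_mul, ← pow_mul, mul_comm j]
  congr 1
  refine Finset.sum_congr rfl fun i _ => ?_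
  rw [mul_pow, hfix, ← pow_mul, ← pow_mul, mul_comm i]

theorem le_ncard_fixedPts [IsAlgClosed k] {d : ℕ} {f : k[X][X]} (hf : Good d f)
    (hirr : Irreducible f) (α : PowerSeries k) (hα : branch α f = 0)
    {a0 b0 : k} (hder : (derivative f).evalEval a0 b0 ≠ 0)
    {r s : ℕ} (hrs : r ≤ s) (hs : s ≠ 0)
    (hfix : ∀ i j, ((f.coeff j).coeff i) ^ p ^ (r + s) = (f.coeff j).coeff i) :
    p ^ r * p ^ s ≤ (fixedPts f (p ^ r * p ^ s)).ncard + stepC d (d - 1) * p ^ s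
      + d * (d * (d - 1)) := by
  classical
  have hQ : 1 < p ^ r * p ^ s := (Nat.one_lt_pow hs hp.out.one_lt).trans_le
    (Nat.le_mul_of_pos_left _ (pow_pos hp.out.pos _))
  have hfin := fixedPts_finite f hQ
  have hd := hf.pos hirr
  rw [Set.ncard_eq_toFinset_card _ hfin]
  set Q := p ^ r * p ^ s with hQdef
  have hQp : Q = p ^ (r + s) := by rw [pow_add]
  set A := (X ^ Q - X : k[X]).roots.toFinset with hA
  have hAcard : A.card = Q := by
    rw [hA, hQp]; exact card_fixedElts _ (by omega)
  have hAmem : ∀ a, a ∈ A ↔ a ^ Q = a := by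
    intro a
    rw [hA, Multiset.mem_toFinset, mem_roots (FiniteField.X_pow_card_sub_X_ne_zero k hQ), IsRoot]
    simp [sub_eq_zero]
  set T : Finset (k × k) := A.biUnion fun a => (fiber f a).image fun b => (a, b) with hT
  have hTmem : ∀ a, a ∈ T ↔ a.1 ^ Q = a.1 ∧ f.evalEval a.1 a.2 = 0 := by
    rintro ⟨a, b⟩
    simp only [hT, Finset.mem_biUnion, Finset.mem_image, hAmem, mem_fiber hf, Prod.mk.injEq]
    constructor
    · rintro ⟨a', h1, b', h2, rfl, rfl⟩; exact ⟨h1, h2⟩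
    · rintro ⟨h1, h2⟩; exact ⟨a, h1, b, h2, rfl, rfl⟩
  have hTcard : T.card = ∑ a ∈ A, (fiber f a).card := by
    rw [hT, Finset.card_biUnion]
    · exact Finset.sum_congr rfl fun a _ =>
        Finset.card_image_of_injective _ fun b b' h => (Prod.mk.inj h).2
    · intro a _ a' _ hne
      simp only [Function.onFun, Finset.disjoint_left, Finset.mem_image]
      rintro _ ⟨b, _, rfl⟩ ⟨b', _, h⟩
      exact hne (Prod.mk.inj h).1.symm
  set B := A.filter fun a => ∃ b, f.evalEval a b = 0 ∧ (derivative f).evalEval a b = 0 with hB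
  have hBcard : B.card ≤ d * (d - 1) := by
    have : ∀ a ∈ B, ∃ b, f.evalEval a b = 0 ∧ (derivative f).evalEval a b = 0 := fun a ha =>
      (Finset.mem_filter.mp ha).2
    choose! b hb using this
    rw [← Finset.card_image_of_injective B (f := fun a => (a, b a))
      (fun a a' h => (Prod.mk.inj h).1)]
    refine bezout_card hf hirr hf.tDeg.derivative (hf.not_dvd_derivative hirr hder) _ ?_ ?_
    · intro q hq
      obtain ⟨a, ha, rfl⟩ := Finset.mem_image.mp hq
      exact (hb a ha).1
    · intro q hq
      obtain ⟨a, ha, rfl⟩ := Finset.mem_image.mp hq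
      exact (hb a ha).2
  have hTlow : d * Q ≤ T.card + d * (d * (d - 1)) := by
    have h1 : ∑ a ∈ A \ B, (fiber f a).card = (A \ B).card * d := by
      rw [← smul_eq_mul, ← Finset.sum_const]
      refine Finset.sum_congr rfl fun a ha => card_fiber hf a fun b h h' => ?_
      rw [Finset.mem_sdiff, hB, Finset.mem_filter] at ha
      exact ha.2 ⟨ha.1, b, h, h'⟩
    have h2 : (A \ B).card * d ≤ T.card := by
      rw [hTcard, ← h1]
      exact Finset.sum_le_sum_of_subset Finset.sdiff_subset
    have h3 : Q ≤ (A \ B).card + B.card := by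
      rw [← hAcard]
      exact Finset.card_le_card_sdiff_add_card
    calc d * Q ≤ d * ((A \ B).card + d * (d - 1)) := Nat.mul_le_mul_left _ (by omega)
      _ = (A \ B).card * d + d * (d * (d - 1)) := by ring
      _ ≤ _ := Nat.add_le_add_right h2 _
  have hsplit := Finset.card_filter_add_card_filter_not (s := T) (fun a : k × k => a.2 ^ Q = a.2)
  have h1 : (T.filter fun a => a.2 ^ Q = a.2).card ≤ hfin.toFinset.card := by
    refine Finset.card_le_card fun a ha => ?_
    rw [Finset.mem_filter, hTmem] at ha
    rw [hfin.mem_toFinset]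
    exact ⟨ha.1.2, ha.1.1, ha.2⟩
  have h2 : (T.filter fun a => ¬ a.2 ^ Q = a.2).card ≤ (d - 1) * Q + stepC d (d - 1) * p ^ s := by
    refine stepanov (e := d - 1) hf hirr α hα hrs hs _ ?_ ?_ (divDiff f)
      (fun m _ => tDeg_divDiff hf m) ?_
    · intro a ha
      rw [Finset.mem_filter, hTmem] at ha
      exact ha.1.2
    · intro a ha
      rw [Finset.mem_filter, hTmem] at ha
      exact ha.1.1
    · intro a ha
      rw [Finset.mem_filter, hTmem] at ha
      refine divDiff_spec hf hd _ _ _ ha.2 ha.1.2 ?_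
      have h3 := evalEval_pow_fixed hfix a.1 a.2
      rw [← hQp, ha.1.1, ha.1.2, hQp, zero_pow (pow_pos hp.out.pos _).ne', ← hQp] at h3
      exact h3
  have h3 : d * Q = (d - 1) * Q + Q := by
    conv_lhs => rw [show d = d - 1 + 1 by omega, add_mul, one_mul]
  omega

end

end

section

/-- An abstract complete curve covered by two affine charts: `I D` and `J D` are the sections of the
divisor `D` over the charts. -/
structure CurveData (F P : Type*) [Field F] where
  q : ℕ
  g : ℕ
  deg : P → ℕ
  I : (P →₀ ℤ) → AddSubgroup F
  J : (P →₀ ℤ) → AddSubgroup F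
  dv : F → (P →₀ ℤ)
  one_lt_q : 1 < q
  deg_pos : ∀ p, 0 < deg p
  finite_deg : ∀ n, {p | deg p = n}.Finite
  monoI : Monotone I
  monoJ : Monotone J
  step : ∀ p D,
    (J (D + .single p 1) = J D ∧ (I D).relIndex (I (D + .single p 1)) = q ^ deg p) ∨
    (I (D + .single p 1) = I D ∧ (J D).relIndex (J (D + .single p 1)) = q ^ deg p)
  mul_memI : ∀ b ≠ 0, ∀ D x, b * x ∈ I (D - dv b) ↔ x ∈ I D
  mul_memJ : ∀ b ≠ 0, ∀ D x, b * x ∈ J (D - dv b) ↔ x ∈ J D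
  dv_mul : ∀ a ≠ 0, ∀ b ≠ 0, dv (a * b) = dv a + dv b
  mem_iff : ∀ x ≠ 0, ∀ D, x ∈ I D ⊓ J D ↔ 0 ≤ dv x + D
  card_zero : Nat.card (I 0 ⊓ J 0 : AddSubgroup F) = q
  index_zero : (I 0 ⊔ J 0).index = q ^ g

theorem AddSubgroup.relIndex_inf_mul_relIndex_sup {G : Type*} [AddCommGroup G]
    {A B : AddSubgroup G} (h : A ≤ B) (C : AddSubgroup G) :
    (A ⊓ C).relIndex (B ⊓ C) * (A ⊔ C).relIndex (B ⊔ C) = A.relIndex B := by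
  have h1 : (A ⊓ C).relIndex (B ⊓ C) = A.relIndex (B ⊓ C) := by
    rw [← AddSubgroup.inf_relIndex_right A (B ⊓ C), ← inf_assoc, inf_eq_left.mpr h]
  have h2 : (A ⊔ C).relIndex (B ⊔ C) = (A ⊔ C).relIndex B := by
    rw [show B ⊔ C = B ⊔ (A ⊔ C) by rw [← sup_assoc, sup_eq_left.mpr h],
      AddSubgroup.relIndex_sup_right]
  have h3 : (A ⊔ C).relIndex B = (A ⊔ B ⊓ C).relIndex B := by
    rw [← AddSubgroup.inf_relIndex_right (A ⊔ C) B, sup_inf_assoc_of_le C h, inf_comm C B]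
  have h4 : A.relIndex (B ⊓ C) = A.relIndex (A ⊔ B ⊓ C) := by
    rw [AddSubgroup.relIndex_sup_left]
  rw [h1, h2, h3, h4]
  exact AddSubgroup.relIndex_mul_relIndex _ _ _ le_sup_left (sup_le h inf_le_left)

namespace CurveData

variable {F P : Type*} [Field F] (C : CurveData F P)

/-- The degree of a divisor. -/
noncomputable def degree : (P →₀ ℤ) →+ ℤ := Finsupp.weight fun p => (C.deg p : ℤ)

theorem degree_single (p : P) (n : ℤ) : C.degree (.single p n) = n * C.deg p := by
  rw [degree, Finsupp.weight_single, smul_eq_mul]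

theorem degree_nonneg {D : P →₀ ℤ} (h : 0 ≤ D) : 0 ≤ C.degree D := by
  rw [degree, Finsupp.weight_apply, Finsupp.sum]
  exact Finset.sum_nonneg fun p _ => smul_nonneg (h p) (by positivity)

theorem eq_zero_of_degree_eq_zero {D : P →₀ ℤ} (h : 0 ≤ D) (h0 : C.degree D = 0) : D = 0 := by
  rw [degree, Finsupp.weight_apply, Finsupp.sum, Finset.sum_eq_zero_iff_of_nonneg
    fun p _ => smul_nonneg (h p) (by positivity)] at h0
  ext p
  by_contra hp
  have := h0 p (Finsupp.mem_support_iff.mpr hp)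
  have hd := C.deg_pos p
  simp only [smul_eq_mul, mul_eq_zero, Nat.cast_eq_zero] at this
  rcases this with h | h
  · exact hp h
  · omega

/-- The number of global sections. -/
noncomputable def a (D : P →₀ ℤ) : ℕ := Nat.card (C.I D ⊓ C.J D : AddSubgroup F)

/-- The size of the first cohomology. -/
noncomputable def b (D : P →₀ ℤ) : ℕ := (C.I D ⊔ C.J D).index

theorem card_eq_relIndex {G : Type*} [AddGroup G] {A B : AddSubgroup G} (h : A ≤ B) :
    Nat.card A * A.relIndex B = Nat.card B := by
  rw [← AddSubgroup.relIndex_bot_left, ← AddSubgroup.relIndex_bot_left]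
  exact AddSubgroup.relIndex_mul_relIndex _ _ _ bot_le h

theorem step_ab (p : P) (D : P →₀ ℤ) :
    ∃ u v, u * v = C.q ^ C.deg p ∧ C.a D * u = C.a (D + .single p 1) ∧
      v * C.b (D + .single p 1) = C.b D := by
  have hle : D ≤ D + .single p 1 := le_add_of_nonneg_right (by simp)
  have hI := C.monoI hle
  have hJ := C.monoJ hle
  set D' := D + Finsupp.single p 1 with hD'
  refine ⟨(C.I D ⊓ C.J D).relIndex (C.I D' ⊓ C.J D'), (C.I D ⊔ C.J D).relIndex (C.I D' ⊔ C.J D'),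
    ?_, card_eq_relIndex (inf_le_inf hI hJ), AddSubgroup.relIndex_mul_index (sup_le_sup hI hJ)⟩
  rcases C.step p D with ⟨h1, h2⟩ | ⟨h1, h2⟩
  · rw [← hD'] at h1 h2
    rw [h1, ← h2]
    exact AddSubgroup.relIndex_inf_mul_relIndex_sup hI _
  · rw [← hD'] at h1 h2
    rw [h1, ← h2, inf_comm (C.I D), inf_comm (C.I D), sup_comm (C.I D), sup_comm (C.I D)]
    exact AddSubgroup.relIndex_inf_mul_relIndex_sup hJ _

theorem q_pos : (0 : ℚ) < C.q := by exact_mod_cast zero_lt_one.trans C.one_lt_q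

/-- Riemann's theorem, in multiplicative form. -/
def RRAt (D : P →₀ ℤ) : Prop :=
  C.a D ≠ 0 ∧ C.b D ≠ 0 ∧ (C.a D : ℚ) * C.q ^ C.g = C.q ^ (1 + C.degree D) * C.b D

theorem rrAt_step (p : P) (D : P →₀ ℤ) : C.RRAt D ↔ C.RRAt (D + .single p 1) := by
  obtain ⟨u, v, huv, ha, hb⟩ := C.step_ab p D
  have hq := C.q_pos
  have hne : u * v ≠ 0 := by
    rw [huv]; exact pow_ne_zero _ (by have := C.one_lt_q; omega)
  have hu : u ≠ 0 := left_ne_zero_of_mul hne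
  have hv : v ≠ 0 := right_ne_zero_of_mul hne
  have hdeg : C.degree (D + .single p 1) = C.degree D + C.deg p := by
    rw [map_add, degree_single, one_mul]
  have hpow : (C.q : ℚ) ^ (1 + C.degree (D + .single p 1)) =
      C.q ^ (1 + C.degree D) * (u * v) := by
    rw [hdeg, ← add_assoc, zpow_add₀ hq.ne', zpow_natCast]
    congr 1; exact_mod_cast huv.symm
  unfold RRAt
  rw [hpow, ← ha, ← hb]
  refine and_congr (by simp [hu]) (and_congr (by simp [hv]) ?_)
  push_cast
  have hu' : (u : ℚ) ≠ 0 := by exact_mod_cast hu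
  constructor
  · intro h; linear_combination u * h
  · intro h
    refine mul_left_cancel₀ hu' ?_
    linear_combination h

theorem rrAt (D : P →₀ ℤ) : C.RRAt D := by
  have key : ∀ E D : P →₀ ℤ, C.RRAt D ↔ C.RRAt (D + E) := by
    intro E
    induction E using Finsupp.induction_linear with
    | zero => simp
    | add f g hf hg => intro D; rw [hf, hg (D + f), add_assoc]
    | single p n =>
      induction n using Int.induction_on with
      | zero => simp
      | succ n ih =>
        intro D; rw [ih, C.rrAt_step p, add_assoc, ← Finsupp.single_add]
      | pred n ih =>
        intro D
        rw [ih, C.rrAt_step p (D + .single p (-(n : ℤ) - 1)), add_assoc, ← Finsupp.single_add,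
          sub_add_cancel]
  have h0 : C.RRAt 0 := by
    refine ⟨?_, ?_, ?_⟩
    · rw [a, C.card_zero]; have := C.one_lt_q; omega
    · rw [b, C.index_zero]; exact pow_ne_zero _ (by have := C.one_lt_q; omega)
    · rw [a, b, C.card_zero, C.index_zero]; simp
  simpa using (key D 0).mp h0

theorem a_ne_zero (D : P →₀ ℤ) : C.a D ≠ 0 := (C.rrAt D).1
theorem b_ne_zero (D : P →₀ ℤ) : C.b D ≠ 0 := (C.rrAt D).2.1
theorem rr (D : P →₀ ℤ) : (C.a D : ℚ) * C.q ^ C.g = C.q ^ (1 + C.degree D) * C.b D :=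
  (C.rrAt D).2.2

instance finite_sections (D : P →₀ ℤ) : Finite (C.I D ⊓ C.J D : AddSubgroup F) :=
  Nat.finite_of_card_ne_zero (C.a_ne_zero D)

theorem dv_one : C.dv 1 = 0 := by
  have := C.dv_mul 1 one_ne_zero 1 one_ne_zero
  simpa using this

theorem dv_inv {x : F} (hx : x ≠ 0) : C.dv x⁻¹ = -C.dv x := by
  have := C.dv_mul x hx _ (inv_ne_zero hx)
  rw [mul_inv_cancel₀ hx, dv_one] at this
  exact (neg_eq_of_add_eq_zero_right this.symm).symm

/-- Multiplication by a nonzero element, as an automorphism of the additive group. -/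
noncomputable def mulEquiv (x : F) (hx : x ≠ 0) : F ≃+ F where
  toEquiv := Equiv.mulLeft₀ x hx
  map_add' := mul_add x

theorem map_mulEquiv {x : F} (hx : x ≠ 0) {A B : AddSubgroup F} (h : ∀ y, x * y ∈ B ↔ y ∈ A) :
    A.map (mulEquiv x hx).toAddMonoidHom = B := by
  ext y
  simp only [AddSubgroup.mem_map]
  constructor
  · rintro ⟨z, hz, rfl⟩; exact (h z).mpr hz
  · intro hy
    refine ⟨x⁻¹ * y, (h _).mp (by rwa [mul_inv_cancel_left₀ hx]), ?_⟩
    exact mul_inv_cancel_left₀ hx y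

theorem a_sub_dv {x : F} (hx : x ≠ 0) (D : P →₀ ℤ) : C.a (D - C.dv x) = C.a D := by
  have h : ∀ y, x * y ∈ C.I (D - C.dv x) ⊓ C.J (D - C.dv x) ↔ y ∈ C.I D ⊓ C.J D := fun y => by
    rw [AddSubgroup.mem_inf, AddSubgroup.mem_inf, C.mul_memI x hx, C.mul_memJ x hx]
  rw [a, ← map_mulEquiv hx h]
  exact Nat.card_congr ((AddSubgroup.equivMapOfInjective _ _
    (mulEquiv x hx).injective).toEquiv).symm

theorem b_sub_dv {x : F} (hx : x ≠ 0) (D : P →₀ ℤ) : C.b (D - C.dv x) = C.b D := by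
  have e : (C.I D ⊔ C.J D).map (mulEquiv x hx).toAddMonoidHom =
      C.I (D - C.dv x) ⊔ C.J (D - C.dv x) := by
    rw [AddSubgroup.map_sup, map_mulEquiv hx (C.mul_memI x hx D),
      map_mulEquiv hx (C.mul_memJ x hx D)]
  have h := AddSubgroup.index_map_equiv (C.I D ⊔ C.J D) (mulEquiv x hx)
  exact (congrArg AddSubgroup.index e).symm.trans h

theorem degree_dv {x : F} (hx : x ≠ 0) : C.degree (C.dv x) = 0 := by
  have h1 := C.rr (0 - C.dv x)
  have h2 := C.rr 0
  rw [C.a_sub_dv hx, C.b_sub_dv hx, h2] at h1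
  have hb : (C.b 0 : ℚ) ≠ 0 := by exact_mod_cast C.b_ne_zero 0
  have h3 := mul_right_cancel₀ hb h1
  have h4 := zpow_right_injective₀ C.q_pos (by exact_mod_cast C.one_lt_q.ne') h3
  simp only [map_zero, map_sub] at h4
  omega

theorem a_eq_one {D : P →₀ ℤ} (h : C.degree D < 0) : C.a D = 1 := by
  rw [a, AddSubgroup.card_eq_one]
  rw [AddSubgroup.eq_bot_iff_forall]
  intro x hx
  by_contra hx0
  have h1 := C.degree_nonneg ((C.mem_iff x hx0 D).mp hx)
  rw [map_add, C.degree_dv hx0] at h1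
  omega

theorem b_eq {D : P →₀ ℤ} (h : C.degree D < 0) :
    (C.b D : ℚ) = (C.q : ℚ) ^ ((C.g : ℤ) - 1 - C.degree D) := by
  have h1 := C.rr D
  have hq := C.q_pos
  rw [C.a_eq_one h, Nat.cast_one, one_mul] at h1
  have : (C.q : ℚ) ^ (1 + C.degree D) ≠ 0 := (zpow_pos hq _).ne'
  refine mul_left_cancel₀ this ?_
  rw [← h1, ← zpow_add₀ hq.ne', ← zpow_natCast]
  congr 1; ring

theorem a_le_b_sub {D : P →₀ ℤ} (hD : C.b D ≠ 1) (E : P →₀ ℤ) : C.a E ≤ C.b (D - E) := by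
  classical
  have hfin : ∀ D, Finite (F ⧸ (C.I D ⊔ C.J D)) := fun D =>
    have : (C.I D ⊔ C.J D).FiniteIndex := ⟨C.b_ne_zero D⟩
    AddSubgroup.finite_quotient_of_finiteIndex
  have := hfin D
  have := hfin (D - E)
  have : Nontrivial (F ⧸ (C.I D ⊔ C.J D)) := by
    rw [← Finite.one_lt_card_iff_nontrivial]
    have h1 := C.b_ne_zero D
    change 1 < C.b D
    omega
  obtain ⟨w, hw⟩ := exists_ne (0 : F ⧸ (C.I D ⊔ C.J D))
  obtain ⟨ψ, hψ⟩ := AddChar.exists_apply_ne_zero.mpr hw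
  obtain ⟨w, rfl⟩ := QuotientAddGroup.mk_surjective w
  set χ : AddChar F ℂ := ψ.compAddMonoidHom (QuotientAddGroup.mk' _) with hχ
  have hχw : χ w ≠ 1 := hψ
  have hχ1 : ∀ x ∈ C.I D ⊔ C.J D, χ x = 1 := by
    intro x hx
    have : (QuotientAddGroup.mk' (C.I D ⊔ C.J D)) x = 0 :=
      (QuotientAddGroup.eq_zero_iff x).mpr hx
    rw [hχ, AddChar.compAddMonoidHom_apply, this, AddChar.map_zero_eq_one]
  have key : ∀ y ∈ C.I E ⊓ C.J E, ∀ x ∈ C.I (D - E) ⊔ C.J (D - E), χ (y * x) = 1 := by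
    intro y hy x hx
    refine hχ1 _ ?_
    by_cases hy0 : y = 0
    · rw [hy0, zero_mul]; exact zero_mem _
    have hyE := (C.mem_iff y hy0 E).mp hy
    have hle : D - E - C.dv y ≤ D := by
      rw [sub_sub, sub_le_self_iff, add_comm]; exact hyE
    obtain ⟨s, hs, t, ht, rfl⟩ := AddSubgroup.mem_sup.mp hx
    rw [mul_add]
    exact add_mem (AddSubgroup.mem_sup_left (C.monoI hle ((C.mul_memI y hy0 _ s).mpr hs)))
      (AddSubgroup.mem_sup_right (C.monoJ hle ((C.mul_memJ y hy0 _ t).mpr ht)))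
  let Φ : (C.I E ⊓ C.J E : AddSubgroup F) → AddChar (F ⧸ (C.I (D - E) ⊔ C.J (D - E))) ℂ := fun y =>
    AddChar.toAddMonoidHomEquiv.symm (QuotientAddGroup.lift _
      (AddChar.toAddMonoidHomEquiv (χ.compAddMonoidHom (AddMonoidHom.mulLeft (y : F))))
      (fun x hx => by simpa using congrArg Additive.ofMul (key y y.2 x hx)))
  have hΦ : ∀ y x, Φ y (QuotientAddGroup.mk x) = χ (y * x) := fun y x => rfl
  have hinj : Function.Injective Φ := by
    intro y z hyz
    by_contra hne
    have hne' : (y : F) - z ≠ 0 := sub_ne_zero.mpr fun h => hne (Subtype.ext h)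
    have h1 : ∀ x, χ ((y - z) * x) = 1 := by
      intro x
      have := congrArg (fun θ : AddChar _ ℂ => θ (QuotientAddGroup.mk x)) hyz
      simp only [hΦ] at this
      rw [sub_mul, AddChar.map_sub_eq_div, this, div_self]
      intro h0
      have := AddChar.map_add_eq_mul χ (z * x) (-(z * x))
      rw [add_neg_cancel, AddChar.map_zero_eq_one, h0, zero_mul] at this
      exact one_ne_zero this
    apply hχw
    have := h1 (((y : F) - z)⁻¹ * w)
    rwa [mul_inv_cancel_left₀ hne'] at this
  have := Fintype.ofFinite (F ⧸ (C.I (D - E) ⊔ C.J (D - E)))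
  calc C.a E ≤ Nat.card (AddChar (F ⧸ (C.I (D - E) ⊔ C.J (D - E))) ℂ) :=
        Nat.card_le_card_of_injective Φ hinj
    _ = C.b (D - E) := by
        rw [Nat.card_eq_fintype_card, AddChar.card_eq, ← Nat.card_eq_fintype_card]; rfl

theorem exists_pos_degree [Nonempty P] (n : ℤ) : ∃ E, n < C.degree E := by
  obtain ⟨p⟩ := ‹Nonempty P›
  refine ⟨.single p (|n| + 1), ?_⟩
  rw [degree_single]
  have := C.deg_pos p
  have h2 : (1 : ℤ) ≤ C.deg p := by exact_mod_cast this
  have h3 := le_abs_self n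
  nlinarith [abs_nonneg n]

theorem b_eq_one [Nonempty P] {D : P →₀ ℤ} (h : 2 * (C.g : ℤ) - 2 < C.degree D) : C.b D = 1 := by
  by_contra hD
  obtain ⟨E, hE⟩ := C.exists_pos_degree (C.degree D)
  have h1 := C.a_le_b_sub hD E
  have hq := C.q_pos
  have h2 : C.degree (D - E) < 0 := by rw [map_sub]; omega
  have h1' : (C.a E : ℚ) ≤ C.b (D - E) := by exact_mod_cast h1
  rw [C.b_eq h2] at h1'
  have h3 := C.rr E
  have hb : (1 : ℚ) ≤ C.b E := by
    exact_mod_cast Nat.one_le_iff_ne_zero.mpr (C.b_ne_zero E)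
  have h4 : (C.q : ℚ) ^ (1 + C.degree E) ≤ C.q ^ ((C.g : ℤ) - 1 - C.degree (D - E) + C.g) := by
    calc (C.q : ℚ) ^ (1 + C.degree E) ≤ C.q ^ (1 + C.degree E) * C.b E :=
          le_mul_of_one_le_right (zpow_pos hq _).le hb
      _ = C.a E * C.q ^ C.g := h3.symm
      _ ≤ C.q ^ ((C.g : ℤ) - 1 - C.degree (D - E)) * C.q ^ C.g := by gcongr
      _ = _ := by rw [← zpow_natCast, ← zpow_add₀ hq.ne']
  rw [zpow_le_zpow_iff_right₀ (by exact_mod_cast C.one_lt_q), map_sub] at h4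
  omega

theorem a_eq [Nonempty P] {D : P →₀ ℤ} (h : 2 * (C.g : ℤ) - 2 < C.degree D) :
    (C.a D : ℚ) = (C.q : ℚ) ^ (1 + C.degree D - C.g) := by
  have h1 := C.rr D
  have hq := C.q_pos
  rw [C.b_eq_one h, Nat.cast_one, mul_one] at h1
  rw [zpow_sub₀ hq.ne', ← h1, zpow_natCast, mul_div_cancel_right₀]
  positivity

end CurveData

end

section

namespace CurveData

variable {F P : Type*} [Field F] (C : CurveData F P)

/-- The effective divisors of degree `n`. -/
def Eff (n : ℤ) : Set (P →₀ ℤ) := {D | 0 ≤ D ∧ C.degree D = n}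

/-- The number of effective divisors of degree `n`. -/
noncomputable def A (n : ℤ) : ℕ := (C.Eff n).ncard

theorem eff_finite (n : ℤ) : (C.Eff n).Finite := by
  classical
  have hT : {p | C.deg p ≤ n.toNat}.Finite := by
    have : {p | C.deg p ≤ n.toNat} = ⋃ m ∈ Finset.range (n.toNat + 1), {p | C.deg p = m} := by
      ext p; simp
    rw [this]
    exact Set.Finite.biUnion (Finset.finite_toSet _) fun m _ => C.finite_deg m
  refine Set.Finite.subset (Finset.finite_toSet
    (hT.toFinset.finsupp fun _ => Finset.Icc (0 : ℤ) n)) ?_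
  rintro D ⟨h0, hn⟩
  have key : ∀ p, D p ≠ 0 → D p * C.deg p ≤ n := by
    intro p hp
    rw [← hn, degree, Finsupp.weight_apply, Finsupp.sum]
    exact Finset.single_le_sum (f := fun p => D p • (C.deg p : ℤ))
      (fun p _ => smul_nonneg (h0 p) (by positivity)) (Finsupp.mem_support_iff.mpr hp)
  have hpos : ∀ p, (1 : ℤ) ≤ C.deg p := fun p => by exact_mod_cast C.deg_pos p
  have hD : ∀ p, 0 ≤ D p := fun p => h0 p
  have hn0 : 0 ≤ n := hn ▸ C.degree_nonneg h0
  simp only [Finset.mem_coe, Finset.mem_finsupp_iff]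
  constructor
  · intro p hp
    rw [Finsupp.mem_support_iff] at hp
    have h1 := key p hp
    have h2 : 1 ≤ D p := by have := hD p; omega
    rw [hT.mem_toFinset]
    have : (C.deg p : ℤ) ≤ n := by nlinarith [hpos p]
    change C.deg p ≤ n.toNat
    omega
  · intro p _
    rw [Finset.mem_Icc]
    refine ⟨hD p, ?_⟩
    by_cases hp : D p = 0
    · omega
    · nlinarith [key p hp, hpos p, hD p]

theorem A_neg {n : ℤ} (hn : n < 0) : C.A n = 0 := by
  rw [A, Set.ncard_eq_zero (C.eff_finite n), Set.eq_empty_iff_forall_notMem]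
  rintro D ⟨h0, h1⟩
  have := C.degree_nonneg h0
  omega

theorem A_zero : C.A 0 = 1 := by
  rw [A, Set.ncard_eq_one]
  refine ⟨0, Set.eq_singleton_iff_unique_mem.mpr ⟨⟨le_rfl, map_zero _⟩, ?_⟩⟩
  rintro D ⟨h0, h1⟩
  exact C.eq_zero_of_degree_eq_zero h0 h1

theorem mem_fiber_iff {x y : F} (hx : x ≠ 0) (hy : y ≠ 0) :
    C.dv x = C.dv y ↔ x / y ∈ C.I 0 ⊓ C.J 0 := by
  rw [C.mem_iff _ (div_ne_zero hx hy), add_zero, div_eq_mul_inv,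
    C.dv_mul _ hx _ (inv_ne_zero hy), C.dv_inv hy]
  constructor
  · intro h; simp [h]
  · intro h
    have := C.eq_zero_of_degree_eq_zero h (by simp [C.degree_dv hx, C.degree_dv hy])
    rwa [← sub_eq_add_neg, sub_eq_zero] at this

theorem ncard_linear_system (D : P →₀ ℤ) :
    {E | 0 ≤ E ∧ ∃ x ≠ 0, E = C.dv x + D}.ncard * (C.q - 1) = C.a D - 1 := by
  classical
  have hfin : ∀ D, ((C.I D ⊓ C.J D : AddSubgroup F) : Set F).Finite := fun D => C.finite_sections D
  have hcard : ∀ D, (hfin D).toFinset.card = C.a D := by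
    intro D
    rw [← Set.ncard_eq_toFinset_card _ (hfin D), ← Nat.card_coe_set_eq]; rfl
  set S := (hfin D).toFinset.erase 0 with hS
  set U := (hfin 0).toFinset.erase 0 with hU
  have hSmem : ∀ x, x ∈ S ↔ x ≠ 0 ∧ x ∈ C.I D ⊓ C.J D := by intro x; simp [hS]
  have hUmem : ∀ x, x ∈ U ↔ x ≠ 0 ∧ x ∈ C.I 0 ⊓ C.J 0 := by intro x; simp [hU]
  have hScard : S.card = C.a D - 1 := by
    rw [hS, Finset.card_erase_of_mem, hcard]
    rw [Set.Finite.mem_toFinset]; exact zero_mem _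
  have hUcard : U.card = C.q - 1 := by
    rw [hU, Finset.card_erase_of_mem, hcard, a, C.card_zero]
    rw [Set.Finite.mem_toFinset]; exact zero_mem _
  have himg : {E | 0 ≤ E ∧ ∃ x ≠ 0, E = C.dv x + D} =
      ((S.image fun x => C.dv x + D : Finset (P →₀ ℤ)) : Set (P →₀ ℤ)) := by
    ext E
    simp only [Set.mem_ofPred_eq, Finset.coe_image, Set.mem_image, Finset.mem_coe, hSmem]
    constructor
    · rintro ⟨h0, x, hx, rfl⟩
      exact ⟨x, ⟨hx, (C.mem_iff x hx D).mpr h0⟩, rfl⟩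
    · rintro ⟨x, ⟨hx, h⟩, rfl⟩
      exact ⟨(C.mem_iff x hx D).mp h, x, hx, rfl⟩
  rw [himg, Set.ncard_coe_finset, ← hScard, ← hUcard, Finset.card_eq_sum_card_image
    (fun x => C.dv x + D) S]
  symm
  refine Finset.sum_const_nat fun E hE => ?_
  obtain ⟨y, hy, rfl⟩ := Finset.mem_image.mp hE
  have hy' := (hSmem y).mp hy
  refine Finset.card_bij' (fun x _ => x / y) (fun u _ => u * y) ?_ ?_ ?_ ?_
  · intro x hx
    obtain ⟨h1, h2⟩ := Finset.mem_filter.mp hx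
    have hx' := (hSmem x).mp h1
    exact (hUmem _).mpr ⟨div_ne_zero hx'.1 hy'.1,
      (C.mem_fiber_iff hx'.1 hy'.1).mp (add_right_cancel h2)⟩
  · intro u hu
    obtain ⟨h1, h2⟩ := (hUmem u).mp hu
    have h3 : u * y ≠ 0 := mul_ne_zero h1 hy'.1
    have h4 : C.dv (u * y) = C.dv y :=
      (C.mem_fiber_iff h3 hy'.1).mpr (by rwa [mul_div_cancel_right₀ _ hy'.1])
    refine Finset.mem_filter.mpr ⟨(hSmem _).mpr ⟨h3, ?_⟩, by rw [h4]⟩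
    rw [C.mem_iff _ h3, h4, ← C.mem_iff _ hy'.1]; exact hy'.2
  · intro x _; exact div_mul_cancel₀ _ hy'.1
  · intro u _; exact mul_div_cancel_right₀ _ hy'.1

/-- The principal divisors. -/
def prin : AddSubgroup (P →₀ ℤ) where
  carrier := {D | ∃ x ≠ 0, C.dv x = D}
  zero_mem' := ⟨1, one_ne_zero, C.dv_one⟩
  add_mem' := by
    rintro _ _ ⟨x, hx, rfl⟩ ⟨y, hy, rfl⟩
    exact ⟨x * y, mul_ne_zero hx hy, C.dv_mul x hx y hy⟩
  neg_mem' := by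
    rintro _ ⟨x, hx, rfl⟩
    exact ⟨x⁻¹, inv_ne_zero hx, C.dv_inv hx⟩

/-- The degree of a divisor class. -/
noncomputable def degCl : (P →₀ ℤ) ⧸ C.prin →+ ℤ :=
  QuotientAddGroup.lift _ C.degree (by rintro _ ⟨x, hx, rfl⟩; exact C.degree_dv hx)

theorem degCl_mk (D : P →₀ ℤ) : C.degCl (QuotientAddGroup.mk D) = C.degree D := rfl

theorem eff_mk_eq {n : ℤ} {D : P →₀ ℤ} (hD : C.degree D = n) :
    {E ∈ C.Eff n | (QuotientAddGroup.mk E : (P →₀ ℤ) ⧸ C.prin) = QuotientAddGroup.mk D} =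
      {E | 0 ≤ E ∧ ∃ x ≠ 0, E = C.dv x + D} := by
  ext E
  constructor
  · rintro ⟨⟨h0, h1⟩, h2⟩
    obtain ⟨x, hx, h3⟩ := QuotientAddGroup.eq.mp h2.symm
    exact ⟨h0, x, hx, by rw [h3]; abel⟩
  · rintro ⟨h0, x, hx, rfl⟩
    refine ⟨⟨h0, by rw [map_add, C.degree_dv hx, hD, zero_add]⟩, ?_⟩
    refine (QuotientAddGroup.eq.mpr ?_).symm
    rw [show -D + (C.dv x + D) = C.dv x by abel]
    exact ⟨x, hx, rfl⟩

theorem cast_linear_system [Nonempty P] {n : ℤ} (hn : 2 * (C.g : ℤ) - 2 < n) {D : P →₀ ℤ}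
    (hD : C.degree D = n) :
    ({E | 0 ≤ E ∧ ∃ x ≠ 0, E = C.dv x + D}.ncard : ℚ) * (C.q - 1) =
      (C.q : ℚ) ^ (1 + n - C.g) - 1 := by
  rw [← hD, ← C.a_eq (by rwa [hD])]
  have h1 := C.ncard_linear_system D
  have h2 := C.a_ne_zero D
  have h3 := C.one_lt_q
  rw [← Nat.cast_one, ← Nat.cast_sub h3.le, ← Nat.cast_sub (by omega), ← h1]
  push_cast; ring

theorem exists_class_number (h1 : ∃ D, C.degree D = 1) :
    ∃ h : ℕ, ∀ n : ℤ, 2 * (C.g : ℤ) - 2 < n →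
      (C.A n : ℚ) * (C.q - 1) = h * ((C.q : ℚ) ^ (1 + n - C.g) - 1) := by
  classical
  obtain ⟨D1, hD1⟩ := h1
  have : Nonempty P := by
    by_contra hP
    rw [not_nonempty_iff] at hP
    rw [Subsingleton.elim D1 0, map_zero] at hD1
    omega
  have hq : (1 : ℚ) < C.q := by exact_mod_cast C.one_lt_q
  have hfin : (C.degCl ⁻¹' {2 * (C.g : ℤ)}).Finite := by
    refine ((C.eff_finite (2 * C.g)).image
      (fun E => (QuotientAddGroup.mk E : (P →₀ ℤ) ⧸ C.prin))).subset ?_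
    rintro c hc
    obtain ⟨D, rfl⟩ := QuotientAddGroup.mk_surjective c
    have hc' : C.degree D = 2 * C.g := hc
    have h2 := C.cast_linear_system (n := 2 * C.g) (by omega) hc'
    have h3 : {E | 0 ≤ E ∧ ∃ x ≠ 0, E = C.dv x + D}.Nonempty := by
      by_contra h4
      rw [Set.not_nonempty_iff_eq_empty] at h4
      rw [h4, Set.ncard_empty, Nat.cast_zero, zero_mul] at h2
      have := one_lt_zpow₀ hq (n := 1 + 2 * (C.g : ℤ) - C.g) (by omega)
      linarith
    obtain ⟨E, hE⟩ := h3
    rw [← C.eff_mk_eq hc'] at hE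
    exact ⟨E, hE.1, hE.2⟩
  refine ⟨(C.degCl ⁻¹' {2 * (C.g : ℤ)}).ncard, fun n hn => ?_⟩
  set t : (P →₀ ℤ) ⧸ C.prin := QuotientAddGroup.mk ((n - 2 * C.g) • D1) with ht
  have hdt : C.degCl t = n - 2 * C.g := by
    rw [ht, degCl_mk, map_zsmul, hD1, smul_eq_mul, mul_one]
  have himg : C.degCl ⁻¹' {n} = (· + t) '' (C.degCl ⁻¹' {2 * (C.g : ℤ)}) := by
    ext c
    simp only [Set.mem_preimage, Set.mem_singleton_iff, Set.mem_image]
    constructor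
    · intro hc
      exact ⟨c - t, by rw [map_sub, hc, hdt]; ring, sub_add_cancel _ _⟩
    · rintro ⟨c, hc, rfl⟩
      rw [map_add, hc, hdt]; ring
  have hfin' : (C.degCl ⁻¹' {n}).Finite := himg ▸ hfin.image _
  have hcard : (C.degCl ⁻¹' {2 * (C.g : ℤ)}).ncard = hfin'.toFinset.card := by
    rw [← Set.ncard_eq_toFinset_card _ hfin', himg, Set.ncard_image_of_injective _ (add_left_injective t)]
  rw [hcard, A, Set.ncard_eq_toFinset_card _ (C.eff_finite n),
    Finset.card_eq_sum_card_fiberwise (t := hfin'.toFinset)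
      (f := fun E => (QuotientAddGroup.mk E : (P →₀ ℤ) ⧸ C.prin))]
  · rw [Nat.cast_sum, Finset.sum_mul, ← nsmul_eq_mul]
    refine Finset.sum_eq_card_nsmul fun c hc => ?_
    obtain ⟨D, rfl⟩ := QuotientAddGroup.mk_surjective c
    have hc' : C.degree D = n := hfin'.mem_toFinset.mp hc
    rw [← C.cast_linear_system hn hc', ← C.eff_mk_eq hc', ← Set.ncard_coe_finset]
    congr 3
    ext E; simp
  · intro E hE
    have hE' : E ∈ C.Eff n := by simpa using hE
    exact hfin'.mem_toFinset.mpr hE'.2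

end CurveData

end

section

section PowerSums

open PowerSeries

/-- The power series `∑_{m ≥ 1} a m * X ^ m`. -/
noncomputable def tailSeries (a : ℕ → ℂ) : PowerSeries ℂ :=
  PowerSeries.mk fun m => if m = 0 then 0 else a m

theorem one_sub_mul_tailSeries (w : ℂ) :
    (1 - C w * X : PowerSeries ℂ) * tailSeries (w ^ ·) = C w * X := by
  ext n
  rcases n with _ | n
  · simp [sub_mul, tailSeries, mul_assoc]
  · rw [sub_mul, one_mul, mul_assoc, map_sub, coeff_C_mul, coeff_C_mul, coeff_succ_X_mul]
    rcases n with _ | n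
    · simp [tailSeries]
    · simp [tailSeries, coeff_X, pow_succ']

theorem X_mul_derivative_prod (s : Multiset ℂ) :
    X * derivative ℂ (s.map fun w => (1 - C w * X : PowerSeries ℂ)).prod =
      -((s.map fun w => (1 - C w * X : PowerSeries ℂ)).prod *
        tailSeries fun m => (s.map (· ^ m)).sum) := by
  induction s using Multiset.induction_on with
  | empty =>
    have : tailSeries (fun m => ((0 : Multiset ℂ).map (· ^ m)).sum) = 0 := by
      ext n; simp [tailSeries]
    rw [this]
    simp
  | cons w s ih =>
    have hadd : tailSeries (fun m => ((w ::ₘ s).map (· ^ m)).sum) =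
        tailSeries (w ^ ·) + tailSeries fun m => (s.map (· ^ m)).sum := by
      ext n
      by_cases hn : n = 0 <;> simp [tailSeries, hn]
    have hd : derivative ℂ (1 - C w * X : PowerSeries ℂ) = - C w := by
      simp [Derivation.leibniz, derivative_C, derivative_X]
    rw [Multiset.map_cons, Multiset.prod_cons, hadd, Derivation.leibniz, smul_eq_mul, smul_eq_mul,
      mul_add, hd]
    linear_combination (1 - C w * X : PowerSeries ℂ) * ih +
      (s.map fun w => (1 - C w * X : PowerSeries ℂ)).prod * one_sub_mul_tailSeries w

theorem exists_multiset_of_logDeriv {L M : PowerSeries ℂ} {n : ℕ} (h0 : constantCoeff L = 1)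
    (hn : ∀ m, n < m → coeff m L = 0) (hM : X * derivative ℂ L = -(L * M)) :
    ∃ s : Multiset ℂ, s.card ≤ n ∧ ∀ m ≠ 0, coeff m M = (s.map (· ^ m)).sum := by
  set l := trunc (n + 1) L with hl
  have hlL : (l : PowerSeries ℂ) = L := by
    ext m
    rw [Polynomial.coeff_coe, hl, coeff_trunc]
    split_ifs with h
    · rfl
    · exact (hn m (by omega)).symm
  have hl0 : l.coeff 0 = 1 := by
    rw [← Polynomial.coeff_coe, hlL, coeff_zero_eq_constantCoeff_apply, h0]
  have hne : l ≠ 0 := by rintro h; rw [h] at hl0; simp at hl0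
  have hroot : ∀ r ∈ l.roots, r ≠ 0 := by
    rintro r hr rfl
    have := (Polynomial.mem_roots hne).mp hr
    rw [Polynomial.IsRoot, ← Polynomial.coeff_zero_eq_eval_zero, hl0] at this
    exact one_ne_zero this
  have hsplit := (IsAlgClosed.splits l).eq_prod_roots
  have h1 : (l.roots.map fun a => Polynomial.X - Polynomial.C a) =
      l.roots.map fun a => Polynomial.C (-a) * (1 - Polynomial.C a⁻¹ * Polynomial.X) := by
    refine Multiset.map_congr rfl fun a ha => ?_
    have : (Polynomial.C a * Polynomial.C a⁻¹ : Polynomial ℂ) = 1 := by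
      rw [← Polynomial.C_mul, mul_inv_cancel₀ (hroot a ha), Polynomial.C_1]
    rw [Polynomial.C_neg]
    linear_combination (-Polynomial.X) * this
  rw [h1, Multiset.prod_map_mul, ← mul_assoc] at hsplit
  obtain ⟨c, hc⟩ : ∃ c, Polynomial.C l.leadingCoeff *
      (l.roots.map fun a => Polynomial.C (-a)).prod = Polynomial.C c := by
    refine ⟨l.leadingCoeff * (l.roots.map fun a => -a).prod, ?_⟩
    rw [Polynomial.C_mul]
    congr 1
    rw [← Multiset.prod_hom _ Polynomial.C, Multiset.map_map]; rfl
  rw [hc] at hsplit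
  have hc1 : c = 1 := by
    have := congrArg (fun r => Polynomial.eval 0 r) hsplit
    simp only [Polynomial.eval_mul, Polynomial.eval_C, Polynomial.eval_multiset_prod,
      Multiset.map_map, Function.comp_def, ← Polynomial.coeff_zero_eq_eval_zero, hl0] at this
    simpa using this.symm
  rw [hc1, Polynomial.C_1, one_mul] at hsplit
  refine ⟨l.roots.map (·⁻¹), ?_, fun m hm => ?_⟩
  · rw [Multiset.card_map]
    refine (Polynomial.card_roots' l).trans ?_
    exact Nat.lt_succ_iff.mp (natDegree_trunc_lt L n)
  · have hL : L = ((l.roots.map (·⁻¹)).map fun w => (1 - C w * X : PowerSeries ℂ)).prod := by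
      rw [← hlL]
      have := congrArg Polynomial.coeToPowerSeries.ringHom hsplit
      rw [Polynomial.coeToPowerSeries.ringHom_apply] at this
      rw [this, map_multiset_prod, Multiset.map_map, Multiset.map_map]
      congr 1
      refine Multiset.map_congr rfl fun a _ => ?_
      simp
    have h2 := X_mul_derivative_prod (l.roots.map (·⁻¹))
    rw [← hL, hM, neg_inj] at h2
    have hLne : L ≠ 0 := by
      rintro h; rw [h] at h0; simp at h0
    rw [mul_left_cancel₀ hLne h2, tailSeries, coeff_mk, if_neg hm]

theorem norm_le_of_norm_powerSum_le (s : Multiset ℂ) {r c : ℝ} (hr : 0 < r)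
    (h : ∀ k : ℕ, k ≠ 0 → ‖(s.map (· ^ k)).sum‖ ≤ c * r ^ k) : ∀ w ∈ s, ‖w‖ ≤ r := by
  classical
  intro w hw
  by_contra! hlt
  set u : Polynomial ℂ := ∏ v ∈ s.toFinset.erase w, (Polynomial.X - Polynomial.C v) with hu
  have huw : u.eval w ≠ 0 := by
    rw [hu, Polynomial.eval_prod, Finset.prod_ne_zero_iff]
    intro v hv
    simpa [sub_ne_zero] using (Finset.ne_of_mem_erase hv).symm
  have hu0 : ∀ v ∈ s, v ≠ w → u.eval v = 0 := by
    intro v hv hne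
    rw [hu, Polynomial.eval_prod]
    exact Finset.prod_eq_zero (Finset.mem_erase.mpr ⟨hne, Multiset.mem_toFinset.mpr hv⟩)
      (by simp)
  have h1 : ∀ k, (s.map fun v => v ^ k * u.eval v).sum = s.count w * (w ^ k * u.eval w) := by
    intro k
    rw [Finset.sum_multiset_map_count, Finset.sum_eq_single w]
    · rw [nsmul_eq_mul]
    · intro v hv hne
      rw [hu0 v (Multiset.mem_toFinset.mp hv) hne, mul_zero, smul_zero]
    · intro h; exact absurd (Multiset.mem_toFinset.mpr hw) h
  have h2 : ∀ k, (s.map fun v => v ^ k * u.eval v).sum =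
      ∑ j ∈ Finset.range (u.natDegree + 1), u.coeff j * (s.map (· ^ (k + j))).sum := by
    intro k
    simp_rw [← Multiset.sum_map_mul_left, Polynomial.eval_eq_sum_range, Finset.mul_sum]
    rw [Multiset.sum_map_sum]
    refine Finset.sum_congr rfl fun j _ => ?_
    congr 1
    refine Multiset.map_congr rfl fun v _ => ?_
    ring
  set K := ∑ j ∈ Finset.range (u.natDegree + 1), ‖u.coeff j‖ * (c * r ^ j) with hK
  have h3 : ∀ k ≠ 0, ‖w‖ ^ k * ‖u.eval w‖ ≤ K * r ^ k := by
    intro k hk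
    have hcount : (1 : ℝ) ≤ s.count w := by
      exact_mod_cast Multiset.one_le_count_iff_mem.mpr hw
    calc ‖w‖ ^ k * ‖u.eval w‖ ≤ s.count w * (‖w‖ ^ k * ‖u.eval w‖) :=
          le_mul_of_one_le_left (by positivity) hcount
      _ = ‖(s.map fun v => v ^ k * u.eval v).sum‖ := by
          rw [h1, norm_mul, norm_mul, norm_pow, Complex.norm_natCast]
      _ ≤ ∑ j ∈ Finset.range (u.natDegree + 1), ‖u.coeff j‖ * (c * r ^ (k + j)) := by
          rw [h2]
          refine (norm_sum_le _ _).trans (Finset.sum_le_sum fun j _ => ?_)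
          rw [norm_mul]
          exact mul_le_mul_of_nonneg_left (h _ (by omega)) (norm_nonneg _)
      _ = K * r ^ k := by
          rw [hK, Finset.sum_mul]
          exact Finset.sum_congr rfl fun j _ => by rw [pow_add]; ring
  have hpos : 0 < ‖u.eval w‖ := norm_pos_iff.mpr huw
  obtain ⟨k, hk⟩ := pow_unbounded_of_one_lt (K / ‖u.eval w‖) ((one_lt_div hr).mpr hlt)
  have hk' : K / ‖u.eval w‖ < (‖w‖ / r) ^ (k + 1) := hk.trans_le
    (pow_le_pow_right₀ ((one_lt_div hr).mpr hlt).le (Nat.le_succ k))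
  rw [div_pow, div_lt_div_iff₀ hpos (by positivity)] at hk'
  exact absurd (h3 (k + 1) (by omega)) (not_le.mpr hk')

end PowerSums

end

section

namespace CurveData

variable {F P : Type*} [Field F] (C : CurveData F P)

/-- The number of points of the curve over the extension of degree `m` of the constant field. -/
noncomputable def N (m : ℕ) : ℕ := ∑ᶠ p ∈ {p | C.deg p ∣ m}, C.deg p

theorem finite_deg_le (n : ℕ) : {p | C.deg p ≤ n}.Finite := by
  have : {p | C.deg p ≤ n} = ⋃ m ∈ Finset.range (n + 1), {p | C.deg p = m} := by
    ext p; simp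
  rw [this]
  exact Set.Finite.biUnion (Finset.finite_toSet _) fun m _ => C.finite_deg m

theorem finite_deg_dvd {m : ℕ} (hm : m ≠ 0) : {p | C.deg p ∣ m}.Finite :=
  (C.finite_deg_le m).subset fun _ hp => Nat.le_of_dvd (Nat.pos_of_ne_zero hm) hp

theorem N_eq_sum {m n : ℕ} (hm : m ≠ 0) (hmn : m ≤ n) :
    C.N m = ∑ p ∈ (C.finite_deg_le n).toFinset, if C.deg p ∣ m then C.deg p else 0 := by
  classical
  rw [N, finsum_mem_eq_finite_toFinset_sum _ (C.finite_deg_dvd hm), ← Finset.sum_filter]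
  refine Finset.sum_congr ?_ fun _ _ => rfl
  ext p
  rw [Set.Finite.mem_toFinset, Finset.mem_filter, Set.Finite.mem_toFinset]
  exact ⟨fun h => ⟨(Nat.le_of_dvd (Nat.pos_of_ne_zero hm) h).trans hmn, h⟩, fun h => h.2⟩

theorem card_eff_ge (n : ℤ) (p : P) (k : ℕ) :
    ((C.eff_finite n).toFinset.filter fun D => (k : ℤ) ≤ D p).card = C.A (n - k * C.deg p) := by
  classical
  rw [A, Set.ncard_eq_toFinset_card _ (C.eff_finite _)]
  refine Finset.card_bij' (fun D _ => D - .single p (k : ℤ)) (fun D _ => D + .single p (k : ℤ))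
    ?_ ?_ ?_ ?_
  · intro D hD
    obtain ⟨h1, h2⟩ := Finset.mem_filter.mp hD
    rw [Set.Finite.mem_toFinset] at h1 ⊢
    refine ⟨?_, by rw [map_sub, degree_single, h1.2]⟩
    intro r
    rw [Finsupp.sub_apply, Finsupp.single_apply]
    split_ifs with h
    · subst h; simpa using h2
    · simpa using h1.1 r
  · intro D hD
    rw [Set.Finite.mem_toFinset] at hD
    refine Finset.mem_filter.mpr ⟨?_, ?_⟩
    · rw [Set.Finite.mem_toFinset]
      refine ⟨add_nonneg hD.1 (by simp), ?_⟩
      rw [map_add, degree_single, hD.2]; ring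
    · have := hD.1 p
      simpa using this
  · intro D _; exact sub_add_cancel _ _
  · intro D _; exact add_sub_cancel_right _ _

theorem sum_eff_apply (n : ℕ) (p : P) :
    ∑ D ∈ (C.eff_finite n).toFinset, D p = ∑ k ∈ Finset.Icc 1 n, (C.A (n - k * C.deg p) : ℤ) := by
  classical
  have h1 : ∀ D ∈ (C.eff_finite n).toFinset,
      D p = ∑ k ∈ Finset.Icc 1 n, if (k : ℤ) ≤ D p then (1 : ℤ) else 0 := by
    intro D hD
    rw [Set.Finite.mem_toFinset] at hD
    have h0 : 0 ≤ D p := hD.1 p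
    have hn : D p ≤ n := by
      have h2 : 0 ≤ D - .single p (D p) := by
        intro r
        rw [Finsupp.sub_apply, Finsupp.single_apply]
        split_ifs with h
        · subst h; simp
        · simpa using hD.1 r
      have h3 := C.degree_nonneg h2
      rw [map_sub, degree_single, hD.2] at h3
      have h4 : (1 : ℤ) ≤ C.deg p := by exact_mod_cast C.deg_pos p
      nlinarith
    rw [← Finset.sum_filter, Finset.sum_const, nsmul_eq_mul, mul_one]
    have : (Finset.Icc 1 n).filter (fun k : ℕ => (k : ℤ) ≤ D p) = Finset.Icc 1 (D p).toNat := by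
      ext k; simp; omega
    rw [this, Nat.card_Icc]; omega
  rw [Finset.sum_congr rfl h1, Finset.sum_comm]
  refine Finset.sum_congr rfl fun k _ => ?_
  rw [← C.card_eff_ge, Finset.card_filter]
  push_cast; rfl

theorem sum_A_multiples (n : ℕ) (p : P) :
    ∑ k ∈ Finset.Icc 1 n, (C.A (n - k * C.deg p) : ℤ) =
      ∑ m ∈ Finset.Icc 1 n, if C.deg p ∣ m then (C.A (n - m) : ℤ) else 0 := by
  classical
  have hp := C.deg_pos p
  rw [← Finset.sum_filter]
  have h1 : ∑ k ∈ Finset.Icc 1 n, (C.A (n - k * C.deg p) : ℤ) =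
      ∑ k ∈ (Finset.Icc 1 n).filter (fun k => k * C.deg p ≤ n), (C.A (n - k * C.deg p) : ℤ) := by
    refine (Finset.sum_filter_of_ne fun k _ hne => ?_).symm
    by_contra! hlt
    refine hne ?_
    rw [C.A_neg]; · rfl
    zify at hlt; omega
  rw [h1]
  refine Finset.sum_bij' (fun k _ => k * C.deg p) (fun m _ => m / C.deg p) ?_ ?_ ?_ ?_ ?_
  · intro k hk
    simp only [Finset.mem_filter, Finset.mem_Icc] at hk ⊢
    exact ⟨⟨Nat.mul_pos hk.1.1 hp, hk.2⟩, dvd_mul_left _ _⟩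
  · intro m hm
    simp only [Finset.mem_filter, Finset.mem_Icc] at hm ⊢
    refine ⟨⟨Nat.div_pos (Nat.le_of_dvd hm.1.1 hm.2) hp, (Nat.div_le_self _ _).trans hm.1.2⟩, ?_⟩
    rw [Nat.div_mul_cancel hm.2]; exact hm.1.2
  · intro k _; exact Nat.mul_div_cancel _ hp
  · intro m hm
    exact Nat.div_mul_cancel (Finset.mem_filter.mp hm).2
  · intro k _; push_cast; rfl

theorem mul_A (n : ℕ) :
    (n * C.A n : ℤ) = ∑ m ∈ Finset.Icc 1 n, (C.N m : ℤ) * C.A (n - m) := by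
  classical
  set T := (C.finite_deg_le n).toFinset with hT
  have hdeg : ∀ D ∈ (C.eff_finite n).toFinset, (n : ℤ) = ∑ p ∈ T, D p * C.deg p := by
    intro D hD
    rw [Set.Finite.mem_toFinset] at hD
    conv_lhs => rw [← hD.2]
    rw [degree, Finsupp.weight_apply, Finsupp.sum]
    refine Finset.sum_subset ?_ fun p _ hp => ?_
    · intro p hp
      rw [hT, Set.Finite.mem_toFinset]
      have h1 : 1 ≤ D p := by
        have := hD.1 p
        have h2 := Finsupp.mem_support_iff.mp hp
        simp at this; omega
      have h2 : 0 ≤ D - .single p 1 := by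
        intro r
        rw [Finsupp.sub_apply, Finsupp.single_apply]
        split_ifs with h
        · subst h; simpa using h1
        · simpa using hD.1 r
      have h3 := C.degree_nonneg h2
      rw [map_sub, degree_single, hD.2] at h3
      change C.deg p ≤ n
      omega
    · rw [Finsupp.notMem_support_iff.mp hp, zero_smul]
  calc (n * C.A n : ℤ) = ∑ D ∈ (C.eff_finite n).toFinset, (n : ℤ) := by
        rw [Finset.sum_const, nsmul_eq_mul, A, Set.ncard_eq_toFinset_card _ (C.eff_finite _)]
        ring
    _ = ∑ D ∈ (C.eff_finite n).toFinset, ∑ p ∈ T, D p * C.deg p := Finset.sum_congr rfl hdeg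
    _ = ∑ p ∈ T, C.deg p * ∑ m ∈ Finset.Icc 1 n, if C.deg p ∣ m then (C.A (n - m) : ℤ) else 0 := by
        rw [Finset.sum_comm]
        refine Finset.sum_congr rfl fun p _ => ?_
        rw [← Finset.sum_mul, C.sum_eff_apply, C.sum_A_multiples, mul_comm]
    _ = ∑ m ∈ Finset.Icc 1 n, (C.N m : ℤ) * C.A (n - m) := by
        simp_rw [Finset.mul_sum]
        rw [Finset.sum_comm]
        refine Finset.sum_congr rfl fun m hm => ?_
        obtain ⟨hm1, hm2⟩ := Finset.mem_Icc.mp hm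
        rw [C.N_eq_sum (by omega) hm2, Nat.cast_sum, Finset.sum_mul]
        refine Finset.sum_congr rfl fun p _ => ?_
        split_ifs <;> simp

open PowerSeries

/-- The zeta function. -/
noncomputable def Z : PowerSeries ℂ := PowerSeries.mk fun n => (C.A n : ℂ)

theorem X_mul_derivative_Z :
    X * derivative ℂ C.Z = C.Z * tailSeries fun m => (C.N m : ℂ) := by
  ext n
  have h1 : coeff n (X * derivative ℂ C.Z) = (n * C.A n : ℂ) := by
    rcases n with _ | n
    · simp
    · rw [coeff_succ_X_mul, PowerSeries.coeff_derivative, Z, coeff_mk]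
      push_cast; ring
  have h2 := congrArg (Int.cast (R := ℂ)) (C.mul_A n)
  push_cast at h2
  rw [h1, h2, mul_comm, coeff_mul, Finset.Nat.sum_antidiagonal_eq_sum_range_succ_mk,
    Finset.range_eq_Ico, Finset.sum_eq_sum_Ico_succ_bot (by omega)]
  simp only [tailSeries, Z, coeff_mk, if_true, zero_mul, zero_add]
  have : Finset.Icc 1 n = Finset.Ico 1 (n + 1) := by ext; simp
  rw [this]
  refine Finset.sum_congr rfl fun m hm => ?_
  obtain ⟨hm1, hm2⟩ := Finset.mem_Ico.mp hm
  rw [if_neg (by omega), ← Nat.cast_sub (by omega)]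

theorem exists_frobenius_eigenvalues (h1 : ∃ D, C.degree D = 1) :
    ∃ s : Multiset ℂ, s.card ≤ 2 * C.g ∧
      ∀ m ≠ 0, (C.N m : ℂ) = C.q ^ m + 1 - (s.map (· ^ m)).sum := by
  obtain ⟨h, hA⟩ := C.exists_class_number h1
  set q : ℂ := ((C.q : ℕ) : ℂ) with hq
  set L : PowerSeries ℂ := (1 - PowerSeries.C (1 : ℂ) * X) * (1 - PowerSeries.C q * X) * C.Z with hL
  set U := tailSeries ((1 : ℂ) ^ ·) with hU
  set V := tailSeries (q ^ ·) with hV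
  set M := tailSeries fun m => (C.N m : ℂ) with hM
  have hU1 := one_sub_mul_tailSeries 1
  have hV1 := one_sub_mul_tailSeries q
  have hA' : ∀ n : ℤ, 2 * (C.g : ℤ) - 2 < n →
      (C.A n : ℂ) * (q - 1) = h * (q ^ (1 + n - C.g) - 1) := by
    intro n hn
    have := congrArg (Rat.cast (K := ℂ)) (hA n hn)
    push_cast at this
    exact this
  have hq1 : q - 1 ≠ 0 := by
    rw [sub_ne_zero, hq]; exact_mod_cast C.one_lt_q.ne'
  have hq0 : q ≠ 0 := by
    rw [hq]; have := C.one_lt_q; exact_mod_cast (by omega : C.q ≠ 0)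
  have hcoeff : ∀ n : ℕ, coeff n L = C.A n - (1 + q) * C.A (n - 1) + q * C.A (n - 2) := by
    intro n
    have e : L = C.Z - PowerSeries.C (1 + q) * (X * C.Z) +
        PowerSeries.C q * (X * (X * C.Z)) := by
      rw [hL, map_add, map_one]; ring
    rw [e, map_add, map_sub, coeff_C_mul, coeff_C_mul]
    rcases n with _ | _ | n
    · simp [Z, C.A_neg]
    · rw [coeff_succ_X_mul, coeff_succ_X_mul]
      simp [Z, C.A_neg]
    · rw [coeff_succ_X_mul, coeff_succ_X_mul, coeff_succ_X_mul]
      simp only [Z, coeff_mk]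
      push_cast
      ring_nf
  have c0 : constantCoeff L = 1 := by
    have := hcoeff 0
    rw [coeff_zero_eq_constantCoeff_apply] at this
    rw [this]
    simp [C.A_neg, C.A_zero]
  have c1 : ∀ n, 2 * C.g < n → coeff n L = 0 := by
    intro n hn
    rw [hcoeff]
    refine mul_right_cancel₀ hq1 ?_
    have e0 := hA' n (by omega)
    have e1 := hA' (n - 1) (by omega)
    have e2 := hA' (n - 2) (by omega)
    have p0 : q ^ (1 + (n : ℤ) - C.g) = q ^ (1 + ((n : ℤ) - 1) - C.g) * q := by
      rw [← zpow_add_one₀ hq0]; congr 1; ring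
    have p1 : q ^ (1 + ((n : ℤ) - 1) - C.g) = q ^ (1 + ((n : ℤ) - 2) - C.g) * q := by
      rw [← zpow_add_one₀ hq0]; congr 1; ring
    rw [p0] at e0
    linear_combination e0 - (1 + q) * e1 + q * e2 - h * p1 * 1
  have c2 : X * derivative ℂ L = -(L * (U + V - M)) := by
    have hZ := C.X_mul_derivative_Z
    have hd : ∀ w : ℂ, derivative ℂ (1 - PowerSeries.C w * X : PowerSeries ℂ) =
        -PowerSeries.C w := by
      intro w; simp
    rw [hL, Derivation.leibniz, Derivation.leibniz, hd, hd, smul_eq_mul, smul_eq_mul, smul_eq_mul,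
      smul_eq_mul]
    linear_combination (1 - PowerSeries.C (1 : ℂ) * X) * (1 - PowerSeries.C q * X) * hZ +
      (1 - PowerSeries.C q * X) * C.Z * hU1 + (1 - PowerSeries.C (1 : ℂ) * X) * C.Z * hV1
  obtain ⟨s, hs, hs'⟩ := exists_multiset_of_logDeriv c0 c1 c2
  refine ⟨s, hs, fun m hm => ?_⟩
  rw [← hs' m hm, hU, hV, hM]
  simp [tailSeries, hm]
  ring

/-- A weak estimate for all even extensions implies the Hasse-Weil bound. -/
theorem hasse_weil (h1 : ∃ D, C.degree D = 1) {c : ℝ}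
    (hc : ∀ k ≠ 0, |(C.N (2 * k) : ℝ) - (C.q : ℝ) ^ (2 * k)| ≤ c * (C.q : ℝ) ^ k) :
    |(C.N 1 : ℝ) - (C.q + 1)| ≤ 2 * C.g * √C.q := by
  obtain ⟨s, hs, hN⟩ := C.exists_frobenius_eigenvalues h1
  have hq0 : (1 : ℝ) < C.q := by exact_mod_cast C.one_lt_q
  have hsq : ∀ w ∈ s, ‖w‖ ≤ √C.q := by
    have h2 := norm_le_of_norm_powerSum_le (s.map (· ^ 2)) (r := C.q) (c := c + 1) (by linarith) ?_
    · intro w hw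
      have := h2 (w ^ 2) (Multiset.mem_map_of_mem _ hw)
      rw [norm_pow] at this
      exact Real.le_sqrt_of_sq_le this
    · intro k hk
      have e : (((s.map (· ^ 2)).map (· ^ k)).sum : ℂ) =
          ((1 - ((C.N (2 * k) : ℝ) - (C.q : ℝ) ^ (2 * k)) : ℝ) : ℂ) := by
        have := hN (2 * k) (by omega)
        rw [Multiset.map_map]
        push_cast
        rw [this]
        simp only [Function.comp_def, ← pow_mul]
        ring
      rw [e, Complex.norm_real, Real.norm_eq_abs]
      have h3 := hc k hk
      have h4 : (1 : ℝ) ≤ (C.q : ℝ) ^ k := one_le_pow₀ hq0.le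
      calc _ ≤ |(1 : ℝ)| + |(C.N (2 * k) : ℝ) - (C.q : ℝ) ^ (2 * k)| := abs_sub _ _
        _ ≤ (C.q : ℝ) ^ k + c * (C.q : ℝ) ^ k := by rw [abs_one]; exact add_le_add h4 h3
        _ = _ := by ring
  have e : (((C.N 1 : ℝ) - (C.q + 1) : ℝ) : ℂ) = -(s.map (· ^ 1)).sum := by
    have := hN 1 one_ne_zero
    push_cast
    rw [this]; ring
  rw [← Real.norm_eq_abs, ← Complex.norm_real, e, norm_neg]
  simp only [pow_one, Multiset.map_id']
  have h5 : ‖s.sum‖ ≤ (s.map fun w => ‖w‖).sum := norm_multiset_sum_le s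
  refine h5.trans ?_
  have h6 := Multiset.sum_le_card_nsmul (s.map fun w : ℂ => ‖w‖) (√C.q) (by
    intro x hx
    obtain ⟨w, hw, rfl⟩ := Multiset.mem_map.mp hx
    exact hsq w hw)
  refine h6.trans ?_
  rw [Multiset.card_map, nsmul_eq_mul]
  refine mul_le_mul_of_nonneg_right ?_ (Real.sqrt_nonneg _)
  exact_mod_cast hs

end CurveData

end

section

open IsDedekindDomain WithZero

namespace IsDedekindDomain.HeightOneSpectrum

variable {R : Type*} [CommRing R] [IsDedekindDomain R] (F : Type*) [Field F] [Algebra R F]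
  [IsFractionRing R F]

/-- Sections of a divisor on the spectrum of a Dedekind domain. -/
def sections (D : HeightOneSpectrum R →₀ ℤ) : AddSubgroup F where
  carrier := {x | ∀ v, v.valuation F x ≤ exp (D v)}
  zero_mem' v := by simp
  add_mem' ha hb v := (Valuation.map_add_le _ (ha v) (hb v))
  neg_mem' ha v := by simpa only [Valuation.map_neg] using ha v

variable {F}

theorem mem_sections {D : HeightOneSpectrum R →₀ ℤ} {x : F} :
    x ∈ sections F D ↔ ∀ v, v.valuation F x ≤ exp (D v) := Iff.rfl

variable (F) in
theorem sections_mono : Monotone (sections (R := R) F) := fun _ _ h _ hx v =>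
  (hx v).trans (exp_le_exp.mpr (h v))

theorem mem_sections_zero {x : F} : x ∈ sections (R := R) F 0 ↔ x ∈ (algebraMap R F).range := by
  refine ⟨fun h => mem_integers_of_valuation_le_one F x fun v => by simpa using h v, ?_⟩
  rintro ⟨a, rfl⟩ v
  simpa using v.valuation_le_one a

variable (R) in
theorem finite_valuation_ne_one {x : F} (hx : x ≠ 0) :
    {v : HeightOneSpectrum R | v.valuation F x ≠ 1}.Finite := by
  refine ((Support.finite R x).union (Support.finite R x⁻¹)).subset fun v hv => ?_
  rcases lt_or_gt_of_ne hv with h | h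
  · refine Or.inr ?_
    change 1 < v.valuation F x⁻¹
    rw [map_inv₀]
    exact (one_lt_inv₀ (zero_lt_iff.mpr ((Valuation.ne_zero_iff _).mpr hx))).mpr h
  · exact Or.inl h

variable (R) in
open Classical in
/-- The principal divisor of a nonzero element. -/
noncomputable def principal (x : F) : HeightOneSpectrum R →₀ ℤ :=
  if hx : x = 0 then 0 else
    Finsupp.ofSupportFinite (fun v => -log (v.valuation F x)) <|
      (finite_valuation_ne_one R hx).subset fun v hv h => hv (by simp [h])

theorem principal_apply {x : F} (hx : x ≠ 0) (v : HeightOneSpectrum R) :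
    principal R x v = -log (v.valuation F x) := by
  rw [principal, dif_neg hx]
  rfl

theorem valuation_eq_exp {x : F} (hx : x ≠ 0) (v : HeightOneSpectrum R) :
    v.valuation F x = exp (-principal R x v) := by
  rw [principal_apply hx, neg_neg, exp_log ((Valuation.ne_zero_iff _).mpr hx)]

theorem principal_mul {x y : F} (hx : x ≠ 0) (hy : y ≠ 0) :
    principal R (x * y) = principal R x + principal R y := by
  ext v
  rw [Finsupp.add_apply, principal_apply hx, principal_apply hy, principal_apply (mul_ne_zero hx hy),
    map_mul, log_mul ((Valuation.ne_zero_iff _).mpr hx) ((Valuation.ne_zero_iff _).mpr hy),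
    neg_add]

theorem mem_sections_iff {x : F} (hx : x ≠ 0) (D : HeightOneSpectrum R →₀ ℤ) :
    x ∈ sections F D ↔ 0 ≤ principal R x + D := by
  rw [mem_sections, Finsupp.le_def]
  refine forall_congr' fun v => ?_
  rw [valuation_eq_exp hx, exp_le_exp, Finsupp.add_apply, Finsupp.zero_apply]
  constructor <;> intro h <;> linarith

theorem mul_mem_sections {b : F} (hb : b ≠ 0) (D : HeightOneSpectrum R →₀ ℤ) (x : F) :
    b * x ∈ sections F (D - principal R b) ↔ x ∈ sections F D := by
  rcases eq_or_ne x 0 with rfl | hx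
  · simp [zero_mem]
  rw [mem_sections_iff hx, mem_sections_iff (mul_ne_zero hb hx), principal_mul hb hx]
  rw [show principal R b + principal R x + (D - principal R b) = principal R x + D by abel]

theorem exists_mem_sections (v : HeightOneSpectrum R) (D : HeightOneSpectrum R →₀ ℤ) :
    ∃ y ∈ sections F D, v.valuation F y = exp (D v) := by
  classical
  obtain ⟨π, hπ⟩ := v.valuation_exists_uniformizer F
  have hπ0 : π ≠ 0 := by
    rintro rfl
    rw [map_zero] at hπ
    exact exp_ne_zero hπ.symm
  set y₀ : F := π ^ (-D v) with hy₀
  have hy₀0 : y₀ ≠ 0 := zpow_ne_zero _ hπ0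
  have hvy₀ : v.valuation F y₀ = exp (D v) := by
    rw [hy₀, map_zpow₀, hπ, ← exp_zsmul]
    simp
  set T : Finset (HeightOneSpectrum R) := ((principal R y₀ + D).support.erase v) with hT
  have hex : ∀ w : HeightOneSpectrum R, ∃ z : R, w ≠ v → z ∈ w.asIdeal ∧ z ∉ v.asIdeal := by
    intro w
    by_cases hw : w = v
    · exact ⟨0, fun h => (h hw).elim⟩
    · obtain ⟨z, hz, hz'⟩ := Set.not_subset.mp (fun h : w.asIdeal ≤ v.asIdeal =>
        hw (HeightOneSpectrum.ext (w.isMaximal.eq_of_le v.isMaximal.ne_top h)))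
      exact ⟨z, fun _ => ⟨hz, hz'⟩⟩
  choose z hz using hex
  set n : HeightOneSpectrum R → ℕ := fun w => (-(principal R y₀ + D) w).toNat with hn
  refine ⟨algebraMap R F (∏ w ∈ T, z w ^ n w) * y₀, ?_, ?_⟩
  · intro w
    rw [map_mul]
    by_cases hw : w ∈ T
    · have hwv : w ≠ v := Finset.ne_of_mem_erase hw
      rw [← Finset.mul_prod_erase T _ hw, map_mul, map_mul]
      have h1 : w.valuation F (algebraMap R F (z w ^ n w)) ≤ exp (-(n w : ℤ)) := by
        have h2 : w.valuation F (algebraMap R F (z w)) ≤ exp (-1 : ℤ) := by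
          have := (w.valuation_lt_one_iff_mem (K := F) (z w)).mpr (hz w hwv).1
          rcases eq_or_ne (w.valuation F (algebraMap R F (z w))) 0 with h0 | h0
          · simp [h0]
          · rw [← log_le_iff_le_exp h0]
            rw [← exp_log h0, ← exp_zero, exp_lt_exp] at this
            omega
        rw [map_pow, map_pow]
        calc _ ≤ exp (-1 : ℤ) ^ n w := pow_le_pow_left' h2 _
          _ = _ := by rw [← exp_nsmul]; simp
      have h3 := w.valuation_le_one (K := F) (∏ w ∈ T.erase w, z w ^ n w)
      rw [valuation_eq_exp hy₀0 w]
      calc _ ≤ exp (-(n w : ℤ)) * 1 * exp (-principal R y₀ w) :=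
            mul_le_mul_left (mul_le_mul' h1 h3) _
        _ = exp (-(n w : ℤ) + -principal R y₀ w) := by rw [mul_one, exp_add]
        _ ≤ _ := by
          rw [exp_le_exp]
          have := Int.self_le_toNat (-(principal R y₀ + D) w)
          simp only [hn, Finsupp.add_apply] at this ⊢
          omega
    · have h3 := w.valuation_le_one (K := F) (∏ w ∈ T, z w ^ n w)
      refine (mul_le_of_le_one_left' h3).trans ?_
      by_cases hwv : w = v
      · rw [hwv, hvy₀]
      · have : (principal R y₀ + D) w = 0 := by
          by_contra h
          exact hw (Finset.mem_erase.mpr ⟨hwv, Finsupp.mem_support_iff.mpr h⟩)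
        rw [valuation_eq_exp hy₀0 w, exp_le_exp]
        rw [Finsupp.add_apply] at this
        omega
  · rw [map_mul, hvy₀, (valuation_eq_one_iff_notMem v).mpr, one_mul]
    rw [Ideal.IsPrime.prod_mem_iff]
    rintro ⟨w, hw, h⟩
    exact (hz w (Finset.ne_of_mem_erase hw)).2 (Ideal.IsPrime.mem_of_pow_mem inferInstance _ h)

variable (F) in
theorem relIndex_sections (v : HeightOneSpectrum R) (D : HeightOneSpectrum R →₀ ℤ) :
    (sections F D).relIndex (sections F (D + .single v 1)) = Nat.card (R ⧸ v.asIdeal) := by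
  classical
  obtain ⟨y, hy, hvy⟩ := exists_mem_sections (F := F) v (D + .single v 1)
  have hy0 : y ≠ 0 := by
    rintro rfl
    simp at hvy
  have hne (w : HeightOneSpectrum R) (hw : w ≠ v) : (D + .single v 1 : HeightOneSpectrum R →₀ ℤ) w = D w := by
    simp [Finsupp.single_eq_of_ne hw]
  have heq : (D + .single v 1 : HeightOneSpectrum R →₀ ℤ) v = D v + 1 := by simp
  rw [heq] at hvy
  set φ : R →+ F := (AddMonoidHom.mulRight y).comp (algebraMap R F).toAddMonoidHom with hφ
  have hφa (a : R) : φ a = algebraMap R F a * y := rfl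
  have hφmem (a : R) : φ a ∈ sections F (D + Finsupp.single v 1) := fun w => by
    rw [hφa, map_mul]
    exact (mul_le_of_le_one_left' (w.valuation_le_one a)).trans (hy w)
  have hcomap : (sections F D).comap φ = v.asIdeal.toAddSubgroup := by
    ext a
    rw [AddSubgroup.mem_comap]
    change _ ↔ a ∈ v.asIdeal
    rw [← v.valuation_lt_one_iff_mem (K := F)]
    constructor
    · intro h
      have := h v
      rw [hφa, map_mul, hvy] at this
      by_contra h1
      have h2 := mul_le_mul_left (not_lt.mp h1) (exp (D v + 1))
      rw [one_mul] at h2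
      have := h2.trans this
      rw [exp_le_exp] at this
      omega
    · intro h w
      by_cases hw : w = v
      · subst hw
        rw [hφa, map_mul, hvy]
        rcases eq_or_ne (w.valuation F (algebraMap R F a)) 0 with h0 | h0
        · simp [h0]
        · rw [← exp_log h0, ← exp_zero, exp_lt_exp] at h
          rw [← exp_log h0, ← exp_add, exp_le_exp]
          omega
      · rw [← hne w hw]
        exact hφmem a w
  have hsup : sections F (D + Finsupp.single v 1) = φ.range ⊔ sections F D := by
    refine le_antisymm (fun x hx => ?_) (sup_le ?_ (sections_mono F ?_))
    · obtain ⟨a, ha⟩ := v.exists_valuation_sub_lt_of_integer (K := F) (x := x / y) (by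
        have := hx v
        rw [heq] at this
        rw [map_div₀, hvy]
        exact div_le_one_of_le₀ this (by simp)) 1
      rw [AddSubgroup.mem_sup]
      refine ⟨φ a, ⟨a, rfl⟩, x - φ a, fun w => ?_, by abel⟩
      by_cases hw : w = v
      · subst hw
        have h1 : x - φ a = -((algebraMap R F a - x / y) * y) := by
          rw [hφa]; field_simp; ring
        rw [h1, Valuation.map_neg, map_mul, hvy]
        rcases eq_or_ne (w.valuation F (algebraMap R F a - x / y)) 0 with h0 | h0
        · simp [h0]
        · rw [← exp_log h0, Units.val_one, ← exp_zero, exp_lt_exp] at ha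
          rw [← exp_log h0, ← exp_add, exp_le_exp]
          omega
      · rw [← hne w hw]
        exact sub_mem hx (hφmem a) w
    · rintro _ ⟨a, rfl⟩
      exact hφmem a
    · exact le_add_of_nonneg_right (Finsupp.single_nonneg.mpr zero_le_one)
  rw [hsup, AddSubgroup.relIndex_sup_right, AddMonoidHom.range_eq_map, ← AddSubgroup.relIndex_comap,
    hcomap, AddSubgroup.relIndex_top_right]
  rfl

end IsDedekindDomain.HeightOneSpectrum

open HeightOneSpectrum

/-- The curve data attached to a field which is the fraction field of two Dedekind domains. -/
noncomputable def CurveData.ofDedekind {F R R' : Type*} [Field F]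
    [CommRing R] [IsDedekindDomain R] [Algebra R F] [IsFractionRing R F]
    [CommRing R'] [IsDedekindDomain R'] [Algebra R' F] [IsFractionRing R' F]
    (q g : ℕ) (deg : HeightOneSpectrum R → ℕ) (deg' : HeightOneSpectrum R' → ℕ) (hq : 1 < q)
    (hdeg : ∀ v, Nat.card (R ⧸ v.asIdeal) = q ^ deg v) (hdeg0 : ∀ v, 0 < deg v)
    (hdegf : ∀ n, {v | deg v = n}.Finite)
    (hdeg' : ∀ v, Nat.card (R' ⧸ v.asIdeal) = q ^ deg' v) (hdeg0' : ∀ v, 0 < deg' v)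
    (hdegf' : ∀ n, {v | deg' v = n}.Finite)
    (hcard : Nat.card ((algebraMap R F).range.toAddSubgroup ⊓
      (algebraMap R' F).range.toAddSubgroup : AddSubgroup F) = q)
    (hindex : ((algebraMap R F).range.toAddSubgroup ⊔
      (algebraMap R' F).range.toAddSubgroup).index = q ^ g) :
    CurveData F (HeightOneSpectrum R ⊕ HeightOneSpectrum R') where
  q := q
  g := g
  deg := Sum.elim deg deg'
  I D := sections F (Finsupp.sumFinsuppEquivProdFinsupp D).1
  J D := sections F (Finsupp.sumFinsuppEquivProdFinsupp D).2
  dv x := Finsupp.sumElim (principal R x) (principal R' x)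
  one_lt_q := hq
  deg_pos := by rintro (v | v) <;> simp [hdeg0, hdeg0']
  finite_deg n := by
    refine (((hdegf n).image Sum.inl).union ((hdegf' n).image Sum.inr)).subset ?_
    rintro (v | v) hv
    · exact Or.inl ⟨v, hv, rfl⟩
    · exact Or.inr ⟨v, hv, rfl⟩
  monoI D E h := sections_mono F fun v => h (Sum.inl v)
  monoJ D E h := sections_mono F fun v => h (Sum.inr v)
  step := by
    rintro (v | v) D
    · left
      constructor
      · congr 1
        ext w
        simp
      · rw [Sum.elim_inl, ← hdeg, ← relIndex_sections F v]
        congr 2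
        ext w
        classical
        simp [Finsupp.single_apply]
    · right
      constructor
      · congr 1
        ext w
        simp
      · rw [Sum.elim_inr, ← hdeg', ← relIndex_sections F v]
        congr 2
        ext w
        classical
        simp [Finsupp.single_apply]
  mul_memI b hb D x := by
    rw [← mul_mem_sections hb (Finsupp.sumFinsuppEquivProdFinsupp D).1]
    congr! 2
    ext v
    simp
  mul_memJ b hb D x := by
    rw [← mul_mem_sections hb (Finsupp.sumFinsuppEquivProdFinsupp D).2]
    congr! 2
    ext v
    simp
  dv_mul a ha b hb := by
    rw [principal_mul ha hb, principal_mul ha hb]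
    ext (v | v) <;> simp
  mem_iff x hx D := by
    rw [AddSubgroup.mem_inf, mem_sections_iff hx, mem_sections_iff hx, Finsupp.le_def,
      Finsupp.le_def, Finsupp.le_def, Sum.forall]
    simp
  card_zero := by
    rw [← hcard]
    have h1 : sections (R := R) F 0 = (algebraMap R F).range.toAddSubgroup :=
      AddSubgroup.ext fun x => mem_sections_zero
    have h2 : sections (R := R') F 0 = (algebraMap R' F).range.toAddSubgroup :=
      AddSubgroup.ext fun x => mem_sections_zero
    rw [← h1, ← h2]
    rfl
  index_zero := by
    rw [← hindex]
    have h1 : sections (R := R) F 0 = (algebraMap R F).range.toAddSubgroup :=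
      AddSubgroup.ext fun x => mem_sections_zero
    have h2 : sections (R := R') F 0 = (algebraMap R' F).range.toAddSubgroup :=
      AddSubgroup.ext fun x => mem_sections_zero
    rw [← h1, ← h2]
    rfl

end

section

open IsDedekindDomain HeightOneSpectrum

theorem Polynomial.hasFiniteQuotients (K : Type*) [Field K] [Finite K] :
    Ring.HasFiniteQuotients (Polynomial K) where
  finiteQuotient {I} hI := by
    obtain ⟨p, hp, hp0⟩ := Submodule.exists_mem_ne_zero_of_ne_bot hI
    have hfin : Finite (Polynomial K ⧸ Ideal.span {p}) := by
      change Finite (AdjoinRoot p)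
      have := (AdjoinRoot.powerBasis hp0).finite
      exact Module.finite_of_finite K
    have hle : Ideal.span {p} ≤ I := (Ideal.span_singleton_le_iff_mem I).mpr hp
    exact Finite.of_surjective _ (Ideal.Quotient.factor_surjective hle)

namespace IsDedekindDomain.HeightOneSpectrum

variable (K : Type*) {R : Type*} [Field K] [CommRing R] [Algebra K R]

/-- The residue degree of a place over the finite constant field. -/
noncomputable def resDeg (v : HeightOneSpectrum R) : ℕ := Module.finrank K (R ⧸ v.asIdeal)

variable [Ring.HasFiniteQuotients R]

instance finite_quotient (v : HeightOneSpectrum R) : Finite (R ⧸ v.asIdeal) :=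
  Ring.HasFiniteQuotients.finiteQuotient v.ne_bot

theorem card_quotient (v : HeightOneSpectrum R) :
    Nat.card (R ⧸ v.asIdeal) = Nat.card K ^ v.resDeg K :=
  Module.natCard_eq_pow_finrank

theorem resDeg_pos (v : HeightOneSpectrum R) : 0 < v.resDeg K :=
  Module.finrank_pos

variable [Finite K] [IsDedekindDomain R]

theorem finite_resDeg (n : ℕ) : {v : HeightOneSpectrum R | v.resDeg K = n}.Finite := by
  refine (Ring.HasFiniteQuotients.finite_cardQuot_heightOneSpectrum_le (R := R)
    (Nat.card K ^ n)).subset fun v hv => ?_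
  change Submodule.cardQuot _ ≤ _
  rw [Submodule.cardQuot_apply, ← show v.resDeg K = n from hv, ← card_quotient]

theorem finite_resDeg_dvd {m : ℕ} (hm : m ≠ 0) :
    {v : HeightOneSpectrum R | v.resDeg K ∣ m}.Finite := by
  refine ((Set.finite_Iic m).biUnion fun n _ => finite_resDeg K (R := R) n).subset fun v hv => ?_
  exact Set.mem_biUnion (x := v.resDeg K) (Nat.le_of_dvd (Nat.pos_of_ne_zero hm) hv) rfl

theorem sum_resDeg_eq_card_algHom [Infinite R] (L : Type*) [Field L] [Finite L] [Algebra K L] :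
    ∑ᶠ v ∈ {v : HeightOneSpectrum R | v.resDeg K ∣ Module.finrank K L}, v.resDeg K =
      Nat.card (R →ₐ[K] L) := by
  classical
  have hm : Module.finrank K L ≠ 0 := Module.finrank_pos.ne'
  set S := {v : HeightOneSpectrum R | v.resDeg K ∣ Module.finrank K L} with hS
  have hSf : S.Finite := finite_resDeg_dvd K hm
  have := hSf.fintype
  let Φ : (Σ v : S, (R ⧸ v.1.asIdeal →ₐ[K] L)) → (R →ₐ[K] L) :=
    fun x => x.2.comp (Ideal.Quotient.mkₐ K x.1.1.asIdeal)
  have hfld (v : HeightOneSpectrum R) : Function.Injective fun φ : R ⧸ v.asIdeal →ₐ[K] L =>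
      φ.comp (Ideal.Quotient.mkₐ K v.asIdeal) := fun φ ψ h =>
    Ideal.Quotient.algHom_ext K h
  have hker (v : HeightOneSpectrum R) (φ : R ⧸ v.asIdeal →ₐ[K] L) :
      RingHom.ker (φ.comp (Ideal.Quotient.mkₐ K v.asIdeal)) = v.asIdeal := by
    ext a
    let _ := Ideal.Quotient.field v.asIdeal
    rw [RingHom.mem_ker, AlgHom.comp_apply, ← Ideal.Quotient.eq_zero_iff_mem]
    exact map_eq_zero_iff φ (RingHom.injective (φ : R ⧸ v.asIdeal →+* L))
  have hΦ : Function.Bijective Φ := by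
    constructor
    · rintro ⟨⟨v, hv⟩, φ⟩ ⟨⟨w, hw⟩, ψ⟩ h
      have hvw : v = w := by
        refine HeightOneSpectrum.ext ?_
        rw [← hker v φ, ← hker w ψ]
        exact congrArg _ h
      subst hvw
      exact congrArg (Sigma.mk _) (hfld v h)
    · intro φ
      have hbot : RingHom.ker φ ≠ ⊥ := fun h =>
        not_injective_infinite_finite φ ((RingHom.injective_iff_ker_eq_bot (φ : R →+* L)).mpr h)
      obtain ⟨v, hvφ⟩ : ∃ v : HeightOneSpectrum R, v.asIdeal = RingHom.ker φ :=
        ⟨⟨RingHom.ker φ, RingHom.ker_isPrime _, hbot⟩, rfl⟩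
      let ψ : R ⧸ v.asIdeal →ₐ[K] L := Ideal.Quotient.liftₐ _ φ fun a ha => by
        rwa [hvφ] at ha
      have hv : v ∈ S := by
        let _ := Ideal.Quotient.field v.asIdeal
        exact FiniteField.nonempty_algHom_iff_finrank_dvd.mp ⟨ψ⟩
      refine ⟨⟨⟨v, hv⟩, ψ⟩, ?_⟩
      ext a
      rfl
  rw [← Nat.card_congr (Equiv.ofBijective Φ hΦ), Nat.card_sigma, finsum_mem_eq_finite_toFinset_sum _ hSf,
    ← Finset.sum_coe_sort]
  refine Fintype.sum_equiv (Equiv.subtypeEquivRight fun v => by simp) _ _ fun v => ?_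
  let _ := Ideal.Quotient.field v.1.asIdeal
  have hv : v.1 ∈ S := by simpa using v.2
  exact (FiniteField.natCard_algHom_of_finrank_dvd hv).symm

end IsDedekindDomain.HeightOneSpectrum

/-- The curve data attached to two Dedekind domains with finite quotients and common fraction
field. -/
noncomputable def CurveData.ofCharts (K : Type*) {F R R' : Type*} [Field K] [Finite K] [Field F]
    [CommRing R] [IsDedekindDomain R] [Algebra R F] [IsFractionRing R F]
    [CommRing R'] [IsDedekindDomain R'] [Algebra R' F] [IsFractionRing R' F]
    [Algebra K R] [Algebra K R'] [Ring.HasFiniteQuotients R] [Ring.HasFiniteQuotients R'] (g : ℕ)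
    (hcard : Nat.card ((algebraMap R F).range.toAddSubgroup ⊓
      (algebraMap R' F).range.toAddSubgroup : AddSubgroup F) = Nat.card K)
    (hindex : ((algebraMap R F).range.toAddSubgroup ⊔
      (algebraMap R' F).range.toAddSubgroup).index = Nat.card K ^ g) :
    CurveData F (HeightOneSpectrum R ⊕ HeightOneSpectrum R') :=
  .ofDedekind (Nat.card K) g (resDeg K) (resDeg K) (Finite.one_lt_card) (card_quotient K)
    (resDeg_pos K) (finite_resDeg K) (card_quotient K) (resDeg_pos K) (finite_resDeg K) hcard hindex

end

section

open WithZero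

namespace RatFunc

variable (K : Type*) [Field K]

open Classical in
/-- The valuation at infinity of the rational function field, with classical decidability. -/
noncomputable def vInfty : Valuation (RatFunc K) (WithZero (Multiplicative ℤ)) := inftyValuation K

/-- The rational functions without pole at infinity. -/
noncomputable def inftyRing : Subalgebra K (RatFunc K) where
  carrier := {r | vInfty K r ≤ 1}
  mul_mem' ha hb := by
    rw [Set.mem_ofPred_eq, map_mul]
    exact mul_le_one' ha hb
  add_mem' ha hb := by
    rw [Set.mem_ofPred_eq]
    exact Valuation.map_add_le _ ha hb
  algebraMap_mem' a := by
    rw [algebraMap_eq_C, Set.mem_ofPred_eq]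
    rcases eq_or_ne a 0 with rfl | ha
    · simp
    · classical exact (inftyValuation.C K ha).le

variable {K}

theorem mem_inftyRing {r : RatFunc K} : r ∈ inftyRing K ↔ vInfty K r ≤ 1 := by
  change r ∈ {r | vInfty K r ≤ 1} ↔ _
  rw [Set.mem_ofPred_eq]

theorem vInfty_X_inv_pow (n : ℕ) : vInfty K (X⁻¹ ^ n) = exp (-n : ℤ) := by
  rw [inv_pow, map_inv₀, ← zpow_natCast, vInfty, inftyValuation.X_zpow, exp_neg]

theorem vInfty_polynomial {p : Polynomial K} (hp : p ≠ 0) :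
    vInfty K (algebraMap (Polynomial K) (RatFunc K) p) = exp (p.natDegree : ℤ) :=
  by classical exact inftyValuation.polynomial K hp

theorem vInfty_polynomial_le {p : Polynomial K} {n : ℕ} (hp : p.natDegree ≤ n) :
    vInfty K (algebraMap (Polynomial K) (RatFunc K) p) ≤ exp (n : ℤ) := by
  rcases eq_or_ne p 0 with rfl | h
  · simp
  · rw [vInfty_polynomial h, exp_le_exp]
    exact_mod_cast hp

theorem exists_polynomial_add (c : RatFunc K) :
    ∃ P : Polynomial K, vInfty K (c - algebraMap _ _ P) < 1 := by
  refine ⟨c.num / c.denom, ?_⟩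
  have hd : c.denom ≠ 0 := c.denom_ne_zero
  have hd' : algebraMap (Polynomial K) (RatFunc K) c.denom ≠ 0 := algebraMap_ne_zero hd
  have h1 : c - algebraMap _ _ (c.num / c.denom) =
      algebraMap _ _ (c.num % c.denom) / algebraMap _ _ c.denom := by
    rw [eq_div_iff hd', sub_mul, ← map_mul]
    nth_rw 1 [← num_div_denom c]
    rw [div_mul_cancel₀ _ hd', ← map_sub, EuclideanDomain.mod_eq_sub_mul_div, mul_comm c.denom]
  rw [h1]
  rcases eq_or_ne (c.num % c.denom) 0 with h0 | h0
  · simp [h0]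
  · rw [map_div₀, vInfty_polynomial h0, vInfty_polynomial hd, ← exp_sub, ← exp_zero, exp_lt_exp]
    have := Polynomial.natDegree_lt_natDegree h0
      (EuclideanDomain.mod_lt c.num hd : (c.num % c.denom).degree < c.denom.degree)
    omega

theorem exists_eq_C_of_vInfty_le {P : Polynomial K}
    (h : vInfty K (algebraMap (Polynomial K) (RatFunc K) P) ≤ 1) : ∃ a, P = Polynomial.C a := by
  rcases eq_or_ne P 0 with rfl | h0
  · exact ⟨0, by simp⟩
  · rw [vInfty_polynomial h0, ← exp_zero, exp_le_exp] at h
    exact ⟨_, Polynomial.eq_C_of_natDegree_le_zero (by omega)⟩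

theorem le_exp_neg_one_of_lt {x : WithZero (Multiplicative ℤ)} (h : x < 1) : x ≤ exp (-1 : ℤ) := by
  rcases eq_or_ne x 0 with rfl | h0
  · simp
  · rw [← exp_log h0, ← exp_zero, exp_lt_exp] at h
    rw [← exp_log h0, exp_le_exp]
    omega

theorem exists_C_add {c : RatFunc K} (hc : vInfty K c ≤ 1) :
    ∃ a : K, vInfty K (c - C a) ≤ exp (-1 : ℤ) := by
  obtain ⟨P, hP⟩ := exists_polynomial_add c
  obtain ⟨a, rfl⟩ := exists_eq_C_of_vInfty_le (P := P) (by
    have := Valuation.map_sub_le (vInfty K) hc hP.le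
    rwa [sub_sub_cancel] at this)
  refine ⟨a, le_exp_neg_one_of_lt ?_⟩
  rwa [← algebraMap_C]

theorem vInfty_mul_inv_le {x y : RatFunc K} (h : vInfty K x ≤ vInfty K y) :
    x * y⁻¹ ∈ inftyRing K := by
  rw [mem_inftyRing, map_mul, map_inv₀]
  exact mul_inv_le_one_of_le₀ h zero_le

instance : IsFractionRing (inftyRing K) (RatFunc K) := by
  refine IsFractionRing.of_field _ _ fun z => ?_
  rcases le_total (vInfty K z) 1 with h | h
  · exact ⟨⟨z, mem_inftyRing.mpr h⟩, 1, by simp [Subalgebra.algebraMap_eq]⟩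
  · refine ⟨1, ⟨z⁻¹, ?_⟩, ?_⟩
    · rw [mem_inftyRing, map_inv₀]
      exact inv_le_one_of_one_le₀ h
    · simp [Subalgebra.algebraMap_eq]

/-- The uniformizer `1/X` at infinity. -/
noncomputable def inftyUnif : inftyRing K := ⟨X⁻¹, by
  rw [mem_inftyRing, ← pow_one X⁻¹, vInfty_X_inv_pow, ← exp_zero, exp_le_exp]
  simp⟩

theorem exists_eq_mul_inftyUnif_pow {y : inftyRing K} {n : ℕ}
    (h : vInfty K y ≤ exp (-n : ℤ)) : ∃ z : inftyRing K, y = inftyUnif ^ n * z := by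
  rw [← vInfty_X_inv_pow (K := K)] at h
  refine ⟨⟨_, vInfty_mul_inv_le h⟩, Subtype.ext ?_⟩
  exact (inv_mul_cancel_right₀ (pow_ne_zero n (inv_ne_zero X_ne_zero)) _).symm.trans (mul_comm _ _)

instance : IsPrincipalIdealRing (inftyRing K) where
  principal I := by
    by_cases hI : I = ⊥
    · rw [hI]; exact bot_isPrincipal
    have hex : ∃ n : ℕ, ∃ x ∈ I, exp (-n : ℤ) ≤ vInfty K x := by
      obtain ⟨x, hx, hx0⟩ := Submodule.exists_mem_ne_zero_of_ne_bot hI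
      have hv : vInfty K x ≠ 0 := (Valuation.ne_zero_iff _).mpr (by simpa using hx0)
      refine ⟨(-log (vInfty K x)).toNat, x, hx, ?_⟩
      rw [← le_log_iff_exp_le hv]
      have := Int.self_le_toNat (-log (vInfty K x))
      omega
    classical
    obtain ⟨x, hx, hxn⟩ := Nat.find_spec hex
    refine ⟨x, le_antisymm (fun y hy => ?_) ((Ideal.span_singleton_le_iff_mem I).mpr hx)⟩
    rw [← Ideal.span, Ideal.mem_span_singleton]
    have hx0 : vInfty K x ≠ 0 := ne_of_gt (exp_pos.trans_le hxn)
    have hxy : vInfty K y ≤ vInfty K x := by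
      refine le_trans ?_ hxn
      by_contra hlt
      push Not at hlt
      have hy0 : vInfty K y ≠ 0 := ne_of_gt (exp_pos.trans hlt)
      rcases Nat.eq_zero_or_pos (Nat.find hex) with h0 | h0
      · rw [h0] at hlt
        have := y.2
        rw [mem_inftyRing] at this
        simp only [Nat.cast_zero, neg_zero, exp_zero] at hlt
        exact absurd hlt this.not_gt
      · refine Nat.find_min hex (Nat.sub_lt h0 one_pos) ⟨y, hy, ?_⟩
        rw [← lt_log_iff_exp_lt hy0] at hlt
        rw [← le_log_iff_exp_le hy0]
        omega
    refine ⟨⟨_, vInfty_mul_inv_le hxy⟩, Subtype.ext ?_⟩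
    change (y : RatFunc K) = x * (y * (x : RatFunc K)⁻¹)
    have : (x : RatFunc K) ≠ 0 := (Valuation.ne_zero_iff _).mp hx0
    field_simp

theorem exists_sum_add_inftyUnif_pow (n : ℕ) (y : inftyRing K) : ∃ (a : Fin n → K) (z : inftyRing K),
    y = ∑ i, algebraMap K _ (a i) * inftyUnif ^ (i : ℕ) + inftyUnif ^ n * z := by
  induction n with
  | zero => exact ⟨0, y, by simp⟩
  | succ n ih =>
    obtain ⟨a, z, hz⟩ := ih
    obtain ⟨b, hb⟩ := exists_C_add (c := (z : RatFunc K)) (mem_inftyRing.mp z.2)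
    obtain ⟨w, hw⟩ := exists_eq_mul_inftyUnif_pow (y := z - algebraMap K _ b) (n := 1) hb
    refine ⟨Fin.snoc a b, w, ?_⟩
    rw [sub_eq_iff_eq_add] at hw
    rw [Fin.sum_univ_castSucc]
    simp only [Fin.snoc_castSucc, Fin.snoc_last, Fin.val_castSucc, Fin.val_last]
    rw [hz, hw]
    ring

instance [Finite K] : Ring.HasFiniteQuotients (inftyRing K) where
  finiteQuotient {I} hI := by
    obtain ⟨x, hx, hx0⟩ := Submodule.exists_mem_ne_zero_of_ne_bot hI
    have hv : vInfty K x ≠ 0 := (Valuation.ne_zero_iff _).mpr (by simpa using hx0)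
    set n := (-log (vInfty K x)).toNat with hn
    have hmem : inftyUnif ^ n ∈ I := by
      have : vInfty K (X⁻¹ ^ n) ≤ vInfty K x := by
        rw [vInfty_X_inv_pow, ← le_log_iff_exp_le hv]
        have := Int.self_le_toNat (-log (vInfty K x))
        omega
      have h2 : inftyUnif ^ n = ⟨_, vInfty_mul_inv_le this⟩ * x := by
        refine Subtype.ext ?_
        change (X⁻¹ ^ n : RatFunc K) = X⁻¹ ^ n * (x : RatFunc K)⁻¹ * (x : RatFunc K)
        have : (x : RatFunc K) ≠ 0 := (Valuation.ne_zero_iff _).mp hv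
        field_simp
      rw [h2]
      exact I.mul_mem_left _ hx
    refine Finite.of_surjective (fun a : Fin n → K => Ideal.Quotient.mk I
      (∑ i, algebraMap K _ (a i) * inftyUnif ^ (i : ℕ))) fun y => ?_
    obtain ⟨y, rfl⟩ := Ideal.Quotient.mk_surjective y
    obtain ⟨a, z, rfl⟩ := exists_sum_add_inftyUnif_pow n y
    refine ⟨a, ?_⟩
    rw [Ideal.Quotient.eq]
    rw [sub_add_cancel_left]
    exact I.neg_mem (I.mul_mem_right _ hmem)

/-- Two algebra homomorphisms from the ring at infinity to a finite extension agree. -/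
theorem algHom_inftyRing_eq {L : Type*} [Field L] [Algebra K L] [Algebra.IsAlgebraic K L]
    (φ ψ : inftyRing K →ₐ[K] L) : φ = ψ := by
  have key (φ : inftyRing K →ₐ[K] L) : φ inftyUnif = 0 := by
    by_contra h
    obtain ⟨p, hp0, hp⟩ := Algebra.IsAlgebraic.isAlgebraic (R := K) (φ inftyUnif)
    obtain ⟨r, hr, hr0⟩ : ∃ r : Polynomial K, Polynomial.aeval (φ inftyUnif) r = 0 ∧
        r.coeff 0 ≠ 0 := by
      obtain ⟨r, hpr, hr⟩ := Polynomial.exists_eq_pow_rootMultiplicity_mul_and_not_dvd p hp0 0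
      refine ⟨r, ?_, fun h0 => hr ?_⟩
      · rw [hpr] at hp
        simpa [h] using hp
      · rw [Polynomial.C_0, sub_zero]
        exact Polynomial.X_dvd_iff.mpr h0
    rw [Polynomial.aeval_algHom_apply] at hr
    have hu : IsUnit (Polynomial.aeval (inftyUnif : inftyRing K) r) := by
      have hv : vInfty K (Polynomial.aeval (inftyUnif : inftyRing K) r : inftyRing K) = 1 := by
        rw [← Polynomial.divX_mul_X_add r]
        simp only [map_add, map_mul, Polynomial.aeval_X, Polynomial.aeval_C]
        have h1 : vInfty K (algebraMap K (RatFunc K) (r.coeff 0)) = 1 :=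
          by classical exact inftyValuation.C K hr0
        change vInfty K (((Polynomial.aeval (inftyUnif : inftyRing K) r.divX : inftyRing K) :
          RatFunc K) * X⁻¹ + algebraMap K (RatFunc K) (r.coeff 0)) = 1
        rw [Valuation.map_add_eq_of_lt_right, h1]
        rw [h1, map_mul]
        refine (mul_le_of_le_one_left' (mem_inftyRing.mp (Subtype.property (Polynomial.aeval
          (inftyUnif : inftyRing K) r.divX)))).trans_lt ?_
        rw [← pow_one X⁻¹, vInfty_X_inv_pow, ← exp_zero, exp_lt_exp]
        simp
      have hne : ((Polynomial.aeval (inftyUnif : inftyRing K) r : inftyRing K) : RatFunc K) ≠ 0 :=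
        (Valuation.ne_zero_iff (vInfty K)).mp (by rw [hv]; exact one_ne_zero)
      refine IsUnit.of_mul_eq_one ⟨_, (?_ : _ ∈ inftyRing K)⟩ (Subtype.ext (mul_inv_cancel₀ hne))
      rw [mem_inftyRing, map_inv₀, hv, inv_one]
    exact (hu.map φ).ne_zero hr
  ext y
  obtain ⟨a, z, hz⟩ := exists_sum_add_inftyUnif_pow 1 y
  simp [hz, key]

end RatFunc

end

section

open IsDedekindDomain HeightOneSpectrum

theorem integralClosure.module_finite (A k F : Type*) [CommRing A] [IsDomain A]
    [IsPrincipalIdealRing A] [Field k] [Algebra A k] [IsFractionRing A k] [Field F] [Algebra k F]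
    [Algebra A F] [IsScalarTower A k F] [FiniteDimensional k F] [Algebra.IsSeparable k F] :
    Module.Finite A (integralClosure A F) := by
  have : IsNoetherian A (integralClosure A F) := IsIntegralClosure.isNoetherian A k F _
  infer_instance

theorem integralClosure.algebraMap_injective (A k F : Type*) [CommRing A] [IsDomain A]
    [Field k] [Algebra A k] [IsFractionRing A k] [Field F] [Algebra k F]
    [Algebra A F] [IsScalarTower A k F] : Function.Injective (algebraMap A F) := by
  rw [IsScalarTower.algebraMap_eq A k F]
  exact (algebraMap k F).injective.comp (IsFractionRing.injective A k)

theorem integralClosure.infinite (A k F : Type*) [CommRing A] [IsDomain A] [Infinite A]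
    [Field k] [Algebra A k] [IsFractionRing A k] [Field F] [Algebra k F]
    [Algebra A F] [IsScalarTower A k F] : Infinite (integralClosure A F) :=
  .of_injective (algebraMap A _) fun _ _ h =>
    integralClosure.algebraMap_injective A k F (congrArg Subtype.val h)

theorem finsum_mem_sumElim_dvd {α β : Type*} (f : α → ℕ) (g : β → ℕ) {m : ℕ}
    (hf : {a | f a ∣ m}.Finite) (hg : {b | g b ∣ m}.Finite) :
    ∑ᶠ p ∈ {p | Sum.elim f g p ∣ m}, Sum.elim f g p =
      ∑ᶠ a ∈ {a | f a ∣ m}, f a + ∑ᶠ b ∈ {b | g b ∣ m}, g b := by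
  have h : {p | Sum.elim f g p ∣ m} = Sum.inl '' {a | f a ∣ m} ∪ Sum.inr '' {b | g b ∣ m} := by
    ext (a | b) <;> simp
  rw [h, finsum_mem_union (Set.disjoint_image_inl_image_inr) (hf.image _) (hg.image _),
    finsum_mem_image Sum.inl_injective.injOn, finsum_mem_image Sum.inr_injective.injOn]
  rfl

/-- At most `[F : k]` homomorphisms from the integral closure lie above a given one. -/
theorem integralClosure.card_algHom_le (A k F : Type*) [CommRing A] [IsDomain A]
    [IsPrincipalIdealRing A] [Field k] [Algebra A k] [IsFractionRing A k] [Field F] [Algebra k F]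
    [Algebra A F] [IsScalarTower A k F] [FiniteDimensional k F] [Algebra.IsSeparable k F]
    {K L : Type*} [Field K] [Field L] [Algebra K L]
    [Algebra K A] [Algebra K F] [IsScalarTower K A F] (ψ : A →ₐ[K] L) :
    Finite {φ : integralClosure A F →ₐ[K] L // ∀ a, φ (algebraMap A _ a) = ψ a} ∧
    Nat.card {φ : integralClosure A F →ₐ[K] L // ∀ a, φ (algebraMap A _ a) = ψ a} ≤
      Module.finrank k F := by
  have : Module.IsTorsionFree A F := by
    rw [Module.isTorsionFree_iff_faithfulSMul, faithfulSMul_iff_algebraMap_injective]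
    exact integralClosure.algebraMap_injective A k F
  have := integralClosure.module_finite A k F
  have : Module.Free A (integralClosure A F) := IsIntegralClosure.module_free A k F _
  rw [← IsIntegralClosure.rank A k F (integralClosure A F)]
  let _ : Algebra A L := ψ.toRingHom.toAlgebra
  let Φ (φ : {φ : integralClosure A F →ₐ[K] L // ∀ a, φ (algebraMap A _ a) = ψ a}) :
    integralClosure A F →ₐ[A] L := ⟨φ.1.toRingHom, φ.2⟩
  have hΦ : Function.Injective Φ := fun φ φ' h =>
    Subtype.ext (AlgHom.ext fun z => DFunLike.congr_fun h z)
  exact ⟨.of_injective Φ hΦ, (Nat.card_le_card_of_injective Φ hΦ).trans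
    (card_algHom_le_finrank A (integralClosure A F) L)⟩



section

universe u v

variable (K : Type u) [Field K] [Finite K]

instance RatFunc.infinite_inftyRing : Infinite (RatFunc.inftyRing K) := by
  refine Infinite.of_injective (fun n : ℕ => (RatFunc.inftyUnif : RatFunc.inftyRing K) ^ n)
    fun m n h => ?_
  have h1 := congrArg (fun z : RatFunc.inftyRing K => RatFunc.vInfty K z) h
  change RatFunc.vInfty K (RatFunc.X⁻¹ ^ m) = RatFunc.vInfty K (RatFunc.X⁻¹ ^ n) at h1
  rw [RatFunc.vInfty_X_inv_pow, RatFunc.vInfty_X_inv_pow, WithZero.exp_inj] at h1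
  omega

variable (F : Type v) [Field F] [Algebra (RatFunc K) F] [Algebra (Polynomial K) F]
  [Algebra K F] [IsScalarTower (Polynomial K) (RatFunc K) F] [IsScalarTower K (RatFunc K) F]
  [IsScalarTower K (Polynomial K) F]
  [FiniteDimensional (RatFunc K) F] [Algebra.IsSeparable (RatFunc K) F]

theorem CurveData.exists_of_cover (G : ℕ)
    (hconst : ∀ z : F, IsIntegral (Polynomial K) z → IsIntegral (RatFunc.inftyRing K) z →
      ∃ c : K, z = algebraMap K F c)
    {ι : Type*} [Fintype ι] (hι : Fintype.card ι ≤ G) (b : ι → F)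
    (hgen : ∀ z : F, ∃ u v : F, ∃ c : ι → K, IsIntegral (Polynomial K) u ∧
      IsIntegral (RatFunc.inftyRing K) v ∧ z = u + v + ∑ i, c i • b i) :
    ∃ (P : Type v) (C : CurveData F P), C.q = Nat.card K ∧ C.g ≤ G ∧
      ∀ (L : Type u) [Field L] [Finite L] [Algebra K L],
        ∃ n ≤ Module.finrank (RatFunc K) F, C.N (Module.finrank K L) =
          Nat.card (integralClosure (Polynomial K) F →ₐ[K] L) + n := by
  have hQ : IsIntegrallyClosed (Polynomial K) := inferInstance
  have := Polynomial.hasFiniteQuotients K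
  have := integralClosure.module_finite (Polynomial K) (RatFunc K) F
  have := integralClosure.module_finite (RatFunc.inftyRing K) (RatFunc K) F
  have := integralClosure.isDedekindDomain (Polynomial K) (RatFunc K) F
  have := integralClosure.isDedekindDomain (RatFunc.inftyRing K) (RatFunc K) F
  have : IsFractionRing (integralClosure (Polynomial K) F) F :=
    integralClosure.isFractionRing_of_finite_extension (RatFunc K) F
  have : IsFractionRing (integralClosure (RatFunc.inftyRing K) F) F :=
    integralClosure.isFractionRing_of_finite_extension (RatFunc K) F
  have := Ring.HasFiniteQuotients.of_module_finite (Polynomial K) (integralClosure (Polynomial K) F)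
  have := Ring.HasFiniteQuotients.of_module_finite (RatFunc.inftyRing K)
    (integralClosure (RatFunc.inftyRing K) F)
  let W : Submodule K F :=
    (integralClosure (Polynomial K) F).toSubmodule.restrictScalars K ⊔
      (integralClosure (RatFunc.inftyRing K) F).toSubmodule.restrictScalars K
  have hspan : Submodule.span K (Set.range fun i => W.mkQ (b i)) = ⊤ := by
    refine eq_top_iff.mpr fun z _ => ?_
    obtain ⟨z, rfl⟩ := W.mkQ_surjective z
    obtain ⟨u, v, c, hu, hv, rfl⟩ := hgen z
    have huv : W.mkQ (u + v) = 0 := (Submodule.Quotient.mk_eq_zero W).mpr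
      (Submodule.add_mem_sup (by exact hu) (by exact hv))
    rw [map_add, huv, zero_add, map_sum]
    refine Submodule.sum_mem _ fun i _ => ?_
    rw [map_smul]
    exact Submodule.smul_mem _ _ (Submodule.subset_span ⟨i, rfl⟩)
  classical
  have hfin : Module.Finite K (F ⧸ W) := ⟨⟨Finset.univ.image fun i => W.mkQ (b i), by
    simpa using hspan⟩⟩
  have hg : Module.finrank K (F ⧸ W) ≤ G := by
    refine le_trans ?_ hι
    rw [← finrank_top K, ← hspan]
    exact finrank_range_le_card _
  have hFO : (algebraMap (integralClosure (Polynomial K) F) F).range.toAddSubgroup =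
      ((integralClosure (Polynomial K) F).toSubmodule.restrictScalars K).toAddSubgroup := by
    ext z
    exact ⟨fun ⟨w, hw⟩ => hw ▸ w.2, fun h => ⟨⟨z, h⟩, rfl⟩⟩
  have hFO' : (algebraMap (integralClosure (RatFunc.inftyRing K) F) F).range.toAddSubgroup =
      ((integralClosure (RatFunc.inftyRing K) F).toSubmodule.restrictScalars K).toAddSubgroup := by
    ext z
    exact ⟨fun ⟨w, hw⟩ => hw ▸ w.2, fun h => ⟨⟨z, h⟩, rfl⟩⟩
  have hcard : Nat.card ((algebraMap (integralClosure (Polynomial K) F) F).range.toAddSubgroup ⊓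
      (algebraMap (integralClosure (RatFunc.inftyRing K) F) F).range.toAddSubgroup :
        AddSubgroup F) = Nat.card K := by
    rw [hFO, hFO']
    have hmem (c : K) : algebraMap K F c ∈
        ((integralClosure (Polynomial K) F).toSubmodule.restrictScalars K).toAddSubgroup ⊓
        ((integralClosure (RatFunc.inftyRing K) F).toSubmodule.restrictScalars K).toAddSubgroup := by
      refine ⟨?_, ?_⟩
      · change IsIntegral (Polynomial K) _
        rw [IsScalarTower.algebraMap_apply K (Polynomial K) F]
        exact isIntegral_algebraMap
      · change IsIntegral (RatFunc.inftyRing K) _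
        rw [IsScalarTower.algebraMap_apply K (RatFunc.inftyRing K) F]
        exact isIntegral_algebraMap
    refine (Nat.card_congr (Equiv.ofBijective (fun c : K => ⟨algebraMap K F c, hmem c⟩)
      ⟨fun c c' h => (algebraMap K F).injective (congrArg Subtype.val h), fun z => ?_⟩)).symm
    obtain ⟨c, hc⟩ := hconst z z.2.1 z.2.2
    exact ⟨c, Subtype.ext hc.symm⟩
  have hindex : ((algebraMap (integralClosure (Polynomial K) F) F).range.toAddSubgroup ⊔
      (algebraMap (integralClosure (RatFunc.inftyRing K) F) F).range.toAddSubgroup).index =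
        Nat.card K ^ Module.finrank K (F ⧸ W) := by
    rw [hFO, hFO', ← Submodule.sup_toAddSubgroup, ← Module.natCard_eq_pow_finrank]
    rfl
  have hinf1 := integralClosure.infinite (Polynomial K) (RatFunc K) F
  have hinf2 := integralClosure.infinite (RatFunc.inftyRing K) (RatFunc K) F
  refine ⟨_, CurveData.ofCharts K _ hcard hindex, rfl, hg, fun L _ _ _ =>
    ⟨Nat.card (integralClosure (RatFunc.inftyRing K) F →ₐ[K] L), ?_, ?_⟩⟩
  · rcases isEmpty_or_nonempty (integralClosure (RatFunc.inftyRing K) F →ₐ[K] L) with h | ⟨⟨φ₀⟩⟩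
    · simp
    · let ψ : RatFunc.inftyRing K →ₐ[K] L := φ₀.comp (IsScalarTower.toAlgHom K _ _)
      refine le_trans (Nat.card_congr (Equiv.subtypeUnivEquiv fun φ a => ?_)).symm.le
        (integralClosure.card_algHom_le (RatFunc.inftyRing K) (RatFunc K) F ψ).2
      exact DFunLike.congr_fun (RatFunc.algHom_inftyRing_eq
        (φ.comp (IsScalarTower.toAlgHom K (RatFunc.inftyRing K) _)) ψ) a
  · rw [← sum_resDeg_eq_card_algHom, ← sum_resDeg_eq_card_algHom]
    exact finsum_mem_sumElim_dvd _ _ (finite_resDeg_dvd K Module.finrank_pos.ne')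
      (finite_resDeg_dvd K Module.finrank_pos.ne')

end

end

section

open Polynomial

/-- `F = K(X)[y]` with `y` a root of the bivariate polynomial `f`, the affine equation of a plane
curve of degree `d`. -/
structure IsPlaneFunctionField {K F : Type*} [Field K] [Field F] [Algebra (RatFunc K) F]
    [Algebra K[X] F] (d : ℕ) (f : K[X][X]) (y : F) : Prop where
  good : Good d f
  root : aeval y f = 0
  dvd : ∀ h : K[X][X], aeval y h = 0 → f ∣ h
  minpoly_eq : minpoly (RatFunc K) y = f.map (algebraMap K[X] (RatFunc K))
  span : ∀ z : F, ∃ c : Fin d → RatFunc K, z = ∑ j, c j • y ^ (j : ℕ)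

theorem eval_scaleRoots_prod {R : Type*} [CommRing R] [IsDomain R] (s : Multiset R) (h c : R) :
    eval h ((s.map fun a => X - C a).prod.scaleRoots c) = (s.map fun a => h - c * a).prod := by
  induction s using Multiset.induction_on with
  | empty => simp
  | cons a s ih =>
    rw [Multiset.map_cons, Multiset.prod_cons, mul_scaleRoots_of_noZeroDivisors, eval_mul, ih,
      X_sub_C_scaleRoots, Multiset.map_cons, Multiset.prod_cons]
    simp [mul_comm a c]

namespace IsPlaneFunctionField

variable {K F : Type*} [Field K] [Field F] [Algebra (RatFunc K) F] [Algebra K[X] F]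
  [Algebra K F] [IsScalarTower K[X] (RatFunc K) F] [IsScalarTower K (RatFunc K) F]
  [IsScalarTower K K[X] F] {d : ℕ} {f : K[X][X]} {y : F}

theorem exists_aeval (H : IsPlaneFunctionField d f y) (z : F) :
    ∃ (h : K[X][X]) (s : K[X]), s ≠ 0 ∧ h.degree < d ∧
      algebraMap K[X] F s * z = aeval y h := by
  obtain ⟨c, hc⟩ := H.span z
  obtain ⟨s, hs⟩ := IsLocalization.exist_integer_multiples_of_finite (nonZeroDivisors K[X]) c
  choose g hg using hs
  refine ⟨∑ j : Fin d, C (g j) * X ^ (j : ℕ), s, nonZeroDivisors.ne_zero s.2, ?_, ?_⟩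
  · refine (degree_sum_le _ _).trans_lt ((Finset.sup_lt_iff (WithBot.bot_lt_coe d)).mpr
      fun j _ => (degree_C_mul_X_pow_le _ _).trans_lt ?_)
    exact WithBot.coe_lt_coe.mpr j.2
  · rw [hc, map_sum, Finset.mul_sum]
    refine Finset.sum_congr rfl fun j _ => ?_
    rw [map_mul, aeval_C, map_pow, aeval_X, IsScalarTower.algebraMap_apply K[X] (RatFunc K) F (g j),
      hg j, Algebra.smul_def, ← mul_assoc]
    congr 1
    change _ = algebraMap (RatFunc K) F ((s : K[X]) • c j)
    rw [Algebra.smul_def, map_mul, ← IsScalarTower.algebraMap_apply]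

theorem mem_range_of_isAlgebraic (H : IsPlaneFunctionField d f y)
    (hirr : Irreducible (f.map (mapRingHom (algebraMap K (AlgebraicClosure K))))) {z : F}
    {M : K[X]} (hM : M.Monic) (hz : aeval z M = 0) : ∃ c : K, z = algebraMap K F c := by
  obtain ⟨h, s, hs, hdeg, hsz⟩ := H.exists_aeval z
  set i := mapRingHom (algebraMap K (AlgebraicClosure K)) with hi
  have hdvd : f ∣ ((M.map (C.comp C)).scaleRoots (C s)).eval h := by
    refine H.dvd _ ?_
    have h1 := scaleRoots_eval₂_mul (p := M.map ((C : K[X] →+* K[X][X]).comp C))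
      (aeval y : K[X][X] →ₐ[K[X]] F).toRingHom z (C s)
    have h2 : eval₂ (aeval y : K[X][X] →ₐ[K[X]] F).toRingHom z
        (M.map ((C : K[X] →+* K[X][X]).comp C)) = 0 := by
      rw [eval₂_map, ← hz, aeval_def]
      congr 1
      ext c
      simp [IsScalarTower.algebraMap_apply K K[X] F]
    have h3 : (aeval y : K[X][X] →ₐ[K[X]] F).toRingHom (C s) * z =
        (aeval y : K[X][X] →ₐ[K[X]] F).toRingHom h := by
      refine Eq.trans ?_ hsz
      simp
    rw [h2, mul_zero, h3, eval₂_hom] at h1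
    exact h1
  have hdvd2 : f.map i ∣ ((M.map (algebraMap K (AlgebraicClosure K))).roots.map fun a =>
      h.map i - C (s.map (algebraMap K (AlgebraicClosure K))) * C (C a)).prod := by
    have h1 := map_dvd (mapRingHom i) hdvd
    rw [coe_mapRingHom, ← coe_mapRingHom i, ← eval₂_hom, ← eval_map, map_scaleRoots _ _ _ (by
      rw [(hM.map _).leadingCoeff]; simp)] at h1
    have h2 : (M.map ((C : K[X] →+* K[X][X]).comp C)).map (mapRingHom i) =
        (((M.map (algebraMap K (AlgebraicClosure K))).roots.map fun a => C (C a)).map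
          fun a => X - C a).prod := by
      have h3 := (IsAlgClosed.splits (M.map (algebraMap K (AlgebraicClosure K)))).eq_prod_roots_of_monic
        (hM.map _)
      have h4 := congrArg (Polynomial.map ((C : (AlgebraicClosure K)[X] →+* _).comp C)) h3
      rw [Polynomial.map_multiset_prod, Multiset.map_map] at h4
      rw [Multiset.map_map]
      convert h4 using 1
      · rw [map_map, map_map]
        congr 1
        ext c
        simp [hi]
      · simp
    rw [h2, eval_scaleRoots_prod, Multiset.map_map] at h1
    simpa [hi] using h1
  obtain ⟨a, -, hdvd3⟩ := hirr.prime.exists_mem_multiset_map_dvd hdvd2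
  have hd : 0 < d := by
    simpa using (H.good.map (algebraMap K (AlgebraicClosure K))).pos hirr
  have h0 := eq_zero_of_dvd_of_degree_lt hdvd3 (by
    rw [H.good.monic.degree_map, degree_eq_natDegree H.good.monic.ne_zero, H.good.natDegree]
    refine (degree_sub_le _ _).trans_lt (max_lt (degree_map_le.trans_lt hdeg) ?_)
    rw [← C_mul]
    exact degree_C_le.trans_lt (by exact_mod_cast hd))
  rw [sub_eq_zero, ← C_mul] at h0
  have hinj : Function.Injective (algebraMap K (AlgebraicClosure K)) :=
    (algebraMap K (AlgebraicClosure K)).injective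
  have h1 := congrArg (fun p => (p.coeff 0).coeff s.natDegree) h0
  simp only [coeff_C_zero, coeff_mul_C, coeff_map, hi, coe_mapRingHom] at h1
  have hls : s.coeff s.natDegree ≠ 0 := by rwa [coeff_natDegree, leadingCoeff_ne_zero]
  have ha : a = algebraMap K (AlgebraicClosure K)
      ((h.coeff 0).coeff s.natDegree / s.coeff s.natDegree) := by
    rw [map_div₀, h1, mul_div_cancel_left₀ _ ((_root_.map_ne_zero _).mpr hls)]
  set c := (h.coeff 0).coeff s.natDegree / s.coeff s.natDegree
  refine ⟨c, ?_⟩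
  have h2 : h = C (s * C c) := by
    refine map_injective i (map_injective _ hinj) ?_
    rw [h0, ha]
    simp [hi]
  have hinj2 : Function.Injective (algebraMap K[X] F) :=
    integralClosure.algebraMap_injective K[X] (RatFunc K) F
  refine mul_left_cancel₀ ((map_ne_zero_iff _ hinj2).mpr hs) ?_
  rw [hsz, h2, aeval_C, map_mul, IsScalarTower.algebraMap_apply K K[X] F]
  rfl

theorem mem_range_of_isIntegral (H : IsPlaneFunctionField d f y)
    (hirr : Irreducible (f.map (mapRingHom (algebraMap K (AlgebraicClosure K))))) {z : F}
    (hz : IsIntegral K[X] z) (hz' : IsIntegral (RatFunc.inftyRing K) z) :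
    ∃ c : K, z = algebraMap K F c := by
  have e1 := minpoly.isIntegrallyClosed_eq_field_fractions' (RatFunc K) hz
  have e2 := minpoly.isIntegrallyClosed_eq_field_fractions' (RatFunc K) hz'
  have hlift : minpoly (RatFunc K) z ∈ lifts (algebraMap K (RatFunc K)) := by
    rw [lifts_iff_coeff_lifts]
    intro n
    have h1 : (minpoly (RatFunc K) z).coeff n =
      algebraMap K[X] (RatFunc K) ((minpoly K[X] z).coeff n) := by rw [e1, coeff_map]
    have h2 : (minpoly (RatFunc K) z).coeff n =
      algebraMap (RatFunc.inftyRing K) (RatFunc K) ((minpoly (RatFunc.inftyRing K) z).coeff n) := by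
      rw [e2, coeff_map]
    obtain ⟨a, ha⟩ := RatFunc.exists_eq_C_of_vInfty_le (P := (minpoly K[X] z).coeff n) (by
      rw [← h1, h2]
      exact RatFunc.mem_inftyRing.mp (Subtype.property _))
    exact ⟨a, by rw [h1, ha]; rfl⟩
  have hint : IsIntegral (RatFunc K) z := hz.tower_top
  obtain ⟨M, hM, -, hMm⟩ := lifts_and_natDegree_eq_and_monic hlift (minpoly.monic hint)
  refine H.mem_range_of_isAlgebraic hirr hMm ?_
  rw [← aeval_map_algebraMap (RatFunc K), hM, minpoly.aeval]

theorem isIntegral_root (H : IsPlaneFunctionField d f y) : IsIntegral K[X] y :=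
  ⟨f, H.good.monic, H.root⟩

theorem isIntegral_X_inv_smul_root (H : IsPlaneFunctionField d f y) :
    IsIntegral (RatFunc.inftyRing K) ((RatFunc.X⁻¹ : RatFunc K) • y) := by
  set f' := f.map (algebraMap K[X] (RatFunc K)) with hf'
  have hf'm : f'.Monic := H.good.monic.map _
  have hf'd : f'.natDegree = d := by rw [hf', H.good.monic.natDegree_map, H.good.natDegree]
  have hlift : f'.scaleRoots RatFunc.X⁻¹ ∈ lifts (algebraMap (RatFunc.inftyRing K) (RatFunc K)) := by
    rw [lifts_iff_coeff_lifts]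
    intro n
    suffices h : RatFunc.vInfty K ((f'.scaleRoots RatFunc.X⁻¹).coeff n) ≤ 1 from
      ⟨⟨_, RatFunc.mem_inftyRing.mpr h⟩, rfl⟩
    rw [coeff_scaleRoots, hf'd, hf', coeff_map, map_mul, RatFunc.vInfty_X_inv_pow]
    refine (mul_le_mul_left (RatFunc.vInfty_polynomial_le (H.good.tDeg.natDegree_coeff_le n)) _).trans ?_
    rw [← WithZero.exp_add, ← WithZero.exp_zero, WithZero.exp_le_exp]
    omega
  obtain ⟨M, hM, -, hMm⟩ := lifts_and_natDegree_eq_and_monic hlift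
    ((monic_scaleRoots_iff _).mpr hf'm)
  refine ⟨M, hMm, ?_⟩
  change aeval _ M = 0
  rw [← aeval_map_algebraMap (RatFunc K), hM, Algebra.smul_def]
  refine scaleRoots_aeval_eq_zero ?_
  rw [hf', aeval_map_algebraMap, H.root]

theorem exists_eq_add_add_sum (H : IsPlaneFunctionField d f y) (z : F) :
    ∃ u v : F, ∃ c : (Σ j : Fin d, Fin ((j : ℕ) - 1)) → K, IsIntegral K[X] u ∧
      IsIntegral (RatFunc.inftyRing K) v ∧ z = u + v + ∑ i, c i •
        ((RatFunc.X ^ (i.2 : ℕ) * RatFunc.X⁻¹ ^ ((i.1 : ℕ) - 1) : RatFunc K) • y ^ (i.1 : ℕ)) := by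
  have hint {a : RatFunc K} (ha : RatFunc.vInfty K a ≤ 1) :
      IsIntegral (RatFunc.inftyRing K) (algebraMap (RatFunc K) F a) :=
    isIntegral_algebraMap (R := RatFunc.inftyRing K) (A := F)
      (x := ⟨a, RatFunc.mem_inftyRing.mpr ha⟩)
  have key (j : Fin d) (a : RatFunc K) : ∃ u v : F, ∃ c : Fin ((j : ℕ) - 1) → K,
      IsIntegral K[X] u ∧ IsIntegral (RatFunc.inftyRing K) v ∧ a • y ^ (j : ℕ) = u + v + ∑ i, c i •
        ((RatFunc.X ^ (i : ℕ) * RatFunc.X⁻¹ ^ ((j : ℕ) - 1) : RatFunc K) • y ^ (j : ℕ)) := by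
    set n := (j : ℕ) - 1 with hn
    have hX : (RatFunc.X : RatFunc K) ^ n ≠ 0 := pow_ne_zero _ RatFunc.X_ne_zero
    obtain ⟨P, hP⟩ := RatFunc.exists_polynomial_add (RatFunc.X ^ n * a)
    set ε := RatFunc.X ^ n * a - algebraMap K[X] (RatFunc K) P with hε
    have hXn : ((X : K[X]) ^ n).Monic := monic_X_pow n
    have ha : a = algebraMap K[X] (RatFunc K) (P /ₘ X ^ n) + RatFunc.X⁻¹ ^ n * ε +
        RatFunc.X⁻¹ ^ n * algebraMap K[X] (RatFunc K) (P %ₘ X ^ n) := by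
      have h1 := congrArg (algebraMap K[X] (RatFunc K)) (modByMonic_add_div P (X ^ n))
      rw [map_add, map_mul, map_pow, RatFunc.algebraMap_X] at h1
      rw [hε, ← h1, inv_pow]
      field_simp
      ring
    have hmod : algebraMap K[X] (RatFunc K) (P %ₘ X ^ n) =
        ∑ i : Fin n, algebraMap K (RatFunc K) ((P %ₘ X ^ n).coeff i) * RatFunc.X ^ (i : ℕ) := by
      conv_lhs => rw [← sum_modByMonic_coeff hXn (n := n) (by simp)]
      rw [map_sum]
      refine Finset.sum_congr rfl fun i _ => ?_
      rw [← C_mul_X_pow_eq_monomial, map_mul, map_pow, RatFunc.algebraMap_X, RatFunc.algebraMap_C,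
        RatFunc.algebraMap_eq_C]
    refine ⟨algebraMap K[X] F (P /ₘ X ^ n) * y ^ (j : ℕ), (RatFunc.X⁻¹ ^ n * ε) • y ^ (j : ℕ),
      fun i => (P %ₘ X ^ n).coeff i, isIntegral_algebraMap.mul (H.isIntegral_root.pow _), ?_, ?_⟩
    · rcases Nat.eq_zero_or_pos (j : ℕ) with h0 | h0
      · have hn0 : n = 0 := by omega
        rw [h0, hn0, pow_zero, one_mul, pow_zero, ← Algebra.algebraMap_eq_smul_one]
        exact hint hP.le
      · have h1 : (RatFunc.X⁻¹ ^ n * ε) • y ^ (j : ℕ) = algebraMap (RatFunc K) F (RatFunc.X * ε) *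
            ((RatFunc.X⁻¹ : RatFunc K) • y) ^ (j : ℕ) := by
          rw [_root_.smul_pow, mul_smul_comm, Algebra.smul_def, Algebra.smul_def, ← mul_assoc,
            ← map_mul]
          congr 2
          rw [show (j : ℕ) = n + 1 by omega, pow_succ]
          field_simp [RatFunc.X_ne_zero]
        rw [h1]
        refine IsIntegral.mul ?_ (H.isIntegral_X_inv_smul_root.pow _)
        refine hint ?_
        rw [map_mul]
        refine (mul_le_mul_right (RatFunc.le_exp_neg_one_of_lt hP) _).trans ?_
        rw [← RatFunc.algebraMap_X, RatFunc.vInfty_polynomial X_ne_zero, natDegree_X,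
          ← WithZero.exp_add]
        simp
    · conv_lhs => rw [ha]
      rw [add_smul, add_smul, hmod, Finset.mul_sum, Finset.sum_smul]
      congr 1
      · congr 1
        rw [Algebra.smul_def, ← IsScalarTower.algebraMap_apply]
      · refine Finset.sum_congr rfl fun i _ => ?_
        rw [← IsScalarTower.algebraMap_smul (RatFunc K) ((P %ₘ X ^ n).coeff i), smul_smul]
        congr 1
        ring
  obtain ⟨a, ha⟩ := H.span z
  choose u v c hu hv h using fun j => key j (a j)
  refine ⟨∑ j, u j, ∑ j, v j, fun i => c i.1 i.2, IsIntegral.sum _ fun j _ => hu j,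
    IsIntegral.sum _ fun j _ => hv j, ?_⟩
  rw [ha, Fintype.sum_sigma, ← Finset.sum_add_distrib, ← Finset.sum_add_distrib]
  exact Finset.sum_congr rfl fun j _ => h j

end IsPlaneFunctionField

theorem two_mul_card_sigma (d : ℕ) :
    2 * (Fintype.card (Σ j : Fin (d + 1), Fin ((j : ℕ) - 1)) : ℤ) = (d : ℤ) * (d - 1) := by
  rw [Fintype.card_sigma]
  simp only [Fintype.card_fin]
  rw [Fin.sum_univ_eq_sum_range (fun j => j - 1) (d + 1)]
  induction d with
  | zero => simp
  | succ d ih =>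
    rw [Finset.sum_range_succ, Nat.cast_add, mul_add, ih]
    push_cast
    simp
    ring

end

section

open Polynomial

namespace IsPlaneFunctionField

variable {K F : Type*} [Field K] [Field F] [Algebra (RatFunc K) F] [Algebra K[X] F]
  [Algebra K F] [IsScalarTower K[X] (RatFunc K) F] [IsScalarTower K (RatFunc K) F]
  [IsScalarTower K K[X] F] [FiniteDimensional (RatFunc K) F] [Algebra.IsSeparable (RatFunc K) F]
  {d : ℕ} {f : K[X][X]} {y : F}

theorem adjoin_eq_top (H : IsPlaneFunctionField d f y) : Algebra.adjoin (RatFunc K) {y} = ⊤ := by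
  rw [eq_top_iff]
  intro z _
  obtain ⟨c, rfl⟩ := H.span z
  exact sum_mem fun j _ => Subalgebra.smul_mem _
    (pow_mem (Algebra.subset_adjoin (Set.mem_singleton y)) _) _

theorem aeval_derivative_minpoly (H : IsPlaneFunctionField d f y) :
    aeval y (derivative (minpoly (RatFunc K) y)) = aeval y (derivative f) := by
  rw [H.minpoly_eq, derivative_map, aeval_map_algebraMap]

theorem aeval_derivative_ne_zero (H : IsPlaneFunctionField d f y) :
    aeval y (derivative f) ≠ 0 := by
  rw [← H.aeval_derivative_minpoly]
  exact (Algebra.IsSeparable.isSeparable (RatFunc K) y).aeval_derivative_ne_zero (minpoly.aeval _ _)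

open Pointwise in
theorem exists_aeval_derivative_mul (H : IsPlaneFunctionField d f y) {z : F}
    (hz : IsIntegral K[X] z) : ∃ h : K[X][X], aeval y (derivative f) * z = aeval y h := by
  have h1 := traceForm_dualSubmodule_adjoin K[X] (RatFunc K) H.adjoin_eq_top H.isIntegral_root
  have h2 : z ∈ (Algebra.traceForm (RatFunc K) F).dualSubmodule
      (Subalgebra.toSubmodule (Algebra.adjoin K[X] {y})) := by
    rw [LinearMap.BilinForm.mem_dualSubmodule]
    intro b hb
    have hb' : IsIntegral K[X] b := by
      have : Algebra.adjoin K[X] {y} ≤ integralClosure K[X] F :=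
        Algebra.adjoin_le (Set.singleton_subset_iff.mpr H.isIntegral_root)
      exact this hb
    rw [Algebra.traceForm_apply, Submodule.mem_one]
    obtain ⟨a, ha⟩ := IsIntegrallyClosed.isIntegral_iff.mp
      (Algebra.isIntegral_trace (L := RatFunc K) (F := F) (hz.mul hb'))
    exact ⟨a, ha⟩
  rw [h1, H.aeval_derivative_minpoly] at h2
  obtain ⟨u, hu, rfl⟩ := Submodule.mem_smul_pointwise_iff_exists _ _ _ |>.mp h2
  rw [Subalgebra.mem_toSubmodule, Algebra.adjoin_singleton_eq_range_aeval] at hu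
  obtain ⟨h, rfl⟩ := hu
  exact ⟨h, by rw [smul_eq_mul, mul_inv_cancel_left₀ H.aeval_derivative_ne_zero]; rfl⟩

variable {L : Type*} [Field L] [Algebra K L]

/-- The generator, as an element of the ring of integers. -/
noncomputable def intRoot (H : IsPlaneFunctionField d f y) : integralClosure K[X] F := ⟨y, H.isIntegral_root⟩

/-- The ring of integers maps to the points of the affine plane curve. -/
noncomputable def pointOfHom (H : IsPlaneFunctionField d f y) (φ : integralClosure K[X] F →ₐ[K] L) : L × L :=
  (φ (algebraMap K[X] _ X), φ H.intRoot)

theorem aevalAeval_pointOfHom (H : IsPlaneFunctionField d f y)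
    (φ : integralClosure K[X] F →ₐ[K] L) (h : K[X][X]) :
    aevalAeval (H.pointOfHom φ).1 (H.pointOfHom φ).2 h = φ (aeval H.intRoot h) := by
  have h1 : aevalAeval (H.pointOfHom φ).1 (H.pointOfHom φ).2 =
      φ.comp ((aeval H.intRoot : K[X][X] →ₐ[K[X]] _).restrictScalars K) := by
    apply (aevalAevalEquiv K L).symm.injective
    ext <;> simp [pointOfHom]
  rw [h1]
  rfl

theorem coe_aeval_intRoot (H : IsPlaneFunctionField d f y) (h : K[X][X]) :
    ((aeval H.intRoot h : integralClosure K[X] F) : F) = aeval y h := by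
  have := aeval_algebraMap_apply F H.intRoot h
  exact this.symm

theorem aeval_intRoot_eq (H : IsPlaneFunctionField d f y) {h : K[X][X]}
    {z : integralClosure K[X] F} (hz : (z : F) = aeval y h) : z = aeval H.intRoot h :=
  Subtype.ext (hz.trans (H.coe_aeval_intRoot h).symm)

theorem aevalAeval_pointOfHom_self (H : IsPlaneFunctionField d f y)
    (φ : integralClosure K[X] F →ₐ[K] L) :
    aevalAeval (H.pointOfHom φ).1 (H.pointOfHom φ).2 f = 0 := by
  rw [H.aevalAeval_pointOfHom, ← H.aeval_intRoot_eq (z := 0) (by simp [H.root]), map_zero]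

theorem pointOfHom_injOn (H : IsPlaneFunctionField d f y) :
    Set.InjOn (H.pointOfHom (L := L))
      {φ | aevalAeval (H.pointOfHom φ).1 (H.pointOfHom φ).2 (derivative f) ≠ 0} := by
  intro φ hφ ψ hψ h
  rw [Set.mem_ofPred_eq] at hφ
  ext z
  obtain ⟨g, hg⟩ := H.exists_aeval_derivative_mul z.2
  have h1 : aeval H.intRoot (derivative f) * z = aeval H.intRoot g := by
    refine H.aeval_intRoot_eq ?_
    rw [← hg, ← H.coe_aeval_intRoot]
    rfl
  refine mul_left_cancel₀ hφ ?_
  conv_rhs => rw [h]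
  rw [H.aevalAeval_pointOfHom, H.aevalAeval_pointOfHom, ← map_mul, ← map_mul, h1,
    ← H.aevalAeval_pointOfHom, ← H.aevalAeval_pointOfHom, h]

theorem exists_pointOfHom_eq (H : IsPlaneFunctionField d f y) {P : L × L}
    (h0 : aevalAeval P.1 P.2 f = 0) (h1 : aevalAeval P.1 P.2 (derivative f) ≠ 0) :
    ∃ φ, H.pointOfHom φ = P := by
  have hwd : ∀ g h : K[X][X], aeval y g = aeval y h → aevalAeval P.1 P.2 g = aevalAeval P.1 P.2 h := by
    intro g h hgh
    obtain ⟨u, hu⟩ := H.dvd (g - h) (by rw [map_sub, hgh, sub_self])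
    rw [← sub_eq_zero, ← map_sub, hu, map_mul, h0, zero_mul]
  choose t ht using fun z : integralClosure K[X] F => H.exists_aeval_derivative_mul z.2
  set D := aevalAeval P.1 P.2 (derivative f) with hD
  have hev : ∀ (z : integralClosure K[X] F) (g : K[X][X]), (z : F) = aeval y g →
      aevalAeval P.1 P.2 (t z) / D = aevalAeval P.1 P.2 g := by
    intro z g hz
    rw [div_eq_iff h1, hD, ← map_mul]
    refine hwd _ _ ?_
    rw [← ht, hz, map_mul, mul_comm]
  let φ : integralClosure K[X] F →ₐ[K] L := AlgHom.ofLinearMap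
    { toFun := fun z => aevalAeval P.1 P.2 (t z) / D
      map_add' := fun a b => by
        rw [← add_div, ← map_add]
        congr 1
        refine hwd _ _ ?_
        rw [← ht, map_add, ← ht, ← ht, ← mul_add]
        rfl
      map_smul' := fun c a => by
        rw [RingHom.id_apply, ← smul_div_assoc, ← map_smul]
        congr 1
        refine hwd _ _ ?_
        have : (aeval y) (c • t a) = c • aeval y (t a) :=
          map_smul ((aeval y : K[X][X] →ₐ[K[X]] F).restrictScalars K) c (t a)
        rw [this, ← ht, ← ht, ← mul_smul_comm]
        rfl }
    (by
      change aevalAeval P.1 P.2 (t 1) / D = 1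
      rw [hev 1 1 (by simp), map_one])
    (fun a b => by
      change aevalAeval P.1 P.2 (t (a * b)) / D =
        aevalAeval P.1 P.2 (t a) / D * (aevalAeval P.1 P.2 (t b) / D)
      have h2 := hwd (t (a * b) * derivative f) (t a * t b) (by
        rw [map_mul, map_mul, ← ht, ← ht, ← ht, MulMemClass.coe_mul]
        ring)
      rw [map_mul, map_mul, ← hD] at h2
      rw [div_mul_div_comm, ← h2, mul_div_mul_right _ _ h1])
  refine ⟨φ, Prod.ext ?_ ?_⟩
  · change aevalAeval P.1 P.2 (t _) / D = _
    rw [hev _ (C X) (by rw [aeval_C]; rfl), aevalAeval_X]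
  · change aevalAeval P.1 P.2 (t _) / D = _
    rw [hev _ X (by rw [aeval_X]; rfl), aevalAeval_Y]

end IsPlaneFunctionField

end

section

open Polynomial

theorem evalEval_map_mapRingHom {R S : Type*} [CommRing R] [CommRing S] [Algebra R S]
    {L : Type*} [CommRing L] [Algebra R L] (ι : L →ₐ[R] S) (h : R[X][X]) (a b : L) :
    (h.map (mapRingHom (algebraMap R S))).evalEval (ι a) (ι b) = ι (aevalAeval a b h) := by
  have h1 : (evalEvalRingHom (ι a) (ι b)).comp (mapRingHom (mapRingHom (algebraMap R S))) =
      (ι : L →+* S).comp (aevalAeval a b : R[X][X] →ₐ[R] L).toRingHom := by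
    ext <;> simp
  exact DFunLike.congr_fun h1 h

namespace IsPlaneFunctionField

variable {K F : Type*} [Field K] [Field F] [Algebra (RatFunc K) F] [Algebra K[X] F]
  [Algebra K F] [IsScalarTower K[X] (RatFunc K) F] [IsScalarTower K (RatFunc K) F]
  [IsScalarTower K K[X] F] [FiniteDimensional (RatFunc K) F] [Algebra.IsSeparable (RatFunc K) F]
  {d : ℕ} {f : K[X][X]} {y : F}

theorem finrank_eq (H : IsPlaneFunctionField d f y) : Module.finrank (RatFunc K) F = d := by
  have h1 : IntermediateField.adjoin (RatFunc K) {y} = ⊤ := by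
    rw [eq_top_iff]
    intro z _
    exact IntermediateField.algebra_adjoin_le_adjoin _ _ (H.adjoin_eq_top ▸ Algebra.mem_top)
  rw [← (Field.primitive_element_iff_minpoly_natDegree_eq _ _).mp h1, H.minpoly_eq,
    H.good.monic.natDegree_map, H.good.natDegree]

variable {L : Type*} [Field L] [Algebra K L] [Finite L]

theorem finite_fiber (a : L) :
    {φ : integralClosure K[X] F →ₐ[K] L | φ (algebraMap K[X] _ X) = a}.Finite ∧
    {φ : integralClosure K[X] F →ₐ[K] L | φ (algebraMap K[X] _ X) = a}.ncard ≤
      Module.finrank (RatFunc K) F := by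
  have h := integralClosure.card_algHom_le K[X] (RatFunc K) F (aeval a : K[X] →ₐ[K] L)
  have h1 : {φ : integralClosure K[X] F →ₐ[K] L | φ (algebraMap K[X] _ X) = a} =
      {φ | ∀ p, φ (algebraMap K[X] _ p) = aeval a p} := by
    ext φ
    rw [Set.mem_ofPred_eq, Set.mem_ofPred_eq]
    refine ⟨fun hφ => ?_, fun hφ => by simpa using hφ X⟩
    refine DFunLike.congr_fun (f := φ.comp (IsScalarTower.toAlgHom K K[X] _)) ?_
    ext
    simpa using hφ
  rw [h1]
  exact ⟨h.1, h.2⟩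

theorem finite_algHom : Finite (integralClosure K[X] F →ₐ[K] L) := by
  refine Set.finite_univ_iff.mp ((Set.finite_iUnion fun a : L => (finite_fiber a).1).subset
    fun φ _ => ?_)
  exact Set.mem_iUnion.mpr ⟨_, rfl⟩

theorem ncard_singular_le (H : IsPlaneFunctionField d f y) (ι : L →ₐ[K] AlgebraicClosure K)
    (hirr : Irreducible (f.map (mapRingHom (algebraMap K (AlgebraicClosure K))))) :
    {P : L × L | aevalAeval P.1 P.2 f = 0 ∧ aevalAeval P.1 P.2 (derivative f) = 0}.ncard ≤
      d * (d - 1) := by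
  classical
  have hg := H.good.map (algebraMap K (AlgebraicClosure K))
  have hinj := ι.toRingHom.injective
  have h0 : derivative f ≠ 0 := fun h => H.aeval_derivative_ne_zero (by rw [h, map_zero])
  have hndvd : ¬ f.map (mapRingHom (algebraMap K (AlgebraicClosure K))) ∣
      derivative (f.map (mapRingHom (algebraMap K (AlgebraicClosure K)))) := by
    intro hdvd
    have h1 := natDegree_le_of_dvd hdvd (by
      rw [derivative_map, Ne, Polynomial.map_eq_zero_iff]
      · exact h0
      · exact map_injective _ (algebraMap K (AlgebraicClosure K)).injective)
    have h2 := natDegree_derivative_le (f.map (mapRingHom (algebraMap K (AlgebraicClosure K))))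
    have := hg.pos hirr
    rw [hg.natDegree] at h1 h2
    omega
  rw [Set.ncard_eq_toFinset_card _ (Set.toFinite _)]
  rw [← Finset.card_map ⟨Prod.map ι ι, hinj.prodMap hinj⟩]
  refine bezout_card hg hirr hg.tDeg.derivative hndvd _ ?_ ?_
  all_goals
    intro P hP
    obtain ⟨Q, hQ, rfl⟩ := Finset.mem_map.mp hP
    rw [Set.Finite.mem_toFinset] at hQ
    simp only [Function.Embedding.coeFn_mk, Prod.map_fst, Prod.map_snd]
    try rw [derivative_map]
    rw [evalEval_map_mapRingHom]
  · rw [hQ.1, map_zero]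
  · rw [hQ.2, map_zero]

theorem card_algHom (H : IsPlaneFunctionField d f y) (ι : L →ₐ[K] AlgebraicClosure K)
    (hirr : Irreducible (f.map (mapRingHom (algebraMap K (AlgebraicClosure K))))) :
    {P : L × L | aevalAeval P.1 P.2 f = 0}.ncard ≤
      Nat.card (integralClosure K[X] F →ₐ[K] L) + d * (d - 1) ∧
    Nat.card (integralClosure K[X] F →ₐ[K] L) ≤
      {P : L × L | aevalAeval P.1 P.2 f = 0}.ncard + d * (d * (d - 1)) := by
  classical
  have := finite_algHom (K := K) (F := F) (L := L)
  set B := {P : L × L | aevalAeval P.1 P.2 f = 0 ∧ aevalAeval P.1 P.2 (derivative f) = 0} with hB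
  set G := {P : L × L | aevalAeval P.1 P.2 f = 0 ∧ aevalAeval P.1 P.2 (derivative f) ≠ 0} with hG
  set S := {φ : integralClosure K[X] F →ₐ[K] L |
    aevalAeval (H.pointOfHom φ).1 (H.pointOfHom φ).2 (derivative f) ≠ 0} with hS
  have hBc := H.ncard_singular_le ι hirr
  rw [← hB] at hBc
  have hGS : G.ncard = S.ncard := by
    rw [← H.pointOfHom_injOn.ncard_image]
    congr 1
    ext P
    constructor
    · intro hP
      obtain ⟨φ, rfl⟩ := H.exists_pointOfHom_eq hP.1 hP.2
      exact ⟨φ, hP.2, rfl⟩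
    · rintro ⟨φ, hφ, rfl⟩
      exact ⟨H.aevalAeval_pointOfHom_self φ, hφ⟩
  have hPts : {P : L × L | aevalAeval P.1 P.2 f = 0} = G ∪ B := by
    ext P
    simp only [hG, hB, Set.mem_union, Set.mem_ofPred_eq]
    tauto
  have hPts1 : {P : L × L | aevalAeval P.1 P.2 f = 0}.ncard ≤ G.ncard + B.ncard :=
    hPts ▸ Set.ncard_union_le _ _
  have hPts2 : G.ncard ≤ {P : L × L | aevalAeval P.1 P.2 f = 0}.ncard :=
    Set.ncard_le_ncard (hPts ▸ Set.subset_union_left) (Set.toFinite _)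
  have hSc : S.ncard + Sᶜ.ncard = Nat.card (integralClosure K[X] F →ₐ[K] L) :=
    Set.ncard_add_ncard_compl _
  have hSB : Sᶜ.ncard ≤ d * B.ncard := by
    rw [Set.ncard_eq_toFinset_card _ (Set.toFinite _), Set.ncard_eq_toFinset_card _ (Set.toFinite B)]
    refine (Finset.card_le_mul_card_image (f := fun φ => (H.pointOfHom φ).1) _ d ?_).trans ?_
    · intro a _
      refine le_trans ?_ ((finite_fiber (K := K) (F := F) a).2.trans H.finrank_eq.le)
      rw [← Set.ncard_coe_finset]
      refine Set.ncard_le_ncard (fun φ hφ => ?_) (finite_fiber a).1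
      rw [Finset.mem_coe, Finset.mem_filter] at hφ
      exact hφ.2
    · refine Nat.mul_le_mul_left _ ?_
      change (Finset.image (Prod.fst ∘ H.pointOfHom) _).card ≤ _
      rw [← Finset.image_image (f := H.pointOfHom) (g := Prod.fst)]
      refine Finset.card_image_le.trans (Finset.card_le_card ?_)
      intro P hP
      obtain ⟨φ, hφ, rfl⟩ := Finset.mem_image.mp hP
      rw [Set.Finite.mem_toFinset] at hφ ⊢
      refine ⟨H.aevalAeval_pointOfHom_self φ, ?_⟩
      rwa [hS, Set.mem_compl_iff, Set.mem_ofPred_eq, not_not] at hφ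
  have := hSB.trans (Nat.mul_le_mul_left d hBc)
  omega

end IsPlaneFunctionField

end

section

open Polynomial

section
variable {K F : Type*} [Field K] [Field F] [Algebra (RatFunc K) F] [Algebra K[X] F]
  [Algebra K F] [IsScalarTower K[X] (RatFunc K) F] [IsScalarTower K (RatFunc K) F]
  [IsScalarTower K K[X] F] {d : ℕ} {f : K[X][X]} {y : F}

theorem IsPlaneFunctionField.of_minpoly_eq (hf : Good d f)
    (hmin : minpoly (RatFunc K) y = f.map (algebraMap K[X] (RatFunc K)))
    (htop : Algebra.adjoin (RatFunc K) {y} = ⊤) : IsPlaneFunctionField d f y where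
  good := hf
  root := by rw [← aeval_map_algebraMap (RatFunc K), ← hmin, minpoly.aeval]
  dvd h hh := by
    rw [← aeval_map_algebraMap (RatFunc K)] at hh
    have := minpoly.dvd _ _ hh
    rwa [hmin, map_dvd_map _ (IsFractionRing.injective K[X] (RatFunc K)) hf.monic] at this
  minpoly_eq := hmin
  span z := by
    have hz : z ∈ Algebra.adjoin (RatFunc K) {y} := htop ▸ Algebra.mem_top
    rw [Algebra.adjoin_singleton_eq_range_aeval] at hz
    obtain ⟨p, rfl⟩ := hz
    have hg : (f.map (algebraMap K[X] (RatFunc K))).Monic := hf.monic.map _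
    refine ⟨fun j => (p %ₘ f.map (algebraMap K[X] (RatFunc K))).coeff j, ?_⟩
    have h1 : aeval y (p %ₘ f.map (algebraMap K[X] (RatFunc K))) = aeval y p := by
      conv_rhs => rw [← modByMonic_add_div p (f.map (algebraMap K[X] (RatFunc K)))]
      rw [map_add, map_mul, ← hmin, minpoly.aeval, zero_mul, add_zero]
    change aeval y p = _
    rw [← h1]
    conv_lhs => rw [← sum_modByMonic_coeff hg (n := d) (by
      rw [degree_eq_natDegree hg.ne_zero, hf.monic.natDegree_map, hf.natDegree])]
    simp [aeval_monomial, Algebra.smul_def]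

theorem Algebra.isSeparable_of_adjoin_eq_top {k E : Type*} [Field k] [Field E] [Algebra k E] {x : E}
    (htop : Algebra.adjoin k {x} = ⊤) (hx : IsSeparable k x) : Algebra.IsSeparable k E := by
  have h1 : IntermediateField.adjoin k {x} = ⊤ := by
    rw [_root_.eq_top_iff]
    intro z _
    exact IntermediateField.algebra_adjoin_le_adjoin _ _ (htop ▸ Algebra.mem_top)
  have h2 := (IntermediateField.isSeparable_adjoin_simple_iff_isSeparable k E).mpr hx
  rw [h1] at h2
  exact (AlgEquiv.Algebra.isSeparable_iff IntermediateField.topEquiv).mp h2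

end

section
universe u
variable {K : Type u} [Field K] {d : ℕ} {f : K[X][X]}

theorem Good.irreducible_ratFunc (hf : Good d f)
    (hirr : Irreducible (f.map (mapRingHom (algebraMap K (AlgebraicClosure K))))) :
    Irreducible (f.map (algebraMap K[X] (RatFunc K))) := by
  rw [← hf.monic.irreducible_iff_irreducible_map_fraction_map]
  exact hf.monic.irreducible_of_irreducible_map _ _ hirr

theorem Good.exists_curveData [Finite K] (hf : Good d f)
    (hirr : Irreducible (f.map (mapRingHom (algebraMap K (AlgebraicClosure K)))))
    (hder : derivative f ≠ 0) :
    ∃ (F : Type u) (_ : Field F) (P : Type u) (C : CurveData F P), C.q = Nat.card K ∧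
      2 * (C.g : ℝ) ≤ ((d : ℝ) - 1) * ((d : ℝ) - 2) ∧
      ∀ (L : Type u) [Field L] [Finite L] [Algebra K L] (_ : L →ₐ[K] AlgebraicClosure K),
        {P : L × L | aevalAeval P.1 P.2 f = 0}.ncard ≤
          C.N (Module.finrank K L) + d * (d - 1) ∧
        C.N (Module.finrank K L) ≤
          {P : L × L | aevalAeval P.1 P.2 f = 0}.ncard + d * (d * (d - 1)) + d := by
  have hirr' := hf.irreducible_ratFunc hirr
  have : Fact (Irreducible (f.map (algebraMap K[X] (RatFunc K)))) := ⟨hirr'⟩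
  set g := f.map (algebraMap K[X] (RatFunc K)) with hg
  have hgm : g.Monic := hf.monic.map _
  have hmin : minpoly (RatFunc K) (AdjoinRoot.root g) = g := by
    rw [AdjoinRoot.minpoly_root hgm.ne_zero, hgm.leadingCoeff]
    simp
  have htop : Algebra.adjoin (RatFunc K) {AdjoinRoot.root g} = ⊤ := AdjoinRoot.adjoinRoot_eq_top
  have H : IsPlaneFunctionField d f (AdjoinRoot.root g) := .of_minpoly_eq hf hmin htop
  have hfd : FiniteDimensional (RatFunc K) (AdjoinRoot g) := hgm.finite_adjoinRoot
  have hsep : Algebra.IsSeparable (RatFunc K) (AdjoinRoot g) := by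
    refine Algebra.isSeparable_of_adjoin_eq_top htop ?_
    rw [IsSeparable, hmin, separable_iff_derivative_ne_zero hirr', hg, derivative_map, Ne,
      Polynomial.map_eq_zero_iff (IsFractionRing.injective K[X] (RatFunc K))]
    exact hder
  obtain ⟨P, C, hq, hG, hN⟩ := CurveData.exists_of_cover K (AdjoinRoot g)
    (Fintype.card (Σ j : Fin d, Fin ((j : ℕ) - 1))) (fun z h1 h2 => H.mem_range_of_isIntegral hirr h1 h2)
    le_rfl _ H.exists_eq_add_add_sum
  refine ⟨AdjoinRoot g, inferInstance, P, C, hq, ?_, fun L _ _ _ ι => ?_⟩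
  · have hd : 0 < d := by
      simpa using (hf.map (algebraMap K (AlgebraicClosure K))).pos hirr
    obtain ⟨e, rfl⟩ := Nat.exists_eq_succ_of_ne_zero hd.ne'
    have h1 := two_mul_card_sigma e
    have h2 : (C.g : ℝ) ≤ (Fintype.card (Σ j : Fin (e + 1), Fin ((j : ℕ) - 1)) : ℤ) := by
      exact_mod_cast hG
    have h3 : (2 : ℝ) * (Fintype.card (Σ j : Fin (e + 1), Fin ((j : ℕ) - 1)) : ℤ) =
      (e : ℝ) * ((e : ℝ) - 1) := by exact_mod_cast h1
    push_cast at h2 h3 ⊢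
    linarith
  · obtain ⟨n, hn, h1⟩ := hN L
    rw [H.finrank_eq] at hn
    have := H.card_algHom ι hirr
    omega

end

end

section

open Polynomial

theorem exists_branch {k : Type*} [Field k] [IsAlgClosed k] {d : ℕ} {f : k[X][X]} (hf : Good d f)
    (hd : 0 < d) (hsep : ∀ b, f.evalEval 0 b = 0 → (derivative f).evalEval 0 b ≠ 0) :
    ∃ (α : PowerSeries k) (b : k), branch α f = 0 ∧ (derivative f).evalEval 0 b ≠ 0 := by
  obtain ⟨ζ, hζ⟩ := IsAlgClosed.exists_root (f.map (evalRingHom 0)) (by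
    rw [degree_eq_natDegree (hf.monic.map _).ne_zero, hf.monic.natDegree_map, hf.natDegree]
    exact_mod_cast hd.ne')
  rw [IsRoot, map_evalRingHom_eval] at hζ
  have h1 := hsep ζ hζ
  have hev (h : k[X][X]) : PowerSeries.constantCoeff
      ((h.map coeToPowerSeries.ringHom).eval (PowerSeries.C ζ)) = h.evalEval 0 ζ := by
    rw [← branch_apply, constantCoeff_branch, PowerSeries.constantCoeff_C]
  obtain ⟨α, -, hα, -⟩ := exists_powerSeries_root (f.map coeToPowerSeries.ringHom) ζ
    ((derivative f).evalEval 0 ζ)⁻¹ (by rw [hev, hζ])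
    (by rw [derivative_map, hev, inv_mul_cancel₀ h1]) ⊤ (by simp) (by simp) (by simp)
  exact ⟨α, ζ, by rw [branch_apply, hα], h1⟩

section
variable (K : Type*) [Field K] [Finite K]

/-- The extension of degree `m` of a finite field inside its algebraic closure. -/
def frobFixed (m : ℕ) : IntermediateField K (AlgebraicClosure K) where
  carrier := {a | a ^ Nat.card K ^ m = a}
  mul_mem' {a b} ha hb := by
    rw [Set.mem_ofPred_eq] at *
    rw [mul_pow, ha, hb]
  add_mem' {a b} ha hb := by
    rw [Set.mem_ofPred_eq] at *
    obtain ⟨p, hp⟩ := CharP.exists K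
    have : Fintype K := Fintype.ofFinite K
    obtain ⟨n, hp', hn⟩ := FiniteField.card K p
    have : Fact p.Prime := ⟨hp'⟩
    have : CharP (AlgebraicClosure K) p := charP_of_injective_algebraMap
      (algebraMap K (AlgebraicClosure K)).injective p
    rw [Nat.card_eq_fintype_card, hn, ← pow_mul] at ha hb ⊢
    rw [add_pow_char_pow, ha, hb]
  algebraMap_mem' c := by
    rw [Set.mem_ofPred_eq, ← map_pow]
    have : Fintype K := Fintype.ofFinite K
    rw [Nat.card_eq_fintype_card, FiniteField.pow_card_pow]
  inv_mem' a ha := by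
    rw [Set.mem_ofPred_eq] at *
    rw [inv_pow, ha]

theorem mem_frobFixed {m : ℕ} {a : AlgebraicClosure K} :
    a ∈ frobFixed K m ↔ a ^ Nat.card K ^ m = a := Iff.rfl

theorem natCard_frobFixed {m : ℕ} (hm : m ≠ 0) :
    Nat.card (frobFixed K m) = Nat.card K ^ m := by
  classical
  obtain ⟨p, hp⟩ := CharP.exists K
  have : Fintype K := Fintype.ofFinite K
  obtain ⟨n, hp', hn⟩ := FiniteField.card K p
  have : Fact p.Prime := ⟨hp'⟩
  have : CharP (AlgebraicClosure K) p := charP_of_injective_algebraMap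
    (algebraMap K (AlgebraicClosure K)).injective p
  have h0 : (X ^ p ^ (n * m) - X : (AlgebraicClosure K)[X]) ≠ 0 :=
    FiniteField.X_pow_card_pow_sub_X_ne_zero _ (mul_ne_zero n.ne_zero hm) hp'.one_lt
  rw [Nat.card_eq_fintype_card (α := K), hn, ← pow_mul,
    ← card_fixedElts (k := AlgebraicClosure K) (p := p) (n * m) (mul_ne_zero n.ne_zero hm),
    ← Set.ncard_coe_finset]
  change Set.ncard _ = _
  congr 1
  ext a
  rw [SetLike.mem_coe, mem_frobFixed, Finset.mem_coe, Multiset.mem_toFinset, mem_roots h0,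
    Nat.card_eq_fintype_card (α := K), hn, ← pow_mul]
  simp [sub_eq_zero]

theorem finite_frobFixed {m : ℕ} (hm : m ≠ 0) : Finite (frobFixed K m) := by
  refine Nat.finite_of_card_ne_zero ?_
  rw [natCard_frobFixed K hm]
  exact pow_ne_zero _ Nat.card_pos.ne'

theorem finrank_frobFixed {m : ℕ} (hm : m ≠ 0) : Module.finrank K (frobFixed K m) = m := by
  have := finite_frobFixed K hm
  have h1 := natCard_frobFixed K hm
  rw [Module.natCard_eq_pow_finrank (K := K)] at h1
  exact Nat.pow_right_injective (Finite.one_lt_card) h1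

theorem ncard_fixedPts_eq (f : K[X][X]) (m : ℕ) :
    {P : frobFixed K m × frobFixed K m | aevalAeval P.1 P.2 f = 0}.ncard =
      (fixedPts (f.map (mapRingHom (algebraMap K (AlgebraicClosure K)))) (Nat.card K ^ m)).ncard := by
  have hinj : Function.Injective (Prod.map (frobFixed K m).val (frobFixed K m).val) :=
    Subtype.val_injective.prodMap Subtype.val_injective
  rw [← Set.ncard_image_of_injective _ hinj]
  congr 1
  ext P
  constructor
  · rintro ⟨Q, hQ, rfl⟩
    refine ⟨?_, Q.1.2, Q.2.2⟩
    rw [Prod.map_fst, Prod.map_snd, evalEval_map_mapRingHom]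
    rw [Set.mem_ofPred_eq] at hQ
    rw [hQ, map_zero]
  · rintro ⟨h1, h2, h3⟩
    refine ⟨(⟨P.1, h2⟩, ⟨P.2, h3⟩), ?_, rfl⟩
    have := evalEval_map_mapRingHom (frobFixed K m).val f ⟨P.1, h2⟩ ⟨P.2, h3⟩
    rw [Set.mem_ofPred_eq]
    refine (map_eq_zero_iff _ (frobFixed K m).val.toRingHom.injective).mp (this.symm.trans h1)

end

end

section

open Polynomial

theorem CurveData.exists_dvd_of_N_ne_zero {F P : Type*} [Field F] (C : CurveData F P) {m : ℕ}
    (h : C.N m ≠ 0) : ∃ p, C.deg p ∣ m := by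
  by_contra! h1
  refine h (finsum_mem_eq_zero_of_forall_eq_zero fun p hp => absurd hp (h1 p))

theorem CurveData.exists_degree_eq_one {F P : Type*} [Field F] (C : CurveData F P) {m : ℕ}
    (h1 : C.N m ≠ 0) (h2 : C.N (m + 1) ≠ 0) : ∃ D, C.degree D = 1 := by
  obtain ⟨p, a, ha⟩ := C.exists_dvd_of_N_ne_zero h1
  obtain ⟨p', b, hb⟩ := C.exists_dvd_of_N_ne_zero h2
  refine ⟨.single p' b - .single p a, ?_⟩
  rw [map_sub, C.degree_single, C.degree_single]
  rw [mul_comm] at ha hb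
  have ha' : (m : ℤ) = a * C.deg p := by exact_mod_cast ha
  have hb' : ((m + 1 : ℕ) : ℤ) = b * C.deg p' := by exact_mod_cast hb
  rw [← ha', ← hb']
  push_cast
  ring

section
universe u
variable {K : Type u} [Field K] [Finite K] {d : ℕ} {f : K[X][X]}

/-- The Hasse-Weil bound for affine plane curves over a finite field. -/
theorem Good.abs_ncard_sub_le (hf : Good d f)
    (hirr : Irreducible (f.map (mapRingHom (algebraMap K (AlgebraicClosure K)))))
    (hsep : ∀ b, (f.map (mapRingHom (algebraMap K (AlgebraicClosure K)))).evalEval 0 b = 0 →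
      (derivative (f.map (mapRingHom (algebraMap K (AlgebraicClosure K))))).evalEval 0 b ≠ 0) :
    |((fixedPts (f.map (mapRingHom (algebraMap K (AlgebraicClosure K)))) (Nat.card K)).ncard : ℝ) -
      Nat.card K| ≤ ((d : ℝ) - 1) * ((d : ℝ) - 2) * √(Nat.card K) + (d : ℝ) ^ 3 := by
  set φ := algebraMap K (AlgebraicClosure K) with hφ
  set g := f.map (mapRingHom φ) with hgdef
  have hg : Good d g := hf.map φ
  have hd := hg.pos hirr
  obtain ⟨α, b0, hα, hb0⟩ := exists_branch hg hd hsep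
  have hder : derivative f ≠ 0 := by
    intro h
    rw [hgdef, derivative_map, h] at hb0
    simp at hb0
  obtain ⟨F, _, P, C, hCq, hCg, hCN⟩ := hf.exists_curveData hirr hder
  set q := Nat.card K with hq
  set S : ℕ → ℕ := fun m => (fixedPts g (q ^ m)).ncard with hS
  have hN : ∀ m ≠ 0, S m ≤ C.N m + d * (d - 1) ∧ C.N m ≤ S m + d * (d * (d - 1)) + d := by
    intro m hm
    have := finite_frobFixed K hm
    have h := hCN (frobFixed K m) (frobFixed K m).val
    rwa [finrank_frobFixed K hm, ncard_fixedPts_eq] at h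
  obtain ⟨p, hp⟩ := CharP.exists K
  have : Fintype K := Fintype.ofFinite K
  obtain ⟨n, hp', hn⟩ := FiniteField.card K p
  have : Fact p.Prime := ⟨hp'⟩
  have : CharP (AlgebraicClosure K) p := charP_of_injective_algebraMap φ.injective p
  have hqn : q = p ^ (n : ℕ) := by rw [hq, Nat.card_eq_fintype_card, hn]
  have hq2 : 2 ≤ q := Finite.one_lt_card
  have hfix : ∀ m i j, ((g.coeff j).coeff i) ^ q ^ m = (g.coeff j).coeff i := by
    intro m i j
    have : (g.coeff j).coeff i = φ ((f.coeff j).coeff i) := by simp [hgdef]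
    rw [this, ← map_pow, hq, Nat.card_eq_fintype_card, FiniteField.pow_card_pow]
  have up : ∀ k ≠ 0, S (2 * k) ≤ q ^ (2 * k) + stepC d 1 * q ^ k := by
    intro k hk
    have h := ncard_fixedPts_le (p := p) hg hirr α hα (le_refl (n * k : ℕ)) (mul_ne_zero n.ne_zero hk)
    rwa [pow_mul, ← hqn, ← pow_add, ← two_mul] at h
  have lo : ∀ k ≠ 0, q ^ (2 * k) ≤ S (2 * k) + stepC d (d - 1) * q ^ k + d * (d * (d - 1)) := by
    intro k hk
    have h := le_ncard_fixedPts (p := p) hg hirr α hα hb0 (le_refl (n * k : ℕ))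
      (mul_ne_zero n.ne_zero hk) (by
        rw [← mul_add, pow_mul, ← hqn]
        exact hfix _)
    rwa [pow_mul, ← hqn, ← pow_add, ← two_mul] at h
  have lo' : ∀ k, q ^ (2 * k + 1) ≤
      S (2 * k + 1) + stepC d (d - 1) * q ^ (k + 1) + d * (d * (d - 1)) := by
    intro k
    have h := le_ncard_fixedPts (p := p) hg hirr α hα hb0 (r := n * k) (s := n * (k + 1))
      (Nat.mul_le_mul_left _ (Nat.le_succ k)) (mul_ne_zero n.ne_zero k.succ_ne_zero) (by
        rw [← mul_add, pow_mul, ← hqn]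
        exact hfix _)
    rwa [pow_mul, pow_mul, ← hqn, ← pow_add, ← add_assoc, ← two_mul] at h
  have hdeg : ∃ D, C.degree D = 1 := by
    set c := stepC d (d - 1) + d * (d * (d - 1)) + d * (d - 1) with hc
    have hk : c < q ^ (c + 1) := (Nat.lt_pow_self hq2).trans
      (Nat.pow_lt_pow_right hq2 (Nat.lt_succ_self _))
    have hpos : ∀ a b : ℕ, 0 < b → c < a → stepC d (d - 1) * b + d * (d * (d - 1)) + d * (d - 1) <
        a * b := by
      intro a b hb ha
      have h1 := Nat.mul_lt_mul_of_pos_right ha hb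
      refine lt_of_le_of_lt ?_ h1
      rw [hc, add_mul, add_mul]
      exact Nat.add_le_add (Nat.add_le_add_left (Nat.le_mul_of_pos_right _ hb) _)
        (Nat.le_mul_of_pos_right _ hb)
    refine C.exists_degree_eq_one (m := 2 * (c + 1)) ?_ ?_
    · have h1 := lo (c + 1) (by omega)
      have h2 := (hN (2 * (c + 1)) (by omega)).1
      have h3 := hpos (q ^ (c + 1)) (q ^ (c + 1)) (by positivity) hk
      rw [← pow_add, ← two_mul] at h3
      omega
    · have h1 := lo' (c + 1)
      have h2 := (hN (2 * (c + 1) + 1) (by omega)).1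
      have h3 := hpos (q ^ (c + 1)) (q ^ (c + 1 + 1)) (by positivity) hk
      rw [← pow_add, ← add_assoc, ← two_mul] at h3
      omega
  have hw := C.hasse_weil hdeg
    (c := stepC d 1 + stepC d (d - 1) + d * (d * (d - 1 : ℕ)) + d + d * (d * (d - 1 : ℕ)) + d * (d - 1 : ℕ))
    (by
      intro k hk
      rw [hCq]
      obtain ⟨h1, h2⟩ := hN (2 * k) (by omega)
      have h3 := up k hk
      have h4 := lo k hk
      have h5 : 1 ≤ q ^ k := Nat.one_le_pow _ _ (by omega)
      have h6 : (1 : ℝ) ≤ (q : ℝ) ^ k := by exact_mod_cast h5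
      rify at h1 h2 h3 h4
      have e1 : (0 : ℝ) ≤ d * (d - 1 : ℕ) := by positivity
      have e2 : (0 : ℝ) ≤ d * (d * (d - 1 : ℕ)) := by positivity
      have e3 : (0 : ℝ) ≤ stepC d 1 := by positivity
      have e4 : (0 : ℝ) ≤ stepC d (d - 1) := by positivity
      have e5 : (0 : ℝ) ≤ d := by positivity
      rw [abs_le]
      constructor <;> nlinarith)
  rw [hCq] at hw
  have h1 := hN 1 one_ne_zero
  rw [hS] at h1
  simp only [pow_one] at h1
  obtain ⟨h1, h2⟩ := h1
  rify at h1 h2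
  rw [Nat.cast_sub (by omega)] at h1 h2
  rw [abs_le] at hw ⊢
  have hs := Real.sqrt_nonneg (q : ℝ)
  have hd1 : (1 : ℝ) ≤ d := by exact_mod_cast hd
  have h4 := mul_le_mul_of_nonneg_right hCg hs
  obtain ⟨h5, h6⟩ := hw
  push_cast at h1 h2
  constructor
  · nlinarith [mul_nonneg (sub_nonneg.mpr hd1) (sub_nonneg.mpr hd1)]
  · nlinarith [mul_nonneg (sub_nonneg.mpr hd1) (sub_nonneg.mpr hd1),
      mul_nonneg (mul_nonneg (sub_nonneg.mpr hd1) (sub_nonneg.mpr hd1)) (sub_nonneg.mpr hd1)]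

end

end

section

open Polynomial

section
universe u
variable {K : Type u} [Field K] [Finite K] {d : ℕ}

theorem mem_range_algebraMap_of_pow_natCard {a : AlgebraicClosure K} (ha : a ^ Nat.card K = a) :
    a ∈ Set.range (algebraMap K (AlgebraicClosure K)) := by
  have h1 : a ∈ frobFixed K 1 := by rw [mem_frobFixed, pow_one, ha]
  have h2 : frobFixed K 1 = ⊥ :=
    IntermediateField.finrank_eq_one_iff.mp (finrank_frobFixed K one_ne_zero)
  rw [h2, IntermediateField.mem_bot] at h1
  exact h1

theorem Good.exists_map_eq {h : (AlgebraicClosure K)[X][X]} (hh : Good d h)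
    (hfix : ∀ i j, ((h.coeff j).coeff i) ^ Nat.card K = (h.coeff j).coeff i) :
    ∃ f : K[X][X], Good d f ∧ f.map (mapRingHom (algebraMap K (AlgebraicClosure K))) = h := by
  have hlift : h ∈ lifts (mapRingHom (algebraMap K (AlgebraicClosure K))) := by
    rw [lifts_iff_coeff_lifts]
    intro j
    have : h.coeff j ∈ lifts (algebraMap K (AlgebraicClosure K)) := by
      rw [lifts_iff_coeff_lifts]
      exact fun i => mem_range_algebraMap_of_pow_natCard (hfix i j)
    obtain ⟨u, hu⟩ := (mem_lifts _).mp this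
    exact ⟨u, hu⟩
  obtain ⟨f, hf, hfd, hfm⟩ := lifts_and_natDegree_eq_and_monic hlift hh.monic
  refine ⟨f, ⟨hfm, hfd.trans hh.natDegree, ?_⟩, hf⟩
  refine TDeg.of_map _ (algebraMap K (AlgebraicClosure K)).injective ?_
  rw [hf]
  exact hh.tDeg

/-- An irreducible plane curve over the algebraic closure has few rational points. -/
theorem Good.ncard_fixedPts_natCard_le {h : (AlgebraicClosure K)[X][X]} (hh : Good d h)
    (hirr : Irreducible h)
    (hsep : ∀ b, h.evalEval 0 b = 0 → (derivative h).evalEval 0 b ≠ 0) :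
    ((fixedPts h (Nat.card K)).ncard : ℝ) ≤
      Nat.card K + ((d : ℝ) - 1) * ((d : ℝ) - 2) * √(Nat.card K) + (d : ℝ) ^ 3 := by
  have : Fintype K := Fintype.ofFinite K
  obtain ⟨σ, hσ⟩ : ∃ σ : AlgebraicClosure K →+* AlgebraicClosure K, ∀ a, σ a = a ^ Nat.card K :=
    ⟨(FiniteField.frobeniusAlgHom K (AlgebraicClosure K)).toRingHom, fun a => by
      rw [Nat.card_eq_fintype_card]; rfl⟩
  by_cases hdvd : h ∣ h.map (mapRingHom σ)
  · have heq : h.map (mapRingHom σ) = h :=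
      (eq_of_monic_of_dvd_of_natDegree_le hh.monic (hh.monic.map _) hdvd
        (by rw [hh.monic.natDegree_map]))
    obtain ⟨f, hf, rfl⟩ := hh.exists_map_eq (fun i j => by
      rw [← hσ]
      conv_rhs => rw [← heq]
      simp)
    have := (abs_le.mp (hf.abs_ncard_sub_le hirr hsep)).2
    linarith
  · have hfin := fixedPts_finite h (Finite.one_lt_card (α := K))
    have hb := bezout_card hh hirr (hh.map σ).tDeg hdvd hfin.toFinset
      (fun P hP => (hfin.mem_toFinset.mp hP).1) (fun P hP => by
        have h1 := hfin.mem_toFinset.mp hP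
        have h2 : (evalEvalRingHom (σ P.1) (σ P.2)).comp (mapRingHom (mapRingHom σ)) =
            σ.comp (evalEvalRingHom P.1 P.2) := by
          ext <;> simp
        have h3 := DFunLike.congr_fun h2 h
        rw [hσ, hσ, h1.2.1, h1.2.2] at h3
        refine h3.trans ?_
        change σ (h.evalEval P.1 P.2) = 0
        rw [h1.1, map_zero])
    rw [← Set.ncard_eq_toFinset_card _ hfin] at hb
    have hd : (1 : ℝ) ≤ d := by exact_mod_cast hh.pos hirr
    have hb' : ((fixedPts h (Nat.card K)).ncard : ℝ) ≤ d * d := by exact_mod_cast hb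
    have h4 : 0 ≤ ((d : ℝ) - 1) * ((d : ℝ) - 2) := by
      rcases Nat.eq_or_lt_of_le (hh.pos hirr) with h | h
      · simp [← h]
      · have : (2 : ℝ) ≤ d := by exact_mod_cast h
        exact mul_nonneg (by linarith) (by linarith)
    have h5 := mul_nonneg h4 (Real.sqrt_nonneg (Nat.card K : ℝ))
    have h6 : (0 : ℝ) ≤ Nat.card K := by positivity
    nlinarith [mul_nonneg (sub_nonneg.mpr hd) (mul_nonneg (by positivity : (0:ℝ) ≤ d) (by positivity : (0:ℝ) ≤ d))]

end

end

section

open Matrix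

theorem Matrix.exists_det_submatrix_ne_zero_of_field {L m n : Type*} [Field L] [Fintype m]
    [Fintype n] [DecidableEq n] (M : Matrix m n L) (h : ∀ v, M *ᵥ v = 0 → v = 0) :
    ∃ r : n → m, (M.submatrix r id).det ≠ 0 := by
  have hrank : M.rank = Fintype.card n := by
    have h1 := LinearMap.finrank_range_of_inj (f := M.mulVecLin)
      ((injective_iff_map_eq_zero M.mulVecLin).2 fun v hv => h v (by simpa using hv))
    rw [Module.finrank_fintype_fun_eq_card] at h1
    exact h1
  have hspan : Submodule.span L (Set.range M.row) = ⊤ := by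
    apply Submodule.eq_top_of_finrank_eq
    rw [← Matrix.rank_eq_finrank_span_row, hrank, Module.finrank_fintype_fun_eq_card]
  obtain ⟨κ, a, ha, hsp, hli⟩ := exists_linearIndependent' L M.row
  rw [hspan] at hsp
  let b := Module.Basis.mk hli hsp.ge
  have : Finite κ := Finite.of_injective a ha
  have : Fintype κ := Fintype.ofFinite κ
  have hc : Fintype.card n = Fintype.card κ := by
    rw [← Module.finrank_eq_card_basis b, Module.finrank_fintype_fun_eq_card]
  let e : n ≃ κ := Fintype.equivOfCardEq hc
  refine ⟨a ∘ e, ?_⟩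
  have hli' : LinearIndependent L (M.submatrix (a ∘ e) id).row := hli.comp e e.injective
  rw [Matrix.linearIndependent_rows_iff_isUnit, Matrix.isUnit_iff_isUnit_det] at hli'
  exact hli'.ne_zero

theorem Matrix.exists_det_submatrix_ne_zero {S m n : Type*} [CommRing S] [IsDomain S] [Fintype m]
    [Fintype n] [DecidableEq n] (M : Matrix m n S)
    (h : ∀ v : n → FractionRing S, M.map (algebraMap S (FractionRing S)) *ᵥ v = 0 → v = 0) :
    ∃ r : n → m, (M.submatrix r id).det ≠ 0 := by
  obtain ⟨r, hr⟩ := exists_det_submatrix_ne_zero_of_field _ h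
  refine ⟨r, fun h0 => hr ?_⟩
  rw [show (M.map (algebraMap S (FractionRing S))).submatrix r id =
    (algebraMap S (FractionRing S)).mapMatrix (M.submatrix r id) from rfl, ← RingHom.map_det, h0,
    map_zero]

theorem MvPolynomial.totalDegree_det_le {σ k n : Type*} [CommRing k] [Fintype n] [DecidableEq n]
    (M : Matrix n n (MvPolynomial σ k)) (B : ℕ) (h : ∀ i j, (M i j).totalDegree ≤ B) :
    M.det.totalDegree ≤ Fintype.card n * B := by
  rw [Matrix.det_apply]
  refine MvPolynomial.totalDegree_finsetSum_le fun s _ => ?_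
  rw [Units.smul_def]
  refine (MvPolynomial.totalDegree_smul_le _ _).trans ?_
  refine (MvPolynomial.totalDegree_finsetProd _ _).trans ?_
  refine (Finset.sum_le_card_nsmul _ _ B fun i _ => h _ _).trans ?_
  simp

/-- Schwartz–Zippel as a bound on a set of zeros. -/
theorem MvPolynomial.ncard_zeros_le {n : ℕ} {k : Type*} [CommRing k] [IsDomain k]
    {p : MvPolynomial (Fin n) k} (hp : p ≠ 0) {D : ℕ} (hD : p.totalDegree ≤ D) (T : Finset k)
    (A : Finset (Fin n → k)) (hA : ∀ c ∈ A, (∀ i, c i ∈ T) ∧ MvPolynomial.eval c p = 0) :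
    (A.card : ℝ) * T.card ≤ D * (T.card : ℝ) ^ n := by
  classical
  have h1 := MvPolynomial.schwartz_zippel_totalDegree hp T
  have h2 : A.card ≤ (Finset.filter (fun f => MvPolynomial.eval f p = 0)
      (Fintype.piFinset fun _ : Fin n => T)).card :=
    Finset.card_le_card fun c hc => by
      have := hA c hc
      simp [this.1, this.2]
  rcases T.card.eq_zero_or_pos with h0 | h0
  · rw [h0]; simp; positivity
  rw [div_le_div_iff₀ (by positivity) (by positivity)] at h1
  have h3 : (A.card : ℝ) * T.card ≤ p.totalDegree * (T.card : ℝ) ^ n := by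
    have : (A.card : ℝ) ≤ (Finset.filter (fun f => MvPolynomial.eval f p = 0)
      (Fintype.piFinset fun _ : Fin n => T)).card := by exact_mod_cast h2
    refine (mul_le_mul_of_nonneg_right this (by positivity)).trans ?_
    exact_mod_cast h1
  refine h3.trans ?_
  gcongr

end

section

open Polynomial

section Shear
variable {k τ : Type*} [CommRing k]

/-- The endomorphism of `k[τ][Y]` fixing `Y` and translating the variable `i` by `w i`. -/
noncomputable def shear (w : τ → (MvPolynomial τ k)[X]) :
    (MvPolynomial τ k)[X] →+* (MvPolynomial τ k)[X] :=
  eval₂RingHom (MvPolynomial.aeval fun i => C (MvPolynomial.X i) + w i :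
    MvPolynomial τ k →ₐ[k] (MvPolynomial τ k)[X]).toRingHom X

@[simp] theorem shear_X (w : τ → (MvPolynomial τ k)[X]) : shear w X = X := by
  simp [shear]

@[simp] theorem shear_C (w : τ → (MvPolynomial τ k)[X]) (p : MvPolynomial τ k) :
    shear w (C p) = MvPolynomial.aeval (fun i => C (MvPolynomial.X i) + w i) p := by
  simp [shear]

theorem shear_comp_shear (w w' : τ → (MvPolynomial τ k)[X]) (h : ∀ i, shear w' (w i) = w i)
    (hw : ∀ i, w i + w' i = 0) : (shear w').comp (shear w) = RingHom.id _ := by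
  apply Polynomial.ringHom_ext'
  · apply MvPolynomial.ringHom_ext
    · intro r
      simp [MvPolynomial.algebraMap_eq, IsScalarTower.algebraMap_apply k (MvPolynomial τ k) _]
    · intro i
      simp [h, add_assoc, add_comm (w' i), hw]
  · simp

theorem irreducible_aeval_shear {k : Type*} [Field k] (w : τ → (MvPolynomial τ k)[X])
    (h : ∀ i, shear w (w i) = w i) (h' : ∀ i, shear (-w) (w i) = w i)
    {F : MvPolynomial τ k} (hF : Irreducible F) :
    Irreducible (MvPolynomial.aeval (fun i => C (MvPolynomial.X i) + w i) F :
      (MvPolynomial τ k)[X]) := by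
  have h1 := shear_comp_shear w (-w) h' (by simp)
  have h2 := shear_comp_shear (-w) w (by simp [h]) (by simp)
  let e : (MvPolynomial τ k)[X] ≃+* (MvPolynomial τ k)[X] := RingEquiv.ofRingHom _ _ h2 h1
  have h3 : Irreducible (C F : (MvPolynomial τ k)[X]) :=
    (Polynomial.prime_C_iff.2 hF.prime).irreducible
  rw [← shear_C w F]
  exact (MulEquiv.irreducible_iff e.toMulEquiv).2 h3
end Shear

section Slice
variable {k σ R : Type*} [CommRing k] [CommRing R] [Algebra k R]

/-- The polynomial `F(a + b Y)`. -/
noncomputable def line (F : MvPolynomial σ k) (a b : σ → R) : R[X] :=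
  MvPolynomial.aeval (fun i => C (a i) + C (b i) * X) F

/-- The bivariate polynomial `F(a + b Y + c X)`, with `Y` the outer variable. -/
noncomputable def slice (F : MvPolynomial σ k) (a b c : σ → R) : R[X][X] :=
  MvPolynomial.aeval (fun i => C (C (a i)) + C (C (b i)) * X + C (C (c i) * X)) F

variable (F : MvPolynomial σ k) (a b c : σ → R)

theorem slice_map {R' : Type*} [CommRing R'] [Algebra k R'] (φ : R →ₐ[k] R') :
    (slice F a b c).map (mapRingHom (φ : R →+* R')) =
      slice F (fun i => φ (a i)) (fun i => φ (b i)) (fun i => φ (c i)) := by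
  have : (mapRingHom (mapRingHom (φ : R →+* R'))).comp
      (MvPolynomial.aeval fun i => C (C (a i)) + C (C (b i)) * X + C (C (c i) * X) :
        MvPolynomial σ k →ₐ[k] R[X][X]).toRingHom = (MvPolynomial.aeval fun i =>
        C (C (φ (a i))) + C (C (φ (b i))) * X + C (C (φ (c i)) * X) :
        MvPolynomial σ k →ₐ[k] R'[X][X]).toRingHom := by
    apply MvPolynomial.ringHom_ext
    · intro r
      simp [IsScalarTower.algebraMap_apply k R[X] R[X][X],
        IsScalarTower.algebraMap_apply k R R[X], IsScalarTower.algebraMap_apply k R'[X] R'[X][X],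
        IsScalarTower.algebraMap_apply k R' R'[X]]
    · intro i
      simp
  exact congrArg (fun g => g F) this

theorem line_map {R' : Type*} [CommRing R'] [Algebra k R'] (φ : R →ₐ[k] R') :
    (line F a b).map (φ : R →+* R') =
      line F (fun i => φ (a i)) (fun i => φ (b i)) := by
  have : (mapRingHom (φ : R →+* R')).comp
      (MvPolynomial.aeval fun i => C (a i) + C (b i) * X :
        MvPolynomial σ k →ₐ[k] R[X]).toRingHom = (MvPolynomial.aeval fun i =>
        C (φ (a i)) + C (φ (b i)) * X : MvPolynomial σ k →ₐ[k] R'[X]).toRingHom := by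
    apply MvPolynomial.ringHom_ext
    · intro r
      simp [IsScalarTower.algebraMap_apply k R R[X], IsScalarTower.algebraMap_apply k R' R'[X]]
    · intro i
      simp
  exact congrArg (fun g => g F) this

theorem slice_map_eval (x : R) :
    (slice F a b c).map (evalRingHom x) = line F (fun i => a i + c i * x) b := by
  have : (mapRingHom (evalRingHom x)).comp
      (MvPolynomial.aeval fun i => C (C (a i)) + C (C (b i)) * X + C (C (c i) * X) :
        MvPolynomial σ k →ₐ[k] R[X][X]).toRingHom = (MvPolynomial.aeval fun i =>
        C (a i + c i * x) + C (b i) * X : MvPolynomial σ k →ₐ[k] R[X]).toRingHom := by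
    apply MvPolynomial.ringHom_ext
    · intro r
      simp [IsScalarTower.algebraMap_apply k R[X] R[X][X],
        IsScalarTower.algebraMap_apply k R R[X]]
    · intro i
      simp
      ring
  exact congrArg (fun g => g F) this

theorem line_eval (y : R) :
    (line F a b).eval y = MvPolynomial.aeval (fun i => a i + b i * y) F := by
  have : (evalRingHom y).comp
      (MvPolynomial.aeval fun i => C (a i) + C (b i) * X :
        MvPolynomial σ k →ₐ[k] R[X]).toRingHom = (MvPolynomial.aeval fun i =>
        a i + b i * y : MvPolynomial σ k →ₐ[k] R).toRingHom := by
    apply MvPolynomial.ringHom_ext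
    · intro r
      simp [IsScalarTower.algebraMap_apply k R R[X]]
    · intro i
      simp
  exact congrArg (fun g => g F) this

theorem slice_evalEval (x y : R) :
    (slice F a b c).evalEval x y = MvPolynomial.aeval (fun i => a i + c i * x + b i * y) F := by
  rw [← map_evalRingHom_eval, slice_map_eval, line_eval]

theorem slice_tDeg {d : ℕ} (hF : F.totalDegree ≤ d) : TDeg d (slice F a b c) := by
  rw [slice, MvPolynomial.aeval_def, MvPolynomial.eval₂_eq]
  refine TDeg.sum _ _ fun m hm => ?_
  have h0 : ∀ i, TDeg 1 (C (C (a i)) + C (C (b i)) * X + C (C (c i) * X) : R[X][X]) := fun i =>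
    ((TDeg.CC _ _).add ((TDeg.CC (b i) 0).mul TDeg.Y)).add
      (by rw [C_mul]; exact (TDeg.CC (c i) 0).mul TDeg.CX)
  have h1 : ∀ s : Finset σ, TDeg (∑ i ∈ s, m i)
      (∏ i ∈ s, (C (C (a i)) + C (C (b i)) * X + C (C (c i) * X) : R[X][X]) ^ m i) := by
    classical
    intro s
    induction s using Finset.induction_on with
    | empty => simpa using TDeg.CC (1 : R) 0
    | insert i s hi ih =>
      rw [Finset.sum_insert hi, Finset.prod_insert hi]
      refine TDeg.mul ?_ ih
      simpa using (h0 i).pow (m i)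
  have h2 : algebraMap k R[X][X] (MvPolynomial.coeff m F) =
      C (C (algebraMap k R (MvPolynomial.coeff m F))) := by
    simp [IsScalarTower.algebraMap_apply k R[X] R[X][X], IsScalarTower.algebraMap_apply k R R[X]]
  rw [h2]
  refine ((TDeg.CC _ 0).mul (h1 _)).mono ?_
  rw [zero_add]
  exact (MvPolynomial.le_totalDegree hm).trans hF

theorem slice_coeff {d : ℕ} (hF : F.totalDegree ≤ d) :
    (slice F a b c).coeff d = C ((line F a b).coeff d) := by
  have h1 := (slice_tDeg F a b c hF).natDegree_coeff_le d
  rw [Nat.sub_self] at h1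
  rw [eq_C_of_natDegree_le_zero h1, coeff_zero_eq_eval_zero]
  have h2 := slice_map_eval F a b c 0
  simp only [mul_zero, add_zero] at h2
  rw [← h2, coeff_map, coe_evalRingHom]

theorem line_natDegree_le {d : ℕ} (hF : F.totalDegree ≤ d) : (line F a b).natDegree ≤ d := by
  have h2 := slice_map_eval F a b 0 0
  simp only [mul_zero, add_zero] at h2
  rw [← h2]
  exact natDegree_map_le.trans (slice_tDeg F a b 0 hF).natDegree_le

theorem slice_good [Nontrivial R] {d : ℕ} (hF : F.totalDegree ≤ d)
    (h1 : (line F a b).coeff d = 1) : Good d (slice F a b c) := by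
  have ht := slice_tDeg F a b c hF
  have hc : (slice F a b c).coeff d = 1 := by rw [slice_coeff F a b c hF, h1, C_1]
  have hd : (slice F a b c).natDegree = d :=
    le_antisymm ht.natDegree_le (le_natDegree_of_ne_zero (by simp [hc]))
  exact ⟨by rw [Monic, leadingCoeff, hd, hc], hd, ht⟩

end Slice

section Generic
variable {k σ : Type*} [Field k]

/-- The slice with generic direction `c`. -/
noncomputable def gslice (F : MvPolynomial σ k) (a b : σ → k) : (MvPolynomial σ k)[X][X] :=
  slice F (fun i => MvPolynomial.C (a i)) (fun i => MvPolynomial.C (b i)) MvPolynomial.X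

theorem gslice_map (F : MvPolynomial σ k) (a b c : σ → k) :
    (gslice F a b).map (mapRingHom (MvPolynomial.eval c)) = slice F a b c := by
  have := slice_map F (fun i => MvPolynomial.C (a i)) (fun i => MvPolynomial.C (b i))
    MvPolynomial.X (MvPolynomial.aeval c : MvPolynomial σ k →ₐ[k] k)
  simp only [MvPolynomial.aeval_X, MvPolynomial.algHom_C, Algebra.algebraMap_self_apply] at this
  exact this

theorem line_C_coeff (F : MvPolynomial σ k) (a b : σ → k) {τ : Type*} (d : ℕ) :
    (line F (fun i => (MvPolynomial.C (a i) : MvPolynomial τ k))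
      (fun i => MvPolynomial.C (b i))).coeff d = MvPolynomial.C ((line F a b).coeff d) := by
  have := line_map F a b (Algebra.ofId k (MvPolynomial τ k))
  simp only [Algebra.ofId_apply] at this
  exact (congrArg (fun p => p.coeff d) this.symm).trans (by rw [coeff_map])

theorem gslice_good {F : MvPolynomial σ k} {a b : σ → k} {d : ℕ} (hF : F.totalDegree ≤ d)
    (h1 : (line F a b).coeff d = 1) : Good d (gslice F a b) :=
  slice_good _ _ _ _ hF (by rw [line_C_coeff, h1, map_one])

theorem gslice_irreducible {F : MvPolynomial σ k} {a b : σ → k} {d : ℕ}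
    (hF : F.totalDegree ≤ d) (hirr : Irreducible F) (h1 : (line F a b).coeff d = 1) :
    Irreducible ((gslice F a b).map (mapRingHom
      (algebraMap (MvPolynomial σ k) (FractionRing (MvPolynomial σ k))))) := by
  have hg := gslice_good hF h1
  have hg1 : ((gslice F a b).map (evalRingHom 1)).Monic := hg.monic.map _
  have e1 : (gslice F a b).map (evalRingHom 1) = MvPolynomial.aeval (fun i =>
      C (MvPolynomial.X i) + (C (MvPolynomial.C (a i)) + C (MvPolynomial.C (b i)) * X)) F := by
    rw [gslice, slice_map_eval, line]
    congr 2
    ext1 i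
    rw [mul_one, C_add]
    ring
  have h2 : Irreducible ((gslice F a b).map (evalRingHom 1)) := by
    rw [e1]
    apply irreducible_aeval_shear _ _ _ hirr
    all_goals
      intro i
      simp [MvPolynomial.algHom_C, IsScalarTower.algebraMap_apply k (MvPolynomial σ k) _,
        MvPolynomial.algebraMap_eq]
  rw [hg1.irreducible_iff_irreducible_map_fraction_map
    (K := FractionRing (MvPolynomial σ k))] at h2
  refine (hg.map (algebraMap (MvPolynomial σ k)
    (FractionRing (MvPolynomial σ k)))).monic.irreducible_of_irreducible_map (evalRingHom 1) _ ?_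
  convert h2 using 1
  rw [map_map, map_map]
  congr 1
  ext <;> simp
end Generic

end

section

open Polynomial

section Grid
variable {R : Type*} [CommRing R]

/-- The bivariate polynomial with a given square array of coefficients. -/
noncomputable def gridPoly {D : ℕ} (v : Fin (D + 1) × Fin (D + 1) → R) : R[X][X] :=
  ∑ p, monomial (p.2 : ℕ) (monomial (p.1 : ℕ) (v p))

/-- The first `N` coefficients of the series `α ^ j * X ^ i`. -/
noncomputable def gridMatrix (N D : ℕ) (α : PowerSeries R) :
    Matrix (Fin N) (Fin (D + 1) × Fin (D + 1)) R := fun r p =>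
  PowerSeries.coeff (r : ℕ) (α ^ (p.2 : ℕ) * PowerSeries.X ^ (p.1 : ℕ))

theorem gridPoly_tDeg {D : ℕ} (v : Fin (D + 1) × Fin (D + 1) → R) :
    TDeg (2 * D) (gridPoly v) :=
  TDeg.sum _ _ fun p _ => TDeg.monomial_iff _ _ _ _ (by have := p.1.2; have := p.2.2; omega)

theorem gridPoly_natDegree_le {D : ℕ} (v : Fin (D + 1) × Fin (D + 1) → R) :
    (gridPoly v).natDegree ≤ D :=
  natDegree_sum_le_of_forall_le _ _ fun p _ =>
    (natDegree_monomial_le _).trans (Nat.lt_succ_iff.1 p.2.2)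

theorem gridPoly_coeff_coeff {D : ℕ} (v : Fin (D + 1) × Fin (D + 1) → R)
    (p : Fin (D + 1) × Fin (D + 1)) : ((gridPoly v).coeff p.2).coeff p.1 = v p := by
  classical
  rw [gridPoly, finsetSum_coeff, finsetSum_coeff, Finset.sum_eq_single p]
  · simp
  · intro b _ hb
    rw [coeff_monomial]
    split_ifs with h1
    · rw [coeff_monomial, if_neg]
      intro h2
      exact hb (Prod.ext (Fin.ext h2) (Fin.ext h1))
    · simp
  · simp

theorem TDeg.eq_gridPoly {D : ℕ} {h : R[X][X]} (hh : TDeg D h) :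
    h = gridPoly fun p : Fin (D + 1) × Fin (D + 1) => (h.coeff p.2).coeff p.1 := by
  ext j i
  by_cases hij : i ≤ D ∧ j ≤ D
  · exact (gridPoly_coeff_coeff (fun p : Fin (D + 1) × Fin (D + 1) => (h.coeff p.2).coeff p.1)
      (⟨i, by omega⟩, ⟨j, by omega⟩)).symm
  · rw [hh i j (by omega), gridPoly, finsetSum_coeff, finsetSum_coeff]
    refine (Finset.sum_eq_zero fun p _ => ?_).symm
    rw [coeff_monomial]
    split_ifs with h1
    · rw [coeff_monomial, if_neg]
      have := p.1.2
      have := p.2.2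
      omega
    · simp

theorem coeff_branch_gridPoly {D : ℕ} (N : ℕ) (v : Fin (D + 1) × Fin (D + 1) → R)
    (α : PowerSeries R) (r : Fin N) :
    PowerSeries.coeff (r : ℕ) (branch α (gridPoly v)) = (gridMatrix N D α).mulVec v r := by
  rw [gridPoly, map_sum, map_sum, Matrix.mulVec, dotProduct]
  refine Finset.sum_congr rfl fun p _ => ?_
  rw [← C_mul_X_pow_eq_monomial, ← C_mul_X_pow_eq_monomial, map_mul, map_pow, branch_X, branch_C,
    coe_mul, coe_C, coe_pow, coe_X, gridMatrix, mul_assoc, PowerSeries.coeff_C_mul, mul_comm,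
    mul_comm (PowerSeries.X ^ _)]

theorem gridMatrix_map {R' : Type*} [CommRing R'] (φ : R →+* R') (N D : ℕ) (α : PowerSeries R) :
    (gridMatrix N D α).map φ = gridMatrix N D (PowerSeries.map φ α) := by
  ext r p
  simp only [gridMatrix, Matrix.map_apply, ← PowerSeries.coeff_map, map_mul, map_pow,
    PowerSeries.map_X]

theorem branch_map {R' : Type*} [CommRing R'] (φ : R →+* R') (α : PowerSeries R) (h : R[X][X]) :
    PowerSeries.map φ (branch α h) = branch (PowerSeries.map φ α) (h.map (mapRingHom φ)) := by
  have : (PowerSeries.map φ).comp (branch α : R[X][X] →+* PowerSeries R) =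
      (branch (PowerSeries.map φ α) : R'[X][X] →+* PowerSeries R').comp
        (mapRingHom (mapRingHom φ)) := by
    apply Polynomial.ringHom_ext'
    · apply Polynomial.ringHom_ext'
      · ext1 r
        simp
      · simp
    · simp
  exact congrArg (fun g => g h) this
end Grid

section Generic
variable {k σ : Type*} [Field k]

/-- Power series whose `m`-th coefficient has degree at most `m`. -/
noncomputable def degSubring (k σ : Type*) [Field k] :
    Subring (PowerSeries (MvPolynomial σ k)) where
  carrier := {β | ∀ m, (PowerSeries.coeff m β).totalDegree ≤ m}
  zero_mem' m := by simp
  one_mem' m := by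
    rw [PowerSeries.coeff_one]
    split_ifs <;> simp
  add_mem' {x y} hx hy m := by
    rw [map_add]
    exact (MvPolynomial.totalDegree_add _ _).trans (max_le (hx m) (hy m))
  neg_mem' {x} hx m := by
    rw [map_neg, MvPolynomial.totalDegree_neg]
    exact hx m
  mul_mem' {x y} hx hy m := by
    rw [PowerSeries.coeff_mul]
    refine MvPolynomial.totalDegree_finsetSum_le fun p hp => ?_
    rw [Finset.HasAntidiagonal.mem_antidiagonal] at hp
    refine (MvPolynomial.totalDegree_mul _ _).trans ?_
    rw [← hp]
    exact add_le_add (hx _) (hy _)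

theorem C_mem_degSubring (r : k) :
    PowerSeries.C (MvPolynomial.C r) ∈ degSubring k σ := fun m => by
  rw [PowerSeries.coeff_C]
  split_ifs <;> simp

theorem X_mem_degSubring : PowerSeries.X ∈ degSubring k σ := fun m => by
  rw [PowerSeries.coeff_X]
  split_ifs <;> simp

theorem CX_mul_X_mem_degSubring (i : σ) :
    PowerSeries.C (MvPolynomial.X i) * PowerSeries.X ∈ degSubring k σ := fun m => by
  rw [PowerSeries.coeff_C_mul, PowerSeries.coeff_X]
  split_ifs with h <;> simp [h]

theorem gslice_coeff_mem_degSubring (F : MvPolynomial σ k) (a b : σ → k) (i : ℕ) :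
    ((gslice F a b).map coeToPowerSeries.ringHom).coeff i ∈ degSubring k σ := by
  have key : (gslice F a b).map coeToPowerSeries.ringHom ∈ lifts (degSubring k σ).subtype := by
    rw [← coe_mapRingHom, gslice, slice]
    have hm : ∀ β ∈ degSubring k σ, C β ∈ lifts (degSubring k σ).subtype := fun β hβ =>
      C_mem_lifts _ (⟨β, hβ⟩ : degSubring k σ)
    induction F using MvPolynomial.induction_on with
    | C r =>
      have := hm _ (C_mem_degSubring r)
      have e : (MvPolynomial.aeval fun i => C (C (MvPolynomial.C (a i))) +
          C (C (MvPolynomial.C (b i))) * X + C (C (MvPolynomial.X i) * X) :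
          MvPolynomial σ k →ₐ[k] (MvPolynomial σ k)[X][X]) (MvPolynomial.C r) =
          C (C (MvPolynomial.C r)) := MvPolynomial.aeval_C _ r
      rw [e]
      simpa using this
    | add p q hp hq => simpa only [map_add] using add_mem hp hq
    | mul_X p i hp =>
      rw [map_mul, map_mul]
      refine mul_mem hp ?_
      rw [MvPolynomial.aeval_X, map_add, map_add, map_mul]
      refine add_mem (add_mem ?_ (mul_mem ?_ ?_)) ?_
      · simpa using hm _ (C_mem_degSubring (a i))
      · simpa using hm _ (C_mem_degSubring (b i))
      · simpa using X_mem_lifts (degSubring k σ).subtype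
      · have := hm _ (CX_mul_X_mem_degSubring i)
        simpa using this
  rw [lifts_iff_coeff_lifts] at key
  obtain ⟨β, hβ⟩ := key i
  rw [← hβ]
  exact β.2

theorem exists_generic_branch (F : MvPolynomial σ k) (a b : σ → k) {ζ : k}
    (h0 : (line F a b).eval ζ = 0) (h1 : (derivative (line F a b)).eval ζ ≠ 0) :
    ∃ α ∈ degSubring k σ, PowerSeries.constantCoeff α = MvPolynomial.C ζ ∧
      branch α (gslice F a b) = 0 := by
  set G := (gslice F a b).map coeToPowerSeries.ringHom with hG
  have hl : line F (fun i => (MvPolynomial.C (a i) : MvPolynomial σ k))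
      (fun i => MvPolynomial.C (b i)) = (line F a b).map MvPolynomial.C := by
    ext i
    rw [line_C_coeff, coeff_map]
  have e0 : (gslice F a b).map (evalRingHom 0) = (line F a b).map MvPolynomial.C := by
    rw [gslice, slice_map_eval, ← hl]
    simp
  have c0 : PowerSeries.constantCoeff (G.eval (PowerSeries.C (MvPolynomial.C ζ))) = 0 := by
    have := constantCoeff_branch (PowerSeries.C (MvPolynomial.C ζ)) (gslice F a b)
    rw [branch_apply] at this
    rw [this, ← map_evalRingHom_eval, e0]
    simp [eval_map, h0]
  have c1 : PowerSeries.constantCoeff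
      ((derivative G).eval (PowerSeries.C (MvPolynomial.C ζ))) =
      MvPolynomial.C ((derivative (line F a b)).eval ζ) := by
    have := constantCoeff_branch (PowerSeries.C (MvPolynomial.C ζ)) (derivative (gslice F a b))
    rw [branch_apply, ← derivative_map] at this
    rw [hG, this, ← map_evalRingHom_eval, ← derivative_map, e0, derivative_map]
    simp [eval_map]
  obtain ⟨α, hα0, hα1, hα2⟩ := exists_powerSeries_root G (MvPolynomial.C ζ)
    (MvPolynomial.C ((derivative (line F a b)).eval ζ)⁻¹) c0
    (by rw [c1, ← map_mul, inv_mul_cancel₀ h1, map_one]) (degSubring k σ)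
    (gslice_coeff_mem_degSubring F a b) (C_mem_degSubring _) (C_mem_degSubring _)
  refine ⟨α, fun m => ?_, hα0, by rw [branch_apply]; exact hα1⟩
  obtain ⟨β, hβ, h⟩ := hα2 m
  rw [h]
  exact hβ m

/-- A branch satisfies a nonzero algebraic relation of degree at most `D`. -/
def LowRel {k : Type*} [Field k] (D : ℕ) (α : PowerSeries k) : Prop :=
  ∃ h : k[X][X], h ≠ 0 ∧ TDeg D h ∧ branch α h = 0

theorem card_lowRel_le {n d D : ℕ} {F : MvPolynomial (Fin n) k} {a b : Fin n → k}
    (hF : F.totalDegree ≤ d) (hirr : Irreducible F) (hab : (line F a b).coeff d = 1)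
    {α : PowerSeries (MvPolynomial (Fin n) k)} (hα : α ∈ degSubring k (Fin n))
    (hα0 : branch α (gslice F a b) = 0) (hD : D < d) (T : Finset k) (A : Finset (Fin n → k))
    (hA : ∀ c ∈ A, (∀ i, c i ∈ T) ∧ LowRel D (PowerSeries.map (MvPolynomial.eval c) α)) :
    (A.card : ℝ) * T.card ≤ ((2 * d * D * (D + 1) ^ 2 : ℕ) : ℝ) * (T.card : ℝ) ^ n := by
  have hg := gslice_good hF hab
  obtain ⟨r, hr⟩ := Matrix.exists_det_submatrix_ne_zero (gridMatrix (d * (2 * D) + 1) D α) (by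
    intro v hv
    have hfL := hg.map (algebraMap (MvPolynomial (Fin n) k)
      (FractionRing (MvPolynomial (Fin n) k)))
    rw [gridMatrix_map] at hv
    have hdvd : (gslice F a b).map (mapRingHom (algebraMap (MvPolynomial (Fin n) k)
      (FractionRing (MvPolynomial (Fin n) k)))) ∣ gridPoly v := by
      by_contra hnd
      obtain ⟨m, hm, hne⟩ := bezout_order hfL (gslice_irreducible hF hirr hab) (gridPoly_tDeg v)
        hnd (branch (PowerSeries.map (algebraMap _ _) α)) (by simp)
        (by rw [← branch_map, hα0, map_zero])
      exact hne (by
        have := coeff_branch_gridPoly (d * (2 * D) + 1) v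
          (PowerSeries.map (algebraMap _ _) α) ⟨m, by omega⟩
        rw [hv] at this
        exact this)
    have h0 : gridPoly v = 0 := by
      by_contra hne
      have := natDegree_le_of_dvd hdvd hne
      rw [hfL.natDegree] at this
      have := gridPoly_natDegree_le v
      omega
    ext p
    rw [← gridPoly_coeff_coeff v p, h0]
    simp)
  refine MvPolynomial.ncard_zeros_le hr (D := 2 * d * D * (D + 1) ^ 2) ?_ T A ?_
  · refine (MvPolynomial.totalDegree_det_le _ (d * (2 * D)) fun i j => ?_).trans ?_
    · have := (mul_mem (pow_mem hα (j.2 : ℕ)) (pow_mem X_mem_degSubring (j.1 : ℕ)) :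
        α ^ (j.2 : ℕ) * PowerSeries.X ^ (j.1 : ℕ) ∈ degSubring k (Fin n)) (r i : ℕ)
      exact this.trans (Nat.lt_succ_iff.1 (r i).2)
    · simp only [Fintype.card_prod, Fintype.card_fin]
      apply le_of_eq
      ring
  · intro c hc
    obtain ⟨h1, h, hne, ht, h0⟩ := hA c hc
    refine ⟨h1, ?_⟩
    rw [ht.eq_gridPoly] at h0 hne
    set v := fun p : Fin (D + 1) × Fin (D + 1) => (h.coeff p.2).coeff p.1
    have hv : v ≠ 0 := by
      intro hv
      apply hne
      simp [gridPoly, hv]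
    rw [RingHom.map_det]
    by_contra hdet
    refine hv (Matrix.eq_zero_of_mulVec_eq_zero hdet ?_)
    ext i
    have := coeff_branch_gridPoly (d * (2 * D) + 1) v
      (PowerSeries.map (MvPolynomial.eval c) α) (r i)
    rw [h0, map_zero, ← gridMatrix_map] at this
    exact this.symm
end Generic

end

section

open Polynomial

theorem exists_monic_irreducible_factors {R : Type*} [CommRing R] [IsDomain R]
    [WfDvdMonoid R[X]] {f : R[X]} (hf : f.Monic) :
    ∃ H : Multiset R[X], (∀ h ∈ H, h.Monic ∧ Irreducible h) ∧ H.prod = f := by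
  induction hn : f.natDegree using Nat.strong_induction_on generalizing f with
  | _ n ih =>
    by_cases h1 : f = 1
    · exact ⟨0, by simp, by simp [h1]⟩
    obtain ⟨p, hp, g, hg⟩ := WfDvdMonoid.exists_irreducible_factor
      (fun hu => h1 (hf.isUnit_iff.1 hu)) hf.ne_zero
    have hlc : p.leadingCoeff * g.leadingCoeff = 1 := by
      rw [← leadingCoeff_mul, ← hg, hf.leadingCoeff]
    have hpm : (C g.leadingCoeff * p).Monic := by
      rw [Monic, leadingCoeff_mul, leadingCoeff_C, mul_comm, hlc]
    have hgm : (C p.leadingCoeff * g).Monic := by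
      rw [Monic, leadingCoeff_mul, leadingCoeff_C, hlc]
    have hpi : Irreducible (C g.leadingCoeff * p) := by
      have hu : IsUnit (C g.leadingCoeff) :=
        isUnit_C.2 (IsUnit.of_mul_eq_one p.leadingCoeff (by rw [mul_comm, hlc]))
      rwa [irreducible_isUnit_mul hu]
    have hmul : (C g.leadingCoeff * p) * (C p.leadingCoeff * g) = f := by
      rw [hg, mul_mul_mul_comm, ← C_mul, mul_comm g.leadingCoeff, hlc, C_1, one_mul]
    have hdeg : 0 < (C g.leadingCoeff * p).natDegree := by
      rw [Nat.pos_iff_ne_zero]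
      intro h0
      rw [hpm.natDegree_eq_zero]  at h0
      exact hpi.not_isUnit (h0 ▸ isUnit_one)
    have hlt : (C p.leadingCoeff * g).natDegree < n := by
      have := hpm.natDegree_mul hgm
      rw [hmul, hn] at this
      omega
    obtain ⟨H, hH, hHp⟩ := ih _ hlt hgm rfl
    refine ⟨(C g.leadingCoeff * p) ::ₘ H, fun h hh => ?_, by rw [Multiset.prod_cons, hHp, hmul]⟩
    rcases Multiset.mem_cons.1 hh with rfl | hh
    · exact ⟨hpm, hpi⟩
    · exact hH h hh

theorem sum_Ico_inv_mul_succ {e d : ℕ} (he : 0 < e) (hed : e ≤ d) :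
    ∑ D ∈ Finset.Ico e d, (1 : ℝ) / (D * (D + 1)) = 1 / e - 1 / d := by
  induction d, hed using Nat.le_induction with
  | base => simp
  | succ d hed ih =>
    rw [Finset.sum_Ico_succ_top hed, ih]
    have : (0 : ℝ) < d := by exact_mod_cast he.trans_le hed
    push_cast
    field_simp
    ring

open Classical in
/-- The weight of a branch, large if the branch satisfies an algebraic relation of low degree. -/
noncomputable def relWeight {k : Type*} [Field k] (d : ℕ) (α : PowerSeries k) : ℝ :=
  ∑ D ∈ Finset.Ico 1 d, if LowRel D α then (1 : ℝ) / (D * (D + 1)) else 0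

theorem le_relWeight {k : Type*} [Field k] {d e : ℕ} (he : 0 < e) (hed : e ≤ d)
    {α : PowerSeries k} (h : LowRel e α) : (1 : ℝ) / e - 1 / d ≤ relWeight d α := by
  rw [← sum_Ico_inv_mul_succ he hed, relWeight]
  have hsub : Finset.Ico e d ⊆ Finset.Ico 1 d := Finset.Ico_subset_Ico_left he
  refine le_trans (Finset.sum_le_sum fun D hD => ?_)
    (Finset.sum_le_sum_of_subset_of_nonneg hsub fun D _ _ => ?_)
  · obtain ⟨g, hg, ht, h0⟩ := h
    rw [if_pos ⟨g, hg, ht.mono (Finset.mem_Ico.1 hD).1, h0⟩]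
  · split_ifs <;> positivity

theorem Good.card_factors_le {k : Type*} [Field k] [IsAlgClosed k] {d : ℕ} {f : k[X][X]}
    (hf : Good d f) (hd : 0 < d)
    (hsep : ∀ b, f.evalEval 0 b = 0 → (derivative f).evalEval 0 b ≠ 0)
    {H : Multiset k[X][X]} (hH : ∀ h ∈ H, h.Monic ∧ Irreducible h) (hprod : H.prod = f)
    (α : k → PowerSeries k) (hα : ∀ ζ, f.evalEval 0 ζ = 0 →
      PowerSeries.constantCoeff (α ζ) = ζ ∧ branch (α ζ) f = 0) :
    (H.card : ℝ) - 1 ≤ ((f.map (evalRingHom 0)).roots.map fun ζ => relWeight d (α ζ)).sum := by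
  have h1 : ∀ h ∈ H, (1 : ℝ) - h.natDegree / d ≤
      ((h.map (evalRingHom 0)).roots.map fun ζ => relWeight d (α ζ)).sum := by
    intro h hh
    obtain ⟨hm, hi⟩ := hH h hh
    have hdvd : h ∣ f := hprod ▸ Multiset.dvd_prod hh
    have hg := hf.of_dvd hm hdvd
    have hpos : 0 < h.natDegree := by
      rw [Nat.pos_iff_ne_zero]
      intro h0
      rw [hm.natDegree_eq_zero]  at h0
      exact hi.not_isUnit (h0 ▸ isUnit_one)
    have hle : h.natDegree ≤ d := hf.natDegree ▸ natDegree_le_of_dvd hdvd hf.monic.ne_zero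
    have hcard : (h.map (evalRingHom 0)).roots.card = h.natDegree := by
      rw [← (IsAlgClosed.splits _).natDegree_eq_card_roots, hm.natDegree_map]
    have hw : ∀ x ∈ (h.map (evalRingHom 0)).roots.map (fun ζ => relWeight d (α ζ)),
        (1 : ℝ) / h.natDegree - 1 / d ≤ x := by
      intro x hx
      obtain ⟨ζ, hζ, rfl⟩ := Multiset.mem_map.1 hx
      have hζ0 : h.evalEval 0 ζ = 0 := by
        rw [← map_evalRingHom_eval]
        exact isRoot_of_mem_roots hζ
      obtain ⟨g, hg'⟩ := hdvd
      have hf0 : f.evalEval 0 ζ = 0 := by rw [hg', evalEval_mul, hζ0, zero_mul]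
      obtain ⟨hc, hb⟩ := hα ζ hf0
      refine le_relWeight hpos hle ⟨h, hm.ne_zero, hg.tDeg, ?_⟩
      by_contra hne
      rw [hg', map_mul] at hb
      have hg0 := (mul_eq_zero.1 hb).resolve_left hne
      have := constantCoeff_branch (α ζ) g
      rw [hg0, map_zero, hc] at this
      apply hsep ζ hf0
      rw [hg', derivative_mul, evalEval_add, evalEval_mul, evalEval_mul, hζ0, ← this]
      simp
    have := Multiset.card_nsmul_le_sum hw
    rw [Multiset.card_map, hcard, nsmul_eq_mul] at this
    refine le_trans (le_of_eq ?_) this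
    have : (0 : ℝ) < h.natDegree := by exact_mod_cast hpos
    field_simp
  have h2 : f.map (evalRingHom 0) = (H.map fun h => h.map (evalRingHom 0)).prod := by
    rw [← hprod, ← coe_mapRingHom, map_multiset_prod]
  have h3 : (0 : k[X]) ∉ H.map fun h => h.map (evalRingHom 0) := by
    intro h0
    obtain ⟨h, hh, h0⟩ := Multiset.mem_map.1 h0
    exact ((hH h hh).1.map (evalRingHom 0)).ne_zero h0
  have h4 : (H.map Polynomial.natDegree).sum = d := by
    rw [← natDegree_multiset_prod_of_monic H fun h hh => (hH h hh).1, hprod, hf.natDegree]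
  have h5 : ∀ H' : Multiset k[X][X], (∀ h ∈ H', h ∈ H) →
      (H'.card : ℝ) - ((H'.map Polynomial.natDegree).sum : ℕ) / d ≤ ((((H'.map fun h =>
        h.map (evalRingHom 0)).bind roots).map fun ζ => relWeight d (α ζ)).sum) := by
    intro H'
    induction H' using Multiset.induction_on with
    | empty => simp
    | cons h H' ih =>
      intro hs
      have e1 := ih fun g hg => hs g (Multiset.mem_cons_of_mem hg)
      have e2 := h1 h (hs h (Multiset.mem_cons_self _ _))
      simp only [Multiset.card_cons, Multiset.map_cons, Multiset.sum_cons, Multiset.cons_bind,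
        Multiset.map_add, Multiset.sum_add]
      push_cast
      rw [add_div]
      push_cast at e1
      linarith
  have h6 := h5 H fun _ h => h
  rw [h4, div_self (by exact_mod_cast hd.ne')] at h6
  rwa [h2, roots_multiset_prod _ h3]

theorem Multiset.degree_bounds (E : Multiset ℕ) (hE : ∀ e ∈ E, 1 ≤ e) (hne : E ≠ 0) (s : ℝ)
    (hs : 0 ≤ s) : (E.map fun e : ℕ => ((e : ℝ) - 1) * (e - 2) * s + (e : ℝ) ^ 3).sum ≤
      ((E.sum : ℝ) - 1) * (E.sum - 2) * s + (E.sum : ℝ) ^ 3 := by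
  have h0 : ∀ E : Multiset ℕ, (∀ e ∈ E, 1 ≤ e) → E ≠ 0 → 1 ≤ E.sum := by
    intro E hE hne
    obtain ⟨e, he⟩ := Multiset.exists_mem_of_ne_zero hne
    exact (hE e he).trans (Multiset.single_le_sum (by simp) e he)
  induction E using Multiset.induction_on with
  | empty => exact absurd rfl hne
  | cons e E ih =>
    by_cases hE0 : E = 0
    · simp [hE0]
    have e1 : (1 : ℝ) ≤ e := by exact_mod_cast hE e (Multiset.mem_cons_self _ _)
    have e2 : (1 : ℝ) ≤ ((E.sum : ℕ) : ℝ) := by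
      exact_mod_cast h0 E (fun x hx => hE x (Multiset.mem_cons_of_mem hx)) hE0
    have e3 := ih (fun x hx => hE x (Multiset.mem_cons_of_mem hx)) hE0
    rw [Multiset.map_cons, Multiset.sum_cons, Multiset.sum_cons, Nat.cast_add]
    set u : ℝ := ((E.sum : ℕ) : ℝ)
    have : (e - 1) * (e - 2) + (u - 1) * (u - 2) ≤ ((e : ℝ) + u - 1) * (e + u - 2) := by
      nlinarith
    have e4 : ((e - 1) * (e - 2) + (u - 1) * (u - 2)) * s ≤
        ((e : ℝ) + u - 1) * (e + u - 2) * s := mul_le_mul_of_nonneg_right this hs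
    have e5 : (e : ℝ) ^ 3 + u ^ 3 ≤ (e + u) ^ 3 := by
      have : 0 ≤ (e : ℝ) * u := by positivity
      nlinarith
    nlinarith

universe u

theorem Good.abs_ncard_sub_le_of_factors {K : Type u} [Field K] [Finite K] {d : ℕ} {f : K[X][X]}
    (hf : Good d f) (hd : 0 < d)
    (hsep : ∀ b, (f.map (mapRingHom (algebraMap K (AlgebraicClosure K)))).evalEval 0 b = 0 →
      (derivative (f.map (mapRingHom (algebraMap K (AlgebraicClosure K))))).evalEval 0 b ≠ 0)
    {H : Multiset (AlgebraicClosure K)[X][X]} (hH : ∀ h ∈ H, h.Monic ∧ Irreducible h)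
    (hprod : H.prod = f.map (mapRingHom (algebraMap K (AlgebraicClosure K)))) :
    |((fixedPts (f.map (mapRingHom (algebraMap K (AlgebraicClosure K)))) (Nat.card K)).ncard : ℝ)
      - Nat.card K| ≤ (d - 1) * (d - 2) * √(Nat.card K) + d ^ 3 +
        Nat.card K * ((H.card : ℝ) - 1) := by
  have hfb := hf.map (algebraMap K (AlgebraicClosure K))
  set fb := f.map (mapRingHom (algebraMap K (AlgebraicClosure K))) with hfbdef
  have hdegpos : ∀ h ∈ H, 1 ≤ h.natDegree := by
    intro h hh
    rw [Nat.one_le_iff_ne_zero]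
    intro h0
    rw [(hH h hh).1.natDegree_eq_zero]  at h0
    exact (hH h hh).2.not_isUnit (h0 ▸ isUnit_one)
  have h4 : (H.map Polynomial.natDegree).sum = d := by
    rw [← natDegree_multiset_prod_of_monic H fun h hh => (hH h hh).1, hprod, hfb.natDegree]
  have hH0 : H ≠ 0 := by
    rintro rfl
    simp at h4
    omega
  have hcard1 : 1 ≤ H.card := Multiset.card_pos.2 hH0
  by_cases h1 : H.card = 1
  · obtain ⟨h, rfl⟩ := Multiset.card_eq_one.1 h1
    rw [Multiset.prod_singleton] at hprod
    have hirr : Irreducible fb := hprod ▸ (hH h (by simp)).2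
    have := hf.abs_ncard_sub_le hirr hsep
    simpa using this
  have hq : 1 < Nat.card K := Finite.one_lt_card
  have hup : ((fixedPts fb (Nat.card K)).ncard : ℝ) ≤ (d - 1) * (d - 2) * √(Nat.card K) + d ^ 3 +
        Nat.card K * (H.card : ℝ) := by
    have hb : ∀ h ∈ H, ((fixedPts h (Nat.card K)).ncard : ℝ) ≤ Nat.card K +
        ((h.natDegree - 1) * (h.natDegree - 2) * √(Nat.card K) + h.natDegree ^ 3) := by
      intro h hh
      have hdvd : h ∣ fb := hprod ▸ Multiset.dvd_prod hh
      have hg := hfb.of_dvd (hH h hh).1 hdvd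
      refine (hg.ncard_fixedPts_natCard_le (hH h hh).2 ?_).trans_eq (by ring)
      intro b hb0 hb1
      obtain ⟨g, hg'⟩ := hdvd
      refine hsep b (by rw [hg', evalEval_mul, hb0, zero_mul]) ?_
      rw [hg', derivative_mul, evalEval_add, evalEval_mul, evalEval_mul, hb0, hb1]
      simp
    have hsub : ∀ H' : Multiset (AlgebraicClosure K)[X][X], (∀ h ∈ H', h ∈ H) →
        ((fixedPts H'.prod (Nat.card K)).ncard : ℝ) ≤ (H'.map fun h => (Nat.card K +
          (((h.natDegree : ℝ) - 1) * (h.natDegree - 2) * √(Nat.card K) +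
            (h.natDegree : ℝ) ^ 3))).sum := by
      intro H'
      induction H' using Multiset.induction_on with
      | empty =>
        intro _
        have : fixedPts (1 : (AlgebraicClosure K)[X][X]) (Nat.card K) = ∅ := by
          ext x
          simp [fixedPts, evalEval]
        simp [this]
      | cons h H' ih =>
        intro hs
        have e1 := ih fun g hg => hs g (Multiset.mem_cons_of_mem hg)
        have e2 := hb h (hs h (Multiset.mem_cons_self _ _))
        have e3 : fixedPts (h * H'.prod) (Nat.card K) ⊆
            fixedPts h (Nat.card K) ∪ fixedPts H'.prod (Nat.card K) := by
          intro x hx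
          obtain ⟨h0, h1, h2⟩ := hx
          rw [evalEval_mul] at h0
          rcases mul_eq_zero.1 h0 with h0 | h0
          · exact Or.inl ⟨h0, h1, h2⟩
          · exact Or.inr ⟨h0, h1, h2⟩
        have e4 := (Set.ncard_le_ncard e3 ((fixedPts_finite _ hq).union
          (fixedPts_finite _ hq))).trans (Set.ncard_union_le _ _)
        have e5 : ((fixedPts (h * H'.prod) (Nat.card K)).ncard : ℝ) ≤
          (fixedPts h (Nat.card K)).ncard + (fixedPts H'.prod (Nat.card K)).ncard := by
          exact_mod_cast e4
        rw [Multiset.prod_cons, Multiset.map_cons, Multiset.sum_cons]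
        linarith
    have e1 := hsub H fun _ h => h
    rw [hprod, Multiset.sum_map_add, Multiset.map_const', Multiset.sum_replicate,
      nsmul_eq_mul] at e1
    have e2 := Multiset.degree_bounds (H.map Polynomial.natDegree) (by
      intro e he
      obtain ⟨h, hh, rfl⟩ := Multiset.mem_map.1 he
      exact hdegpos h hh) (by simpa using hH0) (√(Nat.card K)) (by positivity)
    rw [h4, Multiset.map_map] at e2
    simp only [Function.comp_def] at e2
    linarith
  have h2 : (2 : ℝ) ≤ H.card := by exact_mod_cast (by omega : 2 ≤ H.card)
  have hd1 : (1 : ℝ) ≤ d := by exact_mod_cast hd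
  have hnn : 0 ≤ ((d : ℝ) - 1) * (d - 2) := by
    rcases Nat.lt_or_ge d 2 with h | h
    · have : d = 1 := by omega
      simp [this]
    · have : (2 : ℝ) ≤ d := by exact_mod_cast h
      exact mul_nonneg (by linarith) (by linarith)
  have hA : 0 ≤ ((d : ℝ) - 1) * (d - 2) * √(Nat.card K) + d ^ 3 := by positivity
  have hN : (0 : ℝ) ≤ (fixedPts fb (Nat.card K)).ncard := by positivity
  have hq' : (0 : ℝ) ≤ Nat.card K := by positivity
  rw [abs_le]
  constructor
  · nlinarith
  · linarith

end

section

open Polynomial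

theorem Multiset.sum_finsetSum_comm {ι κ : Type*} (s : Finset ι) (Z : Multiset κ)
    (g : ι → κ → ℝ) : ∑ c ∈ s, (Z.map (g c)).sum = (Z.map fun ζ => ∑ c ∈ s, g c ζ).sum := by
  induction Z using Multiset.induction_on with
  | empty => simp
  | cons z Z ih => simp [Finset.sum_add_distrib, ih]

theorem sum_Ico_two_mul_succ {d : ℕ} (hd : 1 ≤ d) :
    ∑ D ∈ Finset.Ico 1 d, (2 : ℝ) * (D + 1) = d ^ 2 + d - 2 := by
  induction d, hd using Nat.le_induction with
  | base => norm_num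
  | succ d hd ih =>
    rw [Finset.sum_Ico_succ_top hd, ih]
    push_cast
    ring

section
universe u
variable {K : Type u} [Field K]

theorem line_algebraMap {σ k : Type*} [Field k] [Algebra K k] (F : MvPolynomial σ K)
    (a b : σ → K) : line (MvPolynomial.map (algebraMap K k) F) (fun i => algebraMap K k (a i))
      (fun i => algebraMap K k (b i)) = (line F a b).map (algebraMap K k) := by
  have h1 := line_map F a b (Algebra.ofId K k)
  rw [line, MvPolynomial.aeval_map_algebraMap]
  exact h1.symm

theorem slice_algebraMap {σ k : Type*} [Field k] [Algebra K k] (F : MvPolynomial σ K)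
    (a b c : σ → K) : slice (MvPolynomial.map (algebraMap K k) F) (fun i => algebraMap K k (a i))
      (fun i => algebraMap K k (b i)) (fun i => algebraMap K k (c i)) =
      (slice F a b c).map (mapRingHom (algebraMap K k)) := by
  have h1 := slice_map F a b c (Algebra.ofId K k)
  rw [slice, MvPolynomial.aeval_map_algebraMap]
  exact h1.symm

theorem ncard_zeros_eq_ncard_fixedPts [Finite K] (f : K[X][X]) :
    {p : K × K | f.evalEval p.1 p.2 = 0}.ncard =
      (fixedPts (f.map (mapRingHom (algebraMap K (AlgebraicClosure K)))) (Nat.card K)).ncard := by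
  set φ := algebraMap K (AlgebraicClosure K)
  have hφ : ∀ x y, (f.map (mapRingHom φ)).evalEval (φ x) (φ y) = φ (f.evalEval x y) := fun x y =>
    map_mapRingHom_evalEval φ f x y
  have hfr : ∀ x : K, φ x ^ Nat.card K = φ x := fun x => by
    have : Fintype K := Fintype.ofFinite K
    rw [← map_pow, Nat.card_eq_fintype_card, FiniteField.pow_card]
  rw [← Set.ncard_image_of_injective (f := Prod.map φ φ) _ (φ.injective.prodMap φ.injective)]
  congr 1
  ext ⟨x, y⟩
  constructor
  · rintro ⟨⟨x', y'⟩, h, he⟩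
    obtain ⟨rfl, rfl⟩ := Prod.ext_iff.1 he
    refine ⟨?_, hfr _, hfr _⟩
    have h' : f.evalEval x' y' = 0 := h
    simp [hφ, h']
  · rintro ⟨h, hx, hy⟩
    obtain ⟨x', rfl⟩ := mem_range_algebraMap_of_pow_natCard hx
    obtain ⟨y', rfl⟩ := mem_range_algebraMap_of_pow_natCard hy
    refine ⟨(x', y'), ?_, rfl⟩
    have h' : (f.map (mapRingHom φ)).evalEval (φ x') (φ y') = 0 := h
    rw [hφ] at h'
    exact φ.injective (by rw [h', map_zero])

theorem sum_relWeight_le [Finite K] {n d : ℕ} {F : MvPolynomial (Fin n) (AlgebraicClosure K)}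
    {a b : Fin n → AlgebraicClosure K} (hd : 1 ≤ d)
    (hF : F.totalDegree ≤ d) (hirr : Irreducible F) (hab : (line F a b).coeff d = 1)
    {α : PowerSeries (MvPolynomial (Fin n) (AlgebraicClosure K))} (hα : α ∈ degSubring _ (Fin n))
    (hα0 : branch α (gslice F a b) = 0) [Fintype (Fin n → K)] :
    Nat.card K * ∑ c : Fin n → K, relWeight d (PowerSeries.map (MvPolynomial.eval
      fun i => algebraMap K (AlgebraicClosure K) (c i)) α) ≤
      (d ^ 3 + d ^ 2 - 2 * d) * (Nat.card K : ℝ) ^ n := by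
  classical
  have : Fintype K := Fintype.ofFinite K
  set φ := algebraMap K (AlgebraicClosure K)
  let T : Finset (AlgebraicClosure K) := Finset.univ.map ⟨φ, φ.injective⟩
  have hT : T.card = Nat.card K := by simp [T]
  simp only [relWeight]
  rw [Finset.sum_comm, Finset.mul_sum]
  calc _ ≤ ∑ D ∈ Finset.Ico 1 d, d * (2 * ((D : ℝ) + 1)) * (Nat.card K : ℝ) ^ n := by
        refine Finset.sum_le_sum fun D hD => ?_
        obtain ⟨hD1, hD2⟩ := Finset.mem_Ico.1 hD
        set B : Finset (Fin n → K) := Finset.univ.filter fun c =>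
          LowRel D (PowerSeries.map (MvPolynomial.eval fun i => φ (c i)) α) with hB
        have h1 := card_lowRel_le hF hirr hab hα hα0 hD2 T
          (B.map ⟨fun c i => φ (c i), fun c c' h => funext fun i =>
            φ.injective (congrFun h i)⟩) (by
            intro c hc
            obtain ⟨c, hcB, rfl⟩ := Finset.mem_map.1 hc
            exact ⟨fun i => Finset.mem_map.2 ⟨c i, Finset.mem_univ _, rfl⟩,
              (Finset.mem_filter.1 hcB).2⟩)
        rw [Finset.card_map, hT] at h1
        rw [← Finset.sum_filter, Finset.sum_const, nsmul_eq_mul, ← hB]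
        have hD0 : (0 : ℝ) < D := by exact_mod_cast hD1
        calc (Nat.card K : ℝ) * (B.card * (1 / (D * (D + 1)))) =
            (B.card * Nat.card K) * (1 / (D * (D + 1))) := by ring
          _ ≤ (((2 * d * D * (D + 1) ^ 2 : ℕ) : ℝ) * (Nat.card K : ℝ) ^ n) *
              (1 / (D * (D + 1))) := by gcongr
          _ = _ := by
            push_cast
            field_simp
    _ = _ := by
        rw [← Finset.sum_mul, ← Finset.mul_sum, sum_Ico_two_mul_succ hd]
        ring

theorem sum_abs_ncard_slice_le [Finite K] {n d : ℕ} {F : MvPolynomial (Fin n) K}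
    {a b : Fin n → K} (hd : 1 ≤ d) (hF : F.totalDegree ≤ d)
    (hirr : Irreducible (MvPolynomial.map (algebraMap K (AlgebraicClosure K)) F))
    (hab : (line F a b).coeff d = 1) (hsep : (line F a b).Separable) [Fintype (Fin n → K)] :
    ∑ c : Fin n → K,
      |({p : K × K | (slice F a b c).evalEval p.1 p.2 = 0}.ncard : ℝ) - Nat.card K| ≤
      ((d - 1) * (d - 2) * √(Nat.card K) + d ^ 4 + 2 * d ^ 3) * (Nat.card K : ℝ) ^ n := by
  set φ := algebraMap K (AlgebraicClosure K) with hφ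
  set Fb := MvPolynomial.map φ F with hFb
  set a' : Fin n → AlgebraicClosure K := fun i => φ (a i) with ha'
  set b' : Fin n → AlgebraicClosure K := fun i => φ (b i) with hb'
  have hl : line Fb a' b' = (line F a b).map φ := line_algebraMap F a b
  have hs : ∀ c, slice Fb a' b' (fun i => φ (c i)) = (slice F a b c).map (mapRingHom φ) :=
    slice_algebraMap F a b
  have hFd : Fb.totalDegree ≤ d := (Finset.sup_mono (MvPolynomial.support_map_subset _ _)).trans hF
  have hab' : (line Fb a' b').coeff d = 1 := by rw [hl, coeff_map, hab, map_one]
  have hsep' : (line Fb a' b').Separable := by rw [hl]; exact hsep.map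
  have hder : ∀ ζ, (line Fb a' b').eval ζ = 0 → (derivative (line Fb a' b')).eval ζ ≠ 0 :=
    fun ζ h0 h1 => by
      obtain ⟨u, v, huv⟩ := hsep'
      have := congrArg (eval ζ) huv
      simp [h0, h1] at this
  choose! α hα1 hα2 hα3 using fun ζ (h : (line Fb a' b').eval ζ = 0) =>
    exists_generic_branch Fb a' b' h (hder ζ h)
  have hline0 : ∀ c, (slice Fb a' b' c).map (evalRingHom 0) = line Fb a' b' := by
    intro c
    rw [slice_map_eval]
    simp
  have hev : ∀ c ζ, (slice Fb a' b' c).evalEval 0 ζ = (line Fb a' b').eval ζ := by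
    intro c ζ
    rw [← map_evalRingHom_eval, hline0]
  have hevd : ∀ c ζ, (derivative (slice Fb a' b' c)).evalEval 0 ζ =
      (derivative (line Fb a' b')).eval ζ := by
    intro c ζ
    rw [← map_evalRingHom_eval, ← derivative_map, hline0]
  have hgood : ∀ c, Good d (slice F a b c) := fun c => slice_good F a b c hF hab
  have key : ∀ c : Fin n → K,
      |({p : K × K | (slice F a b c).evalEval p.1 p.2 = 0}.ncard : ℝ) - Nat.card K| ≤
      ((d - 1) * (d - 2) * √(Nat.card K) + d ^ 3) + Nat.card K *
        ((line Fb a' b').roots.map fun ζ => relWeight d (PowerSeries.map (MvPolynomial.eval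
          fun i => φ (c i)) (α ζ))).sum := by
    intro c
    have hfb : Good d (slice Fb a' b' fun i => φ (c i)) := slice_good _ _ _ _ hFd hab'
    obtain ⟨H, hH, hHp⟩ := exists_monic_irreducible_factors hfb.monic
    have hsepc : ∀ b, (slice Fb a' b' fun i => φ (c i)).evalEval 0 b = 0 →
        (derivative (slice Fb a' b' fun i => φ (c i))).evalEval 0 b ≠ 0 := by
      intro b hb
      rw [hevd]
      rw [hev] at hb
      exact hder b hb
    have h1 := hfb.card_factors_le hd hsepc hH hHp (fun ζ => PowerSeries.map
      (MvPolynomial.eval fun i => φ (c i)) (α ζ)) (by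
        intro ζ hζ
        rw [hev] at hζ
        refine ⟨?_, ?_⟩
        · rw [← PowerSeries.coeff_zero_eq_constantCoeff_apply, PowerSeries.coeff_map,
            PowerSeries.coeff_zero_eq_constantCoeff_apply, hα2 ζ hζ, MvPolynomial.eval_C]
        · rw [← gslice_map, ← branch_map, hα3 ζ hζ, map_zero])
    rw [hline0] at h1
    rw [hs] at hsepc hHp
    have h2 := (hgood c).abs_ncard_sub_le_of_factors hd hsepc hH hHp
    rw [ncard_zeros_eq_ncard_fixedPts]
    refine h2.trans ?_
    gcongr
  refine (Finset.sum_le_sum fun c _ => key c).trans ?_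
  rw [Finset.sum_add_distrib, ← Finset.mul_sum, Multiset.sum_finsetSum_comm, Finset.sum_const,
    Finset.card_univ, ← Nat.card_eq_fintype_card, Nat.card_fun, Nat.card_fin, nsmul_eq_mul,
    ← smul_eq_mul (a := (Nat.card K : ℝ)), Multiset.smul_sum, Multiset.map_map]
  have h3 := Multiset.sum_le_card_nsmul ((line Fb a' b').roots.map fun ζ => (Nat.card K : ℝ) *
    ∑ c : Fin n → K, relWeight d (PowerSeries.map (MvPolynomial.eval
          fun i => φ (c i)) (α ζ))) ((d ^ 3 + d ^ 2 - 2 * d) * (Nat.card K : ℝ) ^ n) (by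
      intro x hx
      obtain ⟨ζ, hζ, rfl⟩ := Multiset.mem_map.1 hx
      have hζ0 : (line Fb a' b').eval ζ = 0 := isRoot_of_mem_roots hζ
      exact sum_relWeight_le hd hFd hirr hab' (hα1 ζ hζ0) (hα3 ζ hζ0))
  have h4 : ((line Fb a' b').roots.card : ℝ) ≤ d := by
    exact_mod_cast (card_roots' _).trans (line_natDegree_le Fb a' b' hFd)
  have hd1 : (1 : ℝ) ≤ d := by exact_mod_cast hd
  rw [Multiset.card_map, nsmul_eq_mul] at h3
  have h5 : 0 ≤ ((d : ℝ) ^ 3 + d ^ 2 - 2 * d) * (Nat.card K : ℝ) ^ n :=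
    mul_nonneg (by nlinarith [sq_nonneg ((d : ℝ) - 1)]) (by positivity)
  have h6 := h3.trans (mul_le_mul_of_nonneg_right h4 h5)
  refine (add_le_add_right h6 _).trans ?_
  have h7 : (0 : ℝ) ≤ (Nat.card K : ℝ) ^ n := by positivity
  push_cast
  nlinarith [mul_nonneg (sq_nonneg (d : ℝ)) h7]
end

end

section

open Polynomial

section
variable {σ : Type*} {k : Type*} [Field k]

theorem MvPolynomial.exists_pderiv_ne_zero [Finite k] {F : MvPolynomial σ k}
    (hF : Irreducible F) : ∃ i, MvPolynomial.pderiv i F ≠ 0 := by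
  classical
  by_contra! h
  obtain ⟨p, hp⟩ := CharP.exists k
  have hpp : Fact p.Prime := ⟨CharP.char_is_prime k p⟩
  have hdvd : ∀ m ∈ F.support, ∀ i, p ∣ m i := by
    intro m hm i
    by_contra hi
    have hmi : m i ≠ 0 := fun h0 => hi (by simp [h0])
    have h1 := MvPolynomial.coeff_pderiv (i := i) F (m - Finsupp.single i 1)
    have hm' : m - Finsupp.single i 1 + Finsupp.single i 1 = m := by
      apply tsub_add_cancel_of_le
      rw [Finsupp.single_le_iff]; omega
    rw [h i, MvPolynomial.coeff_zero, hm'] at h1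
    have h2 : (m - Finsupp.single i 1 : σ →₀ ℕ) i + 1 = m i := by simp; omega
    have h3 := congrArg (Nat.cast (R := k)) h2
    rw [Nat.cast_add_one] at h3
    rw [h3] at h1
    rcases mul_eq_zero.1 h1.symm with h4 | h4
    · exact MvPolynomial.mem_support_iff.1 hm h4
    · exact hi ((CharP.cast_eq_zero_iff k p _).1 h4)
  let H : MvPolynomial σ k := ∑ m ∈ F.support,
    MvPolynomial.monomial (m.mapRange (· / p) (by simp)) ((frobeniusEquiv k p).symm (F.coeff m))
  have hH : F = H ^ p := by
    rw [sum_pow_char]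
    conv_lhs => rw [F.as_sum]
    refine Finset.sum_congr rfl fun m hm => ?_
    rw [MvPolynomial.monomial_pow]
    have h1 : p • m.mapRange (· / p) (by simp) = m := by
      ext i
      simp [Nat.mul_div_cancel' (hdvd m hm i)]
    rw [h1]
    congr 1
    exact ((frobeniusEquiv k p).apply_symm_apply _).symm
  rw [hH] at hF
  exact not_irreducible_pow hpp.out.ne_one hF

theorem derivative_line {R : Type*} [CommRing R] [Algebra k R] [Fintype σ] (F : MvPolynomial σ k)
    (a b : σ → R) : derivative (line F a b) =
      ∑ i, C (b i) * line (MvPolynomial.pderiv i F) a b := by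
  classical
  induction F using MvPolynomial.induction_on with
  | C r =>
    have : line (MvPolynomial.C r : MvPolynomial σ k) a b = C (algebraMap k R r) := by
      rw [line, MvPolynomial.algHom_C]; rfl
    rw [this]
    simp [line]
  | add p q hp hq =>
    simp only [line, map_add] at *
    rw [hp, hq, ← Finset.sum_add_distrib]
    simp only [mul_add]
  | mul_X p j hp =>
    simp only [line, map_mul, derivative_mul, MvPolynomial.aeval_X, Derivation.leibniz,
      MvPolynomial.pderiv_X, smul_eq_mul, map_add] at *
    rw [hp, Finset.sum_mul]
    simp only [mul_add, Finset.sum_add_distrib]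
    rw [add_comm]
    congr 1
    · rw [Finset.sum_eq_single j]
      · simp; ring
      · intro i _ hi
        rw [Pi.single_eq_of_ne hi.symm]
        simp
      · simp
    · rw [← Finset.sum_add_distrib]
      exact Finset.sum_congr rfl fun i _ => by ring

theorem coeff_line_zero {R : Type*} [CommRing R] [Algebra k R] (F : MvPolynomial σ k)
    (b : σ → R) (j : ℕ) :
    (line F 0 b).coeff j = MvPolynomial.aeval b (MvPolynomial.homogeneousComponent j F) := by
  classical
  induction F using MvPolynomial.induction_on' with
  | monomial m r =>
    have h : line (MvPolynomial.monomial m r) 0 b =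
        C (algebraMap k R r * m.prod fun i e => b i ^ e) * X ^ m.degree := by
      rw [line, MvPolynomial.aeval_monomial]
      have : algebraMap k R[X] r = C (algebraMap k R r) := rfl
      rw [this, C_mul, mul_assoc]
      congr 1
      simp [Finsupp.prod, mul_pow, Finset.prod_mul_distrib, Finset.prod_pow_eq_pow_sum,
        Finsupp.degree_apply]
    rw [h, coeff_C_mul, coeff_X_pow, MvPolynomial.homogeneousComponent_apply]
    by_cases hr : r = 0
    · simp [hr]
    by_cases hj : j = m.degree
    · subst hj
      simp [MvPolynomial.support_monomial, hr, MvPolynomial.aeval_monomial, Finset.filter_singleton]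
    · simp [MvPolynomial.support_monomial, hr, hj, Ne.symm hj, Finset.filter_singleton]
  | add p q hp hq =>
    simp only [line, map_add, coeff_add] at *
    rw [hp, hq]

theorem MvPolynomial.homogeneousComponent_totalDegree_ne_zero {F : MvPolynomial σ k} (hF : F ≠ 0) :
    MvPolynomial.homogeneousComponent F.totalDegree F ≠ 0 := by
  obtain ⟨m, hm, h⟩ := Finset.exists_mem_eq_sup F.support (MvPolynomial.support_nonempty.2 hF)
    (fun m => m.sum fun _ e => e)
  intro h0
  have h1 := congrArg (MvPolynomial.coeff m) h0
  rw [MvPolynomial.coeff_homogeneousComponent, if_pos] at h1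
  · exact MvPolynomial.mem_support_iff.1 hm (by simpa using h1)
  · rw [MvPolynomial.totalDegree, h]; rfl
end

section
variable {σ : Type*} {k : Type*} [Field k]

/-- The restriction of `F` to the line through a generic point (variables `inr`) with generic
direction (variables `inl`). -/
noncomputable def genericLine (F : MvPolynomial σ k) : (MvPolynomial (σ ⊕ σ) k)[X] :=
  line F (fun i => MvPolynomial.X (.inr i)) (fun i => MvPolynomial.X (.inl i))

theorem genericLine_map {R : Type*} [CommRing R] [Algebra k R] (F : MvPolynomial σ k)
    (a b : σ → R) : (genericLine F).map
      (MvPolynomial.aeval (Sum.elim b a) : MvPolynomial (σ ⊕ σ) k →ₐ[k] R) = line F a b := by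
  rw [genericLine, line_map]
  simp

theorem MvPolynomial.irreducible_rename_inr {F : MvPolynomial σ k} (hF : Irreducible F)
    {τ : Type*} : Irreducible (MvPolynomial.rename (Sum.inr : σ → τ ⊕ σ) F) := by
  have h := (MvPolynomial.prime_C_iff τ).2 hF.prime
  have h2 := congrArg (fun g => g F) (MvPolynomial.sumAlgEquiv_comp_rename_inr k τ σ)
  have h3 : MvPolynomial.sumAlgEquiv k τ σ (MvPolynomial.rename Sum.inr F) =
    MvPolynomial.C F := h2
  rw [← h3] at h
  exact (MulEquiv.prime_iff (MvPolynomial.sumAlgEquiv k τ σ).toMulEquiv).1 h |>.irreducible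

theorem genericLine_irreducible {F : MvPolynomial σ k} (hF : Irreducible F) :
    Irreducible (genericLine F) := by
  let w : σ ⊕ σ → (MvPolynomial (σ ⊕ σ) k)[X] :=
    Sum.elim 0 fun i => C (MvPolynomial.X (.inl i)) * X
  have h := irreducible_aeval_shear w ?_ ?_ (MvPolynomial.irreducible_rename_inr hF (τ := σ))
  · rw [MvPolynomial.aeval_rename] at h
    exact h
  · rintro (i | i) <;> simp [w]
  · rintro (i | i) <;> simp [w]

theorem coeff_genericLine_ne_zero {F : MvPolynomial σ k} (hF : F ≠ 0) :
    (genericLine F).coeff F.totalDegree ≠ 0 := by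
  intro h
  have h1 := genericLine_map F (0 : σ → MvPolynomial σ k) MvPolynomial.X
  have h2 := coeff_line_zero F (MvPolynomial.X : σ → MvPolynomial σ k) F.totalDegree
  rw [← h1, coeff_map, h, map_zero, MvPolynomial.aeval_X_left_apply] at h2
  exact MvPolynomial.homogeneousComponent_totalDegree_ne_zero hF h2.symm

theorem derivative_genericLine_ne_zero [Finite k] [Fintype σ] {F : MvPolynomial σ k}
    (hF : Irreducible F) : derivative (genericLine F) ≠ 0 := by
  classical
  obtain ⟨i, hi⟩ := MvPolynomial.exists_pderiv_ne_zero hF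
  intro h
  have h1 := genericLine_map F (MvPolynomial.X : σ → MvPolynomial σ k) (Pi.single i 1)
  have h2 := congrArg (fun g => (derivative g).eval 0) h1
  simp only [derivative_map, h, Polynomial.map_zero, eval_zero, derivative_line, eval_finsetSum,
    eval_mul, eval_C, line_eval] at h2
  rw [Finset.sum_eq_single i] at h2
  · refine hi ?_
    simpa using h2.symm
  · intro j _ hj
    simp [hj]
  · simp

theorem genericLine_natDegree {F : MvPolynomial σ k} (hF : F ≠ 0) :
    (genericLine F).natDegree = F.totalDegree :=
  le_antisymm (line_natDegree_le F _ _ le_rfl) (le_natDegree_of_ne_zero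
    (coeff_genericLine_ne_zero hF))
end

section
variable {L : Type*} [Field L]

theorem resultant_ne_zero_iff_of_natDegree_le {f g : L[X]} {m : ℕ} (hf : f ≠ 0)
    (hg : g.natDegree ≤ m) : resultant f g f.natDegree m ≠ 0 ↔ IsCoprime f g := by
  obtain ⟨e, rfl⟩ := Nat.exists_eq_add_of_le hg
  rw [resultant_add_right_deg _ _ _ _ _ le_rfl, mul_ne_zero_iff, Ne, Ne, resultant_eq_zero_iff]
  simp [hf]

end

section
variable {σ : Type*} {k : Type*} [Field k]

theorem totalDegree_coeff_line_le {τ : Type*} (F : MvPolynomial σ k) {a b : σ → MvPolynomial τ k}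
    (ha : ∀ i, (a i).totalDegree ≤ 1) (hb : ∀ i, (b i).totalDegree ≤ 1) (j : ℕ) :
    ((line F a b).coeff j).totalDegree ≤ F.totalDegree := by
  classical
  have hadd : ∀ {D : ℕ} {p q : (MvPolynomial τ k)[X]}, (∀ j, (p.coeff j).totalDegree ≤ D) →
      (∀ j, (q.coeff j).totalDegree ≤ D) → ∀ j, ((p + q).coeff j).totalDegree ≤ D :=
    fun hp hq j => by
      rw [coeff_add]
      exact (MvPolynomial.totalDegree_add _ _).trans (max_le (hp j) (hq j))
  have hmul : ∀ {D E : ℕ} {p q : (MvPolynomial τ k)[X]}, (∀ j, (p.coeff j).totalDegree ≤ D) →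
      (∀ j, (q.coeff j).totalDegree ≤ E) → ∀ j, ((p * q).coeff j).totalDegree ≤ D + E :=
    fun hp hq j => by
      rw [coeff_mul]
      exact MvPolynomial.totalDegree_finsetSum_le fun x _ =>
        (MvPolynomial.totalDegree_mul _ _).trans (add_le_add (hp _) (hq _))
  have hC : ∀ {D : ℕ} {p : MvPolynomial τ k}, p.totalDegree ≤ D →
      ∀ j, ((C p).coeff j).totalDegree ≤ D := fun hp j => by
    rw [coeff_C]
    split_ifs
    · exact hp
    · simp
  have hlin : ∀ i j, ((C (a i) + C (b i) * X : (MvPolynomial τ k)[X]).coeff j).totalDegree ≤ 1 :=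
    fun i => hadd (hC (ha i)) (by
      intro j
      rw [coeff_C_mul, coeff_X]
      split_ifs
      · simpa using hb i
      · simp)
  have hpow : ∀ i e j, (((C (a i) + C (b i) * X : (MvPolynomial τ k)[X]) ^ e).coeff
      j).totalDegree ≤ e := by
    intro i e
    induction e with
    | zero => simpa using hC (p := (1 : MvPolynomial τ k)) (D := 0) (by simp)
    | succ e ih => rw [pow_succ]; exact hmul ih (hlin i)
  have hprod : ∀ (m : σ →₀ ℕ) (s : Finset σ) j, ((∏ i ∈ s,
      (C (a i) + C (b i) * X : (MvPolynomial τ k)[X]) ^ m i).coeff j).totalDegree ≤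
      ∑ i ∈ s, m i := by
    intro m s
    induction s using Finset.induction_on with
    | empty => simpa using hC (p := (1 : MvPolynomial τ k)) (D := 0) (by simp)
    | insert i s hi ih =>
      rw [Finset.prod_insert hi, Finset.sum_insert hi]
      exact hmul (hpow _ _) ih
  rw [line, MvPolynomial.aeval_def, MvPolynomial.eval₂_eq, finsetSum_coeff]
  refine MvPolynomial.totalDegree_finsetSum_le fun m hm => ?_
  have h1 : algebraMap k (MvPolynomial τ k)[X] (F.coeff m) = C (MvPolynomial.C (F.coeff m)) := rfl
  rw [h1, coeff_C_mul]
  refine (MvPolynomial.totalDegree_mul _ _).trans ?_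
  rw [MvPolynomial.totalDegree_C, zero_add]
  exact (hprod m _ j).trans (MvPolynomial.le_totalDegree hm)

theorem totalDegree_resultant_le {τ : Type*} {f g : (MvPolynomial τ k)[X]} {D : ℕ}
    (hf : ∀ j, (f.coeff j).totalDegree ≤ D) (hg : ∀ j, (g.coeff j).totalDegree ≤ D) (m n : ℕ) :
    (resultant f g m n).totalDegree ≤ (m + n) * D := by
  have h := MvPolynomial.totalDegree_det_le (sylvester f g m n) D ?_
  · simpa [resultant] using h
  · intro i j
    refine Fin.addCases (fun j => ?_) (fun j => ?_) j <;>
    · simp only [sylvester, Matrix.of_apply, Fin.addCases_left, Fin.addCases_right]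
      split_ifs
      · first | exact hg _ | exact hf _
      · simp

theorem exists_polynomial_of_bad_line [Finite k] [Fintype σ] {F : MvPolynomial σ k}
    (hF : Irreducible F) (hd : 1 ≤ F.totalDegree) :
    ∃ B : MvPolynomial (σ ⊕ σ) k, B ≠ 0 ∧ B.totalDegree ≤ 2 * F.totalDegree ^ 2 ∧
      ∀ a b : σ → k, MvPolynomial.aeval (Sum.elim b a) B ≠ 0 →
        (line F a b).coeff F.totalDegree ≠ 0 ∧ (line F a b).Separable := by
  set d := F.totalDegree with hd'
  set P := genericLine F with hP
  have hPd : P.natDegree = d := genericLine_natDegree hF.ne_zero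
  have hPirr : Irreducible P := genericLine_irreducible hF
  have hPc : ∀ j, (P.coeff j).totalDegree ≤ d := totalDegree_coeff_line_le F
    (fun i => (MvPolynomial.totalDegree_X _).le) (fun i => (MvPolynomial.totalDegree_X _).le)
  have hPc' : ∀ j, ((derivative P).coeff j).totalDegree ≤ d := by
    intro j
    rw [coeff_derivative]
    refine (MvPolynomial.totalDegree_mul _ _).trans ?_
    have : ((j : MvPolynomial (σ ⊕ σ) k) + 1).totalDegree = 0 := by
      have : ((j : MvPolynomial (σ ⊕ σ) k) + 1) = MvPolynomial.C ((j : k) + 1) := by simp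
      rw [this, MvPolynomial.totalDegree_C]
    rw [this]
    exact hPc _
  refine ⟨P.coeff d * resultant P (derivative P) d (d - 1), mul_ne_zero
    (coeff_genericLine_ne_zero hF.ne_zero) ?_, ?_, ?_⟩
  · let ι := algebraMap (MvPolynomial (σ ⊕ σ) k) (FractionRing (MvPolynomial (σ ⊕ σ) k))
    have hι : Function.Injective ι := IsFractionRing.injective _ _
    have h1 : Irreducible (P.map ι) :=
      ((hPirr.isPrimitive (by omega)).irreducible_iff_irreducible_map_fraction_map).1 hPirr
    have h2 : (P.map ι).Separable := by
      rw [separable_iff_derivative_ne_zero h1, derivative_map]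
      exact (Polynomial.map_ne_zero_iff hι).2 (derivative_genericLine_ne_zero hF)
    have h3 : (P.map ι).natDegree = d := by rw [natDegree_map_eq_of_injective hι, hPd]
    have h4 := (resultant_ne_zero_iff_of_natDegree_le h1.ne_zero
      (natDegree_derivative_le (P.map ι))).2 h2
    rw [h3, derivative_map, resultant_map_map] at h4
    exact fun h0 => h4 (by rw [h0, map_zero])
  · refine (MvPolynomial.totalDegree_mul _ _).trans ?_
    refine (add_le_add (hPc _) (totalDegree_resultant_le hPc hPc' _ _)).trans ?_
    have : d + (d + (d - 1)) * d = (d + (d - 1) + 1) * d := by ring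
    rw [this, pow_two, ← mul_assoc]
    exact Nat.mul_le_mul_right _ (by omega)
  · intro a b hab
    rw [map_mul, mul_ne_zero_iff] at hab
    have hm : P.map (MvPolynomial.aeval (Sum.elim b a) : MvPolynomial (σ ⊕ σ) k →ₐ[k] k) =
      line F a b := genericLine_map F a b
    have h1 : (line F a b).coeff d ≠ 0 := by
      rw [← hm, coeff_map]; exact hab.1
    have h2 : (line F a b).natDegree = d := le_antisymm (line_natDegree_le F _ _ le_rfl)
      (le_natDegree_of_ne_zero h1)
    refine ⟨h1, ?_⟩
    have h3 := hab.2
    have h4 := resultant_map_map P (derivative P) d (d - 1)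
      (MvPolynomial.aeval (Sum.elim b a) : MvPolynomial (σ ⊕ σ) k →ₐ[k] k).toRingHom
    rw [← derivative_map] at h4
    change resultant (P.map ((MvPolynomial.aeval (Sum.elim b a) :
      MvPolynomial (σ ⊕ σ) k →ₐ[k] k) : MvPolynomial (σ ⊕ σ) k →+* k)) (derivative (P.map
      ((MvPolynomial.aeval (Sum.elim b a) :
      MvPolynomial (σ ⊕ σ) k →ₐ[k] k) : MvPolynomial (σ ⊕ σ) k →+* k))) _ _ = _ at h4
    rw [hm] at h4
    refine (resultant_ne_zero_iff_of_natDegree_le ?_ (natDegree_derivative_le _)).1 ?_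
    · rintro h0; simp [h0] at h1
    · rw [h2, h4]; exact h3
end

end

section

open Polynomial

section
variable {K : Type*} [Field K]

/-- The indicator function of the zero set of `F`. -/
noncomputable def zeroInd {σ : Type*} (F : MvPolynomial σ K) (v : σ → K) : ℝ :=
  open Classical in if MvPolynomial.aeval v F = 0 then 1 else 0

theorem zeroInd_nonneg {σ : Type*} (F : MvPolynomial σ K) (v : σ → K) : 0 ≤ zeroInd F v := by
  unfold zeroInd; split_ifs <;> norm_num

theorem zeroInd_le_one {σ : Type*} (F : MvPolynomial σ K) (v : σ → K) : zeroInd F v ≤ 1 := by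
  unfold zeroInd; split_ifs <;> norm_num

variable [Fintype K]

theorem card_bad_line_le {n : ℕ} {F : MvPolynomial (Fin n) K} (hF : Irreducible F)
    (hd : 1 ≤ F.totalDegree) : ∃ S : Finset ((Fin n → K) × (Fin n → K)),
      (S.card : ℝ) * Fintype.card K ≤
        2 * (F.totalDegree : ℝ) ^ 2 * (Fintype.card K : ℝ) ^ (2 * n) ∧
      ∀ a b : Fin n → K, (a, b) ∉ S →
        (line F a b).coeff F.totalDegree ≠ 0 ∧ (line F a b).Separable := by
  classical
  obtain ⟨B, hB, hBd, h⟩ := exists_polynomial_of_bad_line hF hd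
  let S : Finset ((Fin n → K) × (Fin n → K)) :=
    Finset.univ.filter fun p => MvPolynomial.aeval (Sum.elim p.2 p.1) B = 0
  refine ⟨S, ?_, fun a b hab => h a b fun h0 => hab
    (Finset.mem_filter.2 ⟨Finset.mem_univ _, h0⟩)⟩
  let j : (Fin n → K) × (Fin n → K) → Fin (n + n) → K :=
    fun p => Sum.elim p.2 p.1 ∘ finSumFinEquiv.symm
  have hj : Function.Injective j := by
    intro p p' hp
    have h1 : Sum.elim p.2 p.1 = Sum.elim p'.2 p'.1 :=
      finSumFinEquiv.symm.surjective.injective_comp_right hp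
    refine Prod.ext (funext fun i => ?_) (funext fun i => ?_)
    · exact congrFun h1 (.inr i)
    · exact congrFun h1 (.inl i)
  have h1 := MvPolynomial.ncard_zeros_le (p := MvPolynomial.rename finSumFinEquiv B)
    ((MvPolynomial.rename_injective _ finSumFinEquiv.injective).ne_iff' (map_zero _) |>.2 hB)
    (D := 2 * F.totalDegree ^ 2) ((MvPolynomial.totalDegree_rename_le _ _).trans hBd)
    Finset.univ (S.image j) ?_
  · rw [Finset.card_image_of_injective _ hj, Finset.card_univ] at h1
    rw [two_mul n]
    exact_mod_cast h1
  · intro c hc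
    obtain ⟨p, hp, rfl⟩ := Finset.mem_image.1 hc
    refine ⟨fun _ => Finset.mem_univ _, ?_⟩
    rw [MvPolynomial.eval_rename]
    have h2 : j p ∘ finSumFinEquiv = Sum.elim p.2 p.1 := by
      ext i; simp [j]
    rw [h2]
    exact (Finset.mem_filter.1 hp).2

theorem ncard_zeros_eq_sum {α : Type*} [Fintype α] (p : α → Prop) [DecidablePred p] :
    ({x | p x}.ncard : ℝ) = ∑ x, if p x then (1 : ℝ) else 0 := by
  rw [Finset.sum_boole, Set.ncard_eq_toFinset_card']
  simp

theorem ncard_slice_eq {σ : Type*} (F : MvPolynomial σ K) (a b c : σ → K) :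
    ({p : K × K | (slice F a b c).evalEval p.1 p.2 = 0}.ncard : ℝ) =
      ∑ x, ∑ y, zeroInd F (fun i => a i + c i * x + b i * y) := by
  classical
  rw [ncard_zeros_eq_sum, Fintype.sum_prod_type]
  refine Finset.sum_congr rfl fun x _ => Finset.sum_congr rfl fun y _ => ?_
  rw [slice_evalEval, zeroInd]

variable {n : ℕ} (F : MvPolynomial (Fin n) K)

theorem sum_zeroInd_mul_le {F : MvPolynomial (Fin n) K} (hF : F ≠ 0) :
    (∑ v, zeroInd F v) * Fintype.card K ≤ F.totalDegree * (Fintype.card K : ℝ) ^ n := by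
  classical
  have h := MvPolynomial.ncard_zeros_le hF le_rfl Finset.univ
    (Finset.univ.filter fun v => MvPolynomial.aeval v F = 0) fun c hc =>
      ⟨fun _ => Finset.mem_univ _, (Finset.mem_filter.1 hc).2⟩
  rw [Finset.card_univ] at h
  refine le_trans (le_of_eq ?_) h
  congr 1
  rw [← Finset.sum_boole]
  exact Finset.sum_congr rfl fun v _ => by rw [zeroInd]

theorem sum_sum_slice_le {F : MvPolynomial (Fin n) K} (hF : F ≠ 0) (a b : Fin n → K) :
    ∑ c, ({p : K × K | (slice F a b c).evalEval p.1 p.2 = 0}.ncard : ℝ) ≤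
      (F.totalDegree + 1) * ((Fintype.card K : ℝ) * (Fintype.card K : ℝ) ^ n) := by
  classical
  set q := (Fintype.card K : ℝ) with hq
  have hq0 : 0 ≤ q := by positivity
  have hN : 0 ≤ ∑ v, zeroInd F v := Finset.sum_nonneg fun v _ => zeroInd_nonneg F v
  have h1 : ∀ x y : K, ∑ c : Fin n → K, zeroInd F (fun i => a i + c i * x + b i * y) ≤
      (∑ v, zeroInd F v) + if x = 0 then q ^ n else 0 := by
    intro x y
    split_ifs with hx
    · refine le_trans (Finset.sum_le_sum fun c _ => zeroInd_le_one F _) ?_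
      simp [hq, hN]
    · rw [add_zero]
      refine (Fintype.sum_bijective (fun (c : Fin n → K) i => a i + c i * x + b i * y) ?_ _ _
        fun _ => rfl).le
      rw [← Finite.injective_iff_bijective]
      intro c c' h
      ext i
      have := congrFun h i
      simpa [hx] using this
  simp only [ncard_slice_eq]
  rw [Finset.sum_comm]
  simp only [Finset.sum_comm (s := (Finset.univ : Finset (Fin n → K)))]
  refine (Finset.sum_le_sum fun x _ => Finset.sum_le_sum fun y _ => h1 x y).trans ?_
  simp only [Finset.sum_add_distrib, Finset.sum_const, Finset.card_univ, nsmul_eq_mul,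
    ← Finset.mul_sum, Finset.sum_ite_eq', Finset.mem_univ, if_true, ← hq]
  have h2 := mul_le_mul_of_nonneg_left (sum_zeroInd_mul_le hF) hq0
  rw [← hq] at h2
  linarith

theorem sum_sum_sum_slice : ∑ a, ∑ b, ∑ c,
    ({p : K × K | (slice F a b c).evalEval p.1 p.2 = 0}.ncard : ℝ) =
      (Fintype.card K : ℝ) ^ (2 * n + 2) * ∑ v, zeroInd F v := by
  classical
  have h1 : ∀ (b c : Fin n → K) (x y : K), ∑ a : Fin n → K, zeroInd F (fun i => a i + c i * x + b i * y) =
      ∑ v, zeroInd F v := by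
    intro b c x y
    refine Fintype.sum_bijective (fun (a : Fin n → K) i => a i + c i * x + b i * y) ?_ _ _
      fun _ => rfl
    rw [← Finite.injective_iff_bijective]
    intro a a' h
    ext i
    have := congrFun h i
    simpa using this
  simp only [ncard_slice_eq]
  have h2 : ∑ a : Fin n → K, ∑ b : Fin n → K, ∑ c : Fin n → K, ∑ x, ∑ y, zeroInd F (fun i => a i + c i * x + b i * y) =
      ∑ b : Fin n → K, ∑ c : Fin n → K, ∑ x, ∑ y, ∑ a : Fin n → K, zeroInd F (fun i => a i + c i * x + b i * y) := by
    rw [Finset.sum_comm]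
    refine Finset.sum_congr rfl fun b _ => ?_
    rw [Finset.sum_comm]
    refine Finset.sum_congr rfl fun c _ => ?_
    rw [Finset.sum_comm]
    refine Finset.sum_congr rfl fun x _ => ?_
    rw [Finset.sum_comm]
  rw [h2]
  simp only [h1, Finset.sum_const, Finset.card_univ, nsmul_eq_mul, Fintype.card_pi,
    Finset.prod_const, Fintype.card_fin]
  push_cast
  ring

theorem irreducible_of_map_algebraMap {σ k L : Type*} [Field k] [Field L] [Algebra k L]
    {F : MvPolynomial σ k} (hF : Irreducible (MvPolynomial.map (algebraMap k L) F)) :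
    Irreducible F := by
  have : IsLocalHom (MvPolynomial.map (σ := σ) (algebraMap k L)) := ⟨fun p hp => by
    rw [MvPolynomial.isUnit_iff] at hp ⊢
    refine ⟨?_, fun i hi => ?_⟩
    · have h1 := hp.1
      rw [MvPolynomial.coeff_map] at h1
      exact (isUnit_map_iff _ _).1 h1
    · have h1 := hp.2 i hi
      rw [MvPolynomial.coeff_map, isNilpotent_iff_eq_zero] at h1
      rw [isNilpotent_iff_eq_zero]
      exact (_root_.map_eq_zero _).1 h1⟩
  exact Irreducible.of_map (f := MvPolynomial.map (algebraMap k L)) hF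

theorem sum_abs_ncard_slice_le_of_separable {F : MvPolynomial (Fin n) K}
    (hd : 1 ≤ F.totalDegree)
    (hirr : Irreducible (MvPolynomial.map (algebraMap K (AlgebraicClosure K)) F))
    {a b : Fin n → K} (hab : (line F a b).coeff F.totalDegree ≠ 0)
    (hsep : (line F a b).Separable) :
    ∑ c, |({p : K × K | (slice F a b c).evalEval p.1 p.2 = 0}.ncard : ℝ) - Fintype.card K| ≤
      (((F.totalDegree : ℝ) - 1) * (F.totalDegree - 2) * √(Fintype.card K : ℝ) +
        (F.totalDegree : ℝ) ^ 4 + 2 * (F.totalDegree : ℝ) ^ 3) * (Fintype.card K : ℝ) ^ n := by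
  set r := ((line F a b).coeff F.totalDegree)⁻¹ with hr
  have hr0 : r ≠ 0 := inv_ne_zero hab
  have hl : line (MvPolynomial.C r * F) a b = C r * line F a b := by
    rw [line, map_mul, MvPolynomial.algHom_C]; rfl
  have hu : IsUnit (MvPolynomial.C (σ := Fin n) (algebraMap K (AlgebraicClosure K) r)) :=
    (IsUnit.mk0 _ ((_root_.map_ne_zero _).2 hr0)).map _
  have h := sum_abs_ncard_slice_le (F := MvPolynomial.C r * F) (a := a) (b := b) hd
    ((MvPolynomial.totalDegree_mul _ _).trans (by simp)) (by
      rw [map_mul, MvPolynomial.map_C, irreducible_isUnit_mul hu]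
      exact hirr) (by rw [hl, coeff_C_mul, hr, inv_mul_cancel₀ hab])
    (by
      rw [hl]
      exact hsep.unit_mul (isUnit_C.2 (IsUnit.mk0 _ hr0)))
  rw [Nat.card_eq_fintype_card] at h
  refine le_trans (le_of_eq (Finset.sum_congr rfl fun c _ => ?_)) h
  congr 4
  ext p
  simp only [Set.mem_ofPred_eq, slice_evalEval, map_mul, MvPolynomial.algHom_C]
  simp [hr0]

theorem abs_sum_zeroInd_sub_le {F : MvPolynomial (Fin n) K}
    (hd : 1 ≤ F.totalDegree)
    (hirr : Irreducible (MvPolynomial.map (algebraMap K (AlgebraicClosure K)) F)) :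
    |(Fintype.card K : ℝ) ^ (2 * n + 2) * ∑ v, zeroInd F v -
        Fintype.card K * (Fintype.card K : ℝ) ^ (3 * n)| ≤
      (((F.totalDegree : ℝ) - 1) * (F.totalDegree - 2) * √(Fintype.card K : ℝ) +
        (F.totalDegree : ℝ) ^ 4 + 4 * (F.totalDegree : ℝ) ^ 3) *
          (Fintype.card K : ℝ) ^ (3 * n) := by
  classical
  have hF := irreducible_of_map_algebraMap hirr
  obtain ⟨S, hS, hgood⟩ := card_bad_line_le hF hd
  set q := (Fintype.card K : ℝ) with hq
  set d := (F.totalDegree : ℝ) with hd'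
  have hd1 : 1 ≤ d := by rw [hd']; exact_mod_cast hd
  have hq0 : 0 ≤ q := by positivity
  set M := (d - 1) * (d - 2) * √q + d ^ 4 + 2 * d ^ 3 with hM
  have hM0 : 0 ≤ M * q ^ n := by
    have h1 : 0 ≤ (d - 1) * (d - 2) := by
      rcases hd.eq_or_lt with h | h
      · have : d = 1 := by rw [hd', ← h]; norm_num
        simp [this]
      · have : 2 ≤ d := by rw [hd']; exact_mod_cast h
        exact mul_nonneg (by linarith) (by linarith)
    positivity
  let f : (Fin n → K) × (Fin n → K) → ℝ := fun p =>
    ∑ c, (({z : K × K | (slice F p.1 p.2 c).evalEval z.1 z.2 = 0}.ncard : ℝ) - q)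
  have hf1 : ∀ p ∉ S, |f p| ≤ M * q ^ n := fun p hp => by
    obtain ⟨h1, h2⟩ := hgood p.1 p.2 hp
    exact (Finset.abs_sum_le_sum_abs _ _).trans
      (sum_abs_ncard_slice_le_of_separable hd hirr h1 h2)
  have hf2 : ∀ p, |f p| ≤ d * (q * q ^ n) := fun p => by
    have h1 := sum_sum_slice_le hF.ne_zero p.1 p.2
    have h2 : f p = ∑ c, ({z : K × K | (slice F p.1 p.2 c).evalEval z.1 z.2 = 0}.ncard : ℝ) -
        q * q ^ n := by
      simp [f, Finset.sum_sub_distrib, ← hq, mul_comm]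
    have h3 : 0 ≤ ∑ c, ({z : K × K | (slice F p.1 p.2 c).evalEval z.1 z.2 = 0}.ncard : ℝ) :=
      Finset.sum_nonneg fun _ _ => by positivity
    have h4 : q * q ^ n ≤ d * (q * q ^ n) := le_mul_of_one_le_left (by positivity) hd1
    rw [abs_le, h2]
    constructor <;> linarith
  have hsum : ∑ p, f p = q ^ (2 * n + 2) * ∑ v, zeroInd F v - q * q ^ (3 * n) := by
    rw [hq, ← sum_sum_sum_slice, Fintype.sum_prod_type]
    simp only [f, Finset.sum_sub_distrib, Finset.sum_const, Finset.card_univ, nsmul_eq_mul,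
      Fintype.card_pi, Finset.prod_const, Fintype.card_fin]
    push_cast
    ring
  rw [← hsum]
  have hall : ∀ p, |f p| ≤ M * q ^ n + if p ∈ S then d * (q * q ^ n) else 0 := fun p => by
    split_ifs with hp
    · linarith [hf2 p]
    · linarith [hf1 p hp]
  refine (Finset.abs_sum_le_sum_abs _ _).trans ((Finset.sum_le_sum fun p _ => hall p).trans ?_)
  rw [Finset.sum_add_distrib, Finset.sum_ite_mem]
  simp only [Finset.sum_const, Finset.card_univ, nsmul_eq_mul, Finset.univ_inter,
    Fintype.card_prod, Fintype.card_pi, Finset.prod_const, Fintype.card_fin]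
  push_cast
  rw [← hq]
  have h5 := mul_le_mul_of_nonneg_right hS (show 0 ≤ d * q ^ n by positivity)
  have h6 : q ^ (3 * n) = q ^ n * q ^ n * q ^ n := by ring
  have h7 : q ^ (2 * n) = q ^ n * q ^ n := by ring
  rw [h7] at h5
  rw [h6]
  linear_combination h5

end

end

open MvPolynomial

/-- **Theorem (Cafure & Matera, 2006).** If `F` is an absolutely irreducible polynomial of
degree `d ≥ 1` in `n ≥ 2` variables over the finite field `𝔽_q`, and `N` is its number of
`𝔽_q`-zeros, then `|N - q^{n-1}| ≤ (d-1)(d-2) q^{n-3/2} + 5 d^{13/3} q^{n-2}`. -/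
theorem cafure_matera
    {K : Type*} [Field K] [Fintype K] {n : ℕ} (hn : 2 ≤ n)
    {d : ℕ} (hd : 1 ≤ d)
    (F : MvPolynomial (Fin n) K) (hFdeg : F.totalDegree = d)
    (hFirr : Irreducible (MvPolynomial.map (algebraMap K (AlgebraicClosure K)) F)) :
    |(Set.ncard {x : Fin n → K | eval x F = 0} : ℝ) -
        (Fintype.card K : ℝ) ^ ((n : ℝ) - 1)| ≤
      ((d : ℝ) - 1) * ((d : ℝ) - 2) * (Fintype.card K : ℝ) ^ ((n : ℝ) - 3 / 2) +
        5 * (d : ℝ) ^ ((13 : ℝ) / 3) * (Fintype.card K : ℝ) ^ ((n : ℝ) - 2) := by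
  classical
  subst hFdeg
  have h := abs_sum_zeroInd_sub_le hd hFirr
  have hN : (Set.ncard {x : Fin n → K | eval x F = 0} : ℝ) = ∑ v, zeroInd F v := by
    rw [ncard_zeros_eq_sum]
    exact Finset.sum_congr rfl fun v _ => by rw [zeroInd]; rfl
  rw [hN]
  set N := ∑ v, zeroInd F v
  set q := (Fintype.card K : ℝ) with hq
  set D := (F.totalDegree : ℝ) with hD
  have hq0 : 0 < q := by rw [hq]; exact_mod_cast Fintype.card_pos
  have hD1 : 1 ≤ D := by rw [hD]; exact_mod_cast hd
  have e1 : q ^ (2 * n + 2) * q ^ ((n : ℝ) - 1) = q * q ^ (3 * n) := by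
    rw [← pow_succ', ← Real.rpow_natCast, ← Real.rpow_natCast, ← Real.rpow_add hq0]
    congr 1; push_cast; ring
  have e2 : q ^ (2 * n + 2) * q ^ ((n : ℝ) - 3 / 2) = √q * q ^ (3 * n) := by
    rw [Real.sqrt_eq_rpow, ← Real.rpow_natCast, ← Real.rpow_natCast, ← Real.rpow_add hq0,
      ← Real.rpow_add hq0]
    congr 1; push_cast; ring
  have e3 : q ^ (2 * n + 2) * q ^ ((n : ℝ) - 2) = q ^ (3 * n) := by
    rw [← Real.rpow_natCast, ← Real.rpow_natCast, ← Real.rpow_add hq0]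
    congr 1; push_cast; ring
  have hpos : 0 < q ^ (2 * n + 2) := by positivity
  refine le_of_mul_le_mul_left ?_ hpos
  rw [← abs_of_pos hpos, ← abs_mul, abs_of_pos hpos, mul_sub, e1]
  refine h.trans ?_
  have h4 : D ^ 4 ≤ D ^ ((13 : ℝ) / 3) := by
    rw [← Real.rpow_natCast]
    exact Real.rpow_le_rpow_of_exponent_le hD1 (by norm_num)
  have h3 : D ^ 3 ≤ D ^ 4 := pow_le_pow_right₀ hD1 (by norm_num)
  have h5 : (D ^ 4 + 4 * D ^ 3) * q ^ (3 * n) ≤ 5 * D ^ ((13 : ℝ) / 3) * q ^ (3 * n) :=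
    mul_le_mul_of_nonneg_right (by linarith) (by positivity)
  linear_combination h5 - (D - 1) * (D - 2) * e2 - 5 * D ^ ((13 : ℝ) / 3) * e3
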